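/- Let Q(x) = x₁² − α₂x₂² − α₃x₃² and let ε > 0. Then for any fixed α₂ > 0 and Lebesgue-almost every α₃ ∈ [1/2, 1] there exists a constant C > 0 such that for all sufficiently large N, min over x ∈ ℤ³ with 0 < ‖x‖ ≤ N of |x₁² − α₂x₂² − α₃x₃²| is at most C·N^{−2/5+ε}. -/

import Mathlib

open MeasureTheory Filter

theorem Nat.card_divisors_le_rpow (ε : ℝ) (hε : 0 < ε) :
    ∃ C : ℝ, 1 ≤ C ∧ ∀ n : ℕ, n ≠ 0 → ((n.divisors.card : ℕ) : ℝ) ≤ C * (n : ℝ) ^ ε := by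
  obtain ⟨P, hP⟩ : ∃ P : ℕ, (2 : ℝ) ≤ (P : ℝ) ^ ε := by
    obtain ⟨P, hP⟩ := exists_nat_ge ((2 : ℝ) ^ (1 / ε))
    refine ⟨P, ?_⟩
    calc (2 : ℝ) = ((2 : ℝ) ^ (1 / ε)) ^ ε := by
          rw [← Real.rpow_mul (by norm_num), one_div_mul_cancel hε.ne', Real.rpow_one]
      _ ≤ _ := Real.rpow_le_rpow (by positivity) hP hε.le
  set c : ℝ := 1 + 1 / (ε * Real.log 2) with hc
  have hl2 : 0 < Real.log 2 := Real.log_pos (by norm_num)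
  have hc1 : 1 ≤ c := by rw [hc]; have : 0 < 1 / (ε * Real.log 2) := by positivity
                         linarith
  have key (p : ℕ) (hp : p.Prime) (a : ℕ) :
      (a + 1 : ℝ) ≤ (if p < P then c else 1) * ((p : ℝ) ^ a) ^ ε := by
    have hp2 : (2 : ℝ) ≤ p := by exact_mod_cast hp.two_le
    have e1 : ((p : ℝ) ^ a) ^ ε = ((p : ℝ) ^ ε) ^ a := by
      rw [← Real.rpow_natCast, ← Real.rpow_natCast, ← Real.rpow_mul (by positivity),
        ← Real.rpow_mul (by positivity), mul_comm]
    split_ifs with h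
    · have h1 : 1 + a * (ε * Real.log 2) ≤ ((p : ℝ) ^ a) ^ ε := by
        calc 1 + a * (ε * Real.log 2) ≤ Real.exp (a * (ε * Real.log 2)) := by
              linarith [Real.add_one_le_exp (a * (ε * Real.log 2))]
          _ = ((2 : ℝ) ^ a) ^ ε := by
              rw [← Real.rpow_natCast, ← Real.rpow_mul (by norm_num), Real.rpow_def_of_pos (by norm_num)]
              ring_nf
          _ ≤ _ := by gcongr
      calc (a + 1 : ℝ) ≤ c * (1 + a * (ε * Real.log 2)) := by
            rw [hc]
            have : (1 + 1 / (ε * Real.log 2)) * (1 + a * (ε * Real.log 2)) =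
              1 + a + a * (ε * Real.log 2) + 1 / (ε * Real.log 2) := by field_simp; ring
            rw [this]
            have : 0 ≤ a * (ε * Real.log 2) := by positivity
            have : 0 < 1 / (ε * Real.log 2) := by positivity
            linarith
        _ ≤ _ := by gcongr
    · rw [one_mul, e1]
      have h2 : (2 : ℝ) ≤ (p : ℝ) ^ ε := hP.trans (by
        apply Real.rpow_le_rpow (by positivity) _ hε.le; exact_mod_cast not_lt.mp h)
      calc (a + 1 : ℝ) ≤ 2 ^ a := by exact_mod_cast Nat.lt_two_pow_self
        _ ≤ _ := by gcongr
  refine ⟨c ^ P, one_le_pow₀ hc1, fun n hn => ?_⟩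
  rw [Nat.card_divisors hn]
  push_cast
  calc ∏ p ∈ n.primeFactors, ((n.factorization p : ℝ) + 1)
      ≤ ∏ p ∈ n.primeFactors, ((if p < P then c else 1) * ((p : ℝ) ^ (n.factorization p)) ^ ε) := by
        apply Finset.prod_le_prod
        · intros; positivity
        · intro p hp; exact key p (Nat.prime_of_mem_primeFactors hp) _
    _ = (∏ p ∈ n.primeFactors, (if p < P then c else 1)) *
          (∏ p ∈ n.primeFactors, ((p : ℝ) ^ (n.factorization p))) ^ ε := by
        rw [Finset.prod_mul_distrib, Real.finsetProd_rpow]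
        intros; positivity
    _ ≤ c ^ P * (n : ℝ) ^ ε := by
        have e2 : (∏ p ∈ n.primeFactors, ((p : ℝ) ^ (n.factorization p))) = n := by
          have := Nat.prod_factorization_pow_eq_self hn
          conv_rhs => rw [← this]
          rw [Finsupp.prod]; push_cast; rfl
        rw [e2]
        gcongr
        rw [Finset.prod_ite, Finset.prod_const, Finset.prod_const_one, mul_one]
        apply pow_le_pow_right₀ hc1
        calc _ ≤ (Finset.range P).card := Finset.card_le_card (by
              intro x; simp +contextual)
          _ = P := by simp

theorem exists_many_primes_Ioc :
    ∃ X₀ : ℕ, ∀ x : ℕ, X₀ ≤ x →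
      (x : ℝ) / (4 * Real.log (3 * x)) ≤ (((Finset.Ioc x (3 * x)).filter Nat.Prime).card : ℝ) := by
  have hl2 : 0 < Real.log 2 := Real.log_pos (by norm_num)
  have h1 : ∀ᶠ x : ℝ in atTop, Real.log (x + 1) + 2 * √x * Real.log x ≤ (Real.log 2 / 6) * x := by
    have A : (fun x : ℝ => Real.log (x + 1)) =o[atTop] (fun x : ℝ => x) := by
      have := (Real.isLittleO_log_id_atTop).comp_tendsto (tendsto_atTop_add_const_right atTop (1:ℝ) tendsto_id)
      refine this.trans_isBigO ?_
      apply Asymptotics.IsBigO.of_bound 2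
      filter_upwards [eventually_ge_atTop 1] with x hx
      simp only [Function.comp, id, Real.norm_eq_abs]
      rw [abs_of_pos (by linarith), abs_of_pos (by linarith)]; linarith
    have B : (fun x : ℝ => 2 * √x * Real.log x) =o[atTop] (fun x : ℝ => x) := by
      have h := (isLittleO_log_rpow_atTop (show (0:ℝ) < 1/2 by norm_num))
      have h2 := (Asymptotics.isBigO_refl (fun x : ℝ => 2 * √x) atTop).mul_isLittleO h
      refine h2.trans_isBigO ?_
      apply Asymptotics.IsBigO.of_bound 2
      filter_upwards [eventually_ge_atTop 1] with x hx
      rw [← Real.sqrt_eq_rpow, mul_assoc, Real.mul_self_sqrt (by linarith), norm_mul]; simp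
    filter_upwards [(A.add B).bound (show 0 < Real.log 2 / 6 by positivity), eventually_ge_atTop 1] with x hx hx1
    have := (le_abs_self _).trans hx
    rwa [Real.norm_eq_abs, abs_of_pos (by linarith)] at this
  obtain ⟨R, hR⟩ := eventually_atTop.mp h1
  refine ⟨⌈R⌉₊ + 2, fun x hx => ?_⟩
  have hx1 : 2 ≤ x := by omega
  have hxr : (2:ℝ) ≤ x := by exact_mod_cast hx1
  have hxR : R ≤ x := (Nat.le_ceil R).trans (by exact_mod_cast (by omega : ⌈R⌉₊ ≤ x))
  have h3 := hR (3 * x) (by linarith)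
  have t1 := Chebyshev.theta_ge (3 * x)
  have t2 := Chebyshev.theta_le_log4_mul_x (x := x) (by positivity)
  have l4 : Real.log 4 = 2 * Real.log 2 := by
    rw [show (4:ℝ) = 2 ^ 2 by norm_num, Real.log_pow]; norm_num
  push_cast at t1
  have hlog : 0 < Real.log (3 * x) := Real.log_pos (by linarith)
  have e1 : Chebyshev.theta ((3 * x : ℕ) : ℝ) = Chebyshev.theta x +
      ∑ p ∈ (Finset.Ioc x (3 * x)).filter Nat.Prime, Real.log p := by
    simp only [Chebyshev.theta, Nat.floor_natCast]
    rw [← Finset.sum_union]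
    · congr 1
      ext p; simp only [Finset.mem_filter, Finset.mem_Ioc, Finset.mem_union]
      constructor
      · rintro ⟨⟨a, b⟩, c⟩
        by_cases h : p ≤ x
        · exact Or.inl ⟨⟨a, h⟩, c⟩
        · exact Or.inr ⟨⟨by omega, b⟩, c⟩
      · rintro (⟨⟨a, b⟩, c⟩ | ⟨⟨a, b⟩, c⟩)
        · exact ⟨⟨a, by omega⟩, c⟩
        · exact ⟨⟨by omega, b⟩, c⟩
    · rw [Finset.disjoint_left]
      intro p; simp only [Finset.mem_filter, Finset.mem_Ioc]; omega
  have e2 : ∑ p ∈ (Finset.Ioc x (3 * x)).filter Nat.Prime, Real.log p ≤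
      (((Finset.Ioc x (3 * x)).filter Nat.Prime).card : ℝ) * Real.log (3 * x) := by
    rw [← nsmul_eq_mul]
    apply Finset.sum_le_card_nsmul
    intro p hp
    simp only [Finset.mem_filter, Finset.mem_Ioc] at hp
    apply Real.log_le_log
    · exact_mod_cast hp.2.pos
    · exact_mod_cast hp.1.2
  push_cast at e1
  rw [div_le_iff₀ (by positivity)]
  have l2 : (0.69:ℝ) < Real.log 2 := by linarith [Real.log_two_gt_d9]
  have : Real.log 2 / 2 * x ≤ (((Finset.Ioc x (3 * x)).filter Nat.Prime).card : ℝ) * Real.log (3 * x) := by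
    nlinarith
  nlinarith

theorem norm_sum_range_sq_le (X : ℕ) (f : ℕ → ℂ) (hf : ∀ x, ‖f x‖ ≤ 1) :
    ‖∑ x ∈ Finset.range X, f x‖ ^ 2 ≤ X + 2 * ∑ h ∈ Finset.Ico 1 X,
      ‖∑ x ∈ Finset.range (X - h), f (x + h) * (starRingEnd ℂ) (f x)‖ := by
  have key : ∀ Y : ℕ, ∑ x ∈ Finset.range Y, ∑ y ∈ Finset.range x, f x * (starRingEnd ℂ) (f y)
      = ∑ h ∈ Finset.Ico 1 Y, ∑ x ∈ Finset.range (Y - h), f (x + h) * (starRingEnd ℂ) (f x) := by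
    intro Y
    rw [Finset.sum_sigma', Finset.sum_sigma']
    refine Finset.sum_nbij' (fun p => ⟨p.1 - p.2, p.2⟩) (fun p => ⟨p.2 + p.1, p.2⟩) ?_ ?_ ?_ ?_ ?_
    · rintro ⟨x, y⟩ h; simp at h ⊢; omega
    · rintro ⟨x, y⟩ h; simp at h ⊢; omega
    · rintro ⟨x, y⟩ h; simp at h ⊢; omega
    · rintro ⟨x, y⟩ h; simp at h ⊢
    · rintro ⟨x, y⟩ h; simp at h ⊢
      exact Or.inl (by rw [Nat.add_sub_cancel' h.2.le])
  have sq : ∀ Y : ℕ, ‖∑ x ∈ Finset.range Y, f x‖ ^ 2 ≤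
      Y + 2 * (∑ x ∈ Finset.range Y, ∑ y ∈ Finset.range x, f x * (starRingEnd ℂ) (f y)).re := by
    intro Y
    induction Y with
    | zero => simp
    | succ n ih =>
      rw [Finset.sum_range_succ, Finset.sum_range_succ]
      set S := ∑ x ∈ Finset.range n, f x
      have h1 : ∑ y ∈ Finset.range n, f n * (starRingEnd ℂ) (f y) = f n * (starRingEnd ℂ) S := by
        rw [← Finset.mul_sum, map_sum]
      rw [h1, ← Complex.normSq_eq_norm_sq, Complex.normSq_add, Complex.normSq_eq_norm_sq,
        Complex.normSq_eq_norm_sq]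
      have h2 : (S * (starRingEnd ℂ) (f n)).re = (f n * (starRingEnd ℂ) S).re := by
        simp; ring
      rw [h2, Complex.add_re]
      have h3 : ‖f n‖ ^ 2 ≤ 1 := by
        have := hf n; have := norm_nonneg (f n); nlinarith
      push_cast
      linarith
  refine (sq X).trans ?_
  rw [key]
  have := Complex.re_le_norm (∑ h ∈ Finset.Ico 1 X, ∑ x ∈ Finset.range (X - h),
    f (x + h) * (starRingEnd ℂ) (f x))
  have h2 := norm_sum_le (Finset.Ico 1 X) (fun h => ∑ x ∈ Finset.range (X - h),
    f (x + h) * (starRingEnd ℂ) (f x))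
  linarith

theorem norm_geom_exp_le (c d : ℝ) (hc : c ≠ 0) (hc' : |c| ≤ Real.pi) (X : ℕ) :
    ‖∑ x ∈ Finset.range X, Complex.exp (Complex.I * ((c * x + d : ℝ) : ℂ))‖ ≤ Real.pi / |c| := by
  set w := Complex.exp (Complex.I * (c : ℂ)) with hw
  have h1 : ∀ x : ℕ, Complex.exp (Complex.I * ((c * x + d : ℝ) : ℂ)) =
      w ^ x * Complex.exp (Complex.I * (d : ℂ)) := by
    intro x
    rw [hw, ← Complex.exp_nat_mul, ← Complex.exp_add]
    congr 1; push_cast; ring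
  simp_rw [h1]
  rw [← Finset.sum_mul, norm_mul, mul_comm Complex.I, Complex.norm_exp_ofReal_mul_I, mul_one]
  have hpos : 0 < |c| := abs_pos.2 hc
  have h2 : 2 / Real.pi * |c| ≤ ‖w - 1‖ := by
    rw [hw, Complex.norm_exp_I_mul_ofReal_sub_one, Real.norm_eq_abs, abs_mul, abs_two]
    have := Real.mul_abs_le_abs_sin (x := c / 2) (by rw [abs_div, abs_two]; linarith)
    rw [abs_div, abs_two] at this
    linarith
  have h3 : 0 < 2 / Real.pi * |c| := by have := Real.pi_pos; positivity
  have hw1 : w ≠ 1 := by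
    intro h; rw [h] at h2; simp at h2; linarith
  rw [geom_sum_eq hw1, norm_div]
  have h4 : ‖w ^ X - 1‖ ≤ 2 := by
    refine (norm_sub_le _ _).trans ?_
    rw [norm_pow, hw, mul_comm, Complex.norm_exp_ofReal_mul_I]; norm_num
  calc ‖w ^ X - 1‖ / ‖w - 1‖ ≤ 2 / (2 / Real.pi * |c|) := by gcongr
    _ = Real.pi / |c| := by have := Real.pi_pos; field_simp

theorem eventually_const_le_rpow (C a : ℝ) (ha : 0 < a) : ∃ H₀ : ℝ, 1 ≤ H₀ ∧
    ∀ H, H₀ ≤ H → C ≤ H ^ a := by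
  have := (tendsto_rpow_atTop ha).eventually_ge_atTop C
  obtain ⟨b, hb⟩ := eventually_atTop.1 this
  exact ⟨max 1 b, le_max_left _ _, fun H hH => hb H (le_trans (le_max_right _ _) hH)⟩

theorem coeff_taylor_sub (p : Polynomial ℝ) (k : ℕ) (hp : p.natDegree ≤ k + 1) (h : ℝ) :
    (Polynomial.taylor h p - p).natDegree ≤ k ∧
    (Polynomial.taylor h p - p).coeff k = (k + 1) * h * p.coeff (k + 1) := by
  have h0 : ∀ j, k < j → (Polynomial.taylor h p - p).coeff j = 0 := by
    intro j hj
    rcases Nat.lt_or_ge (k + 1) j with h1 | h1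
    · rw [Polynomial.coeff_sub, Polynomial.coeff_eq_zero_of_natDegree_lt (by rw [Polynomial.natDegree_taylor]; omega),
        Polynomial.coeff_eq_zero_of_natDegree_lt (by omega), sub_zero]
    · have : j = k + 1 := by omega
      subst this
      rw [Polynomial.coeff_sub, Polynomial.taylor_coeff]
      have hd : (Polynomial.hasseDeriv (k+1) p).natDegree = 0 := by
        have := Polynomial.natDegree_hasseDeriv_le p (k+1)
        omega
      rw [Polynomial.eq_C_of_natDegree_eq_zero hd, Polynomial.eval_C, Polynomial.hasseDeriv_coeff]
      simp
  refine ⟨Polynomial.natDegree_le_iff_coeff_eq_zero.2 h0, ?_⟩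
  rw [Polynomial.coeff_sub, Polynomial.taylor_coeff]
  have hd : (Polynomial.hasseDeriv k p).natDegree ≤ 1 := by
    have := Polynomial.natDegree_hasseDeriv_le p k
    omega
  rw [Polynomial.eq_X_add_C_of_natDegree_le_one hd]
  simp only [Polynomial.eval_add, Polynomial.eval_mul, Polynomial.eval_C, Polynomial.eval_X, Polynomial.hasseDeriv_coeff]
  simp [add_comm 1 k]
  ring

theorem weyl_sum_le (k : ℕ) : ∀ a : ℝ, 0 < a → ∃ c : ℝ, 0 < c ∧ ∃ H₀ : ℝ, 1 ≤ H₀ ∧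
    ∀ H : ℝ, H₀ ≤ H → ∀ p : Polynomial ℝ, p.natDegree ≤ k + 1 →
    H ^ (-(k + 1 : ℝ) + a) ≤ |p.coeff (k + 1)| → |p.coeff (k + 1)| ≤ H ^ (-(k : ℝ) - a) →
    ∀ X : ℕ, (X : ℝ) ≤ H →
    ‖∑ x ∈ Finset.range X, Complex.exp (Complex.I * ((p.eval (x : ℝ) : ℝ) : ℂ))‖ ≤ H ^ (1 - c) := by
  induction k with
  | zero =>
    intro a ha
    obtain ⟨H₀, hH1, hH⟩ := eventually_const_le_rpow Real.pi (a / 2) (by positivity)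
    refine ⟨a / 2, by positivity, H₀, hH1, fun H hHH p hp h1 h2 X hX => ?_⟩
    have hH0 : 0 < H := by linarith
    simp only [zero_add] at *
    have hlow : 0 < |p.coeff 1| := lt_of_lt_of_le (Real.rpow_pos_of_pos hH0 _) h1
    have hup : |p.coeff 1| ≤ Real.pi := by
      refine h2.trans ((Real.rpow_le_one_of_one_le_of_nonpos (by linarith) (by simp; linarith)).trans ?_)
      linarith [Real.pi_gt_three]
    have h3 := norm_geom_exp_le (p.coeff 1) (p.coeff 0) (abs_pos.1 hlow) hup X
    have h4 : ∀ x : ℕ, p.eval (x : ℝ) = p.coeff 1 * x + p.coeff 0 := by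
      intro x
      conv_lhs => rw [Polynomial.eq_X_add_C_of_natDegree_le_one hp]
      simp
    simp_rw [h4]
    refine h3.trans ?_
    rw [div_le_iff₀ hlow]
    calc Real.pi ≤ H ^ (a / 2) := hH H hHH
      _ = H ^ (1 - a / 2) * H ^ (-((0 : ℕ) + 1 : ℝ) + a) := by
        rw [← Real.rpow_add hH0]; congr 1; push_cast; ring
      _ ≤ _ := by gcongr
  | succ k ih =>
    intro a ha
    obtain ⟨c', hc', H₁, hH₁, hI⟩ := ih (a / 2) (by positivity)
    obtain ⟨H₂, hH₂, hI₂⟩ := eventually_const_le_rpow ((k : ℝ) + 2) (a / 2) (by positivity)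
    set c := min (a / 2) (min c' 1) with hc
    have hc0 : 0 < c := by simp [hc, ha, hc']
    obtain ⟨H₃, hH₃, hI₃⟩ := eventually_const_le_rpow 7 (c / 2) (by positivity)
    refine ⟨c / 4, by positivity, max H₁ (max H₂ H₃), le_max_of_le_left hH₁, ?_⟩
    intro H hH p hp h1 h2 X hX
    simp only [max_le_iff] at hH
    have hH1 : 1 ≤ H := hH₁.trans hH.1
    have hH0 : 0 < H := by linarith
    set f : ℕ → ℂ := fun x => Complex.exp (Complex.I * ((p.eval (x : ℝ) : ℝ) : ℂ)) with hf
    have hfn : ∀ x, ‖f x‖ = 1 := by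
      intro x; rw [hf]; simp only; rw [mul_comm, Complex.norm_exp_ofReal_mul_I]
    have hm := norm_sum_range_sq_le X f (fun x => (hfn x).le)
    have hterm : ∀ h ∈ Finset.Ico 1 X,
        ‖∑ x ∈ Finset.range (X - h), f (x + h) * (starRingEnd ℂ) (f x)‖ ≤
          (if (h : ℝ) < H ^ (1 - a / 2) then H else 0) + H ^ (1 - c') := by
      intro h hh
      rw [Finset.mem_Ico] at hh
      have hXh : ((X - h : ℕ) : ℝ) ≤ H := le_trans (by exact_mod_cast Nat.sub_le _ _) hX
      split_ifs with hlt
      · refine (norm_sum_le _ _).trans ?_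
        have : ∀ x, ‖f (x + h) * (starRingEnd ℂ) (f x)‖ = 1 := by
          intro x; rw [norm_mul, RCLike.norm_conj, hfn, hfn, one_mul]
        simp only [this, Finset.sum_const, Finset.card_range, nsmul_eq_mul, mul_one]
        have := Real.rpow_nonneg hH0.le (1 - c')
        linarith
      · push Not at hlt
        obtain ⟨hd, hcf⟩ := coeff_taylor_sub p (k + 1) hp (h : ℝ)
        have h3 : ∀ x : ℕ, f (x + h) * (starRingEnd ℂ) (f x) = Complex.exp (Complex.I *
            (((Polynomial.taylor (h : ℝ) p - p).eval (x : ℝ) : ℝ) : ℂ)) := by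
          intro x
          simp only [hf]
          rw [← Complex.exp_conj, ← Complex.exp_add]
          congr 1
          simp [Polynomial.taylor_eval]
          ring
        simp_rw [h3]
        rw [zero_add]
        refine hI H hH.1 _ hd ?_ ?_ (X - h) hXh
        · rw [hcf, abs_mul]
          have e1 : (h : ℝ) ≤ |((↑(k + 1) : ℝ) + 1) * (h : ℝ)| := by
            rw [abs_of_nonneg (by positivity)]
            have : (0 : ℝ) ≤ h := by positivity
            push_cast
            nlinarith [(Nat.cast_nonneg k : (0 : ℝ) ≤ k)]
          calc H ^ (-(k + 1 : ℝ) + a / 2) = H ^ (1 - a / 2) * H ^ (-((k + 1 : ℕ) + 1 : ℝ) + a) := by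
                rw [← Real.rpow_add hH0]; congr 1; push_cast; ring
            _ ≤ _ := by
                refine mul_le_mul (hlt.trans e1) h1 (by positivity) (by positivity)
        · rw [hcf, abs_mul]
          have e1 : |((↑(k + 1) : ℝ) + 1) * (h : ℝ)| ≤ H ^ (a / 2) * H := by
            rw [abs_of_nonneg (by positivity)]
            have : (h : ℝ) ≤ H := le_trans (by exact_mod_cast hh.2.le) hX
            gcongr
            have := hI₂ H hH.2.1
            push_cast; linarith
          calc _ ≤ H ^ (a / 2) * H * H ^ (-((k + 1 : ℕ) : ℝ) - a) := by gcongr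
            _ = H ^ (a / 2) * H ^ (1 : ℝ) * H ^ (-((k + 1 : ℕ) : ℝ) - a) := by rw [Real.rpow_one]
            _ = H ^ (-(k : ℝ) - a / 2) := by
                rw [← Real.rpow_add hH0, ← Real.rpow_add hH0]; congr 1; push_cast; ring
    have hsum := Finset.sum_le_sum hterm
    rw [Finset.sum_add_distrib, Finset.sum_const, nsmul_eq_mul, Finset.sum_ite, Finset.sum_const,
      Finset.sum_const_zero, add_zero, nsmul_eq_mul] at hsum
    have hcard1 : (((Finset.Ico 1 X).filter (fun h : ℕ => (h : ℝ) < H ^ (1 - a / 2))).card : ℝ) ≤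
        H ^ (1 - a / 2) := by
      have hsub : (Finset.Ico 1 X).filter (fun h : ℕ => (h : ℝ) < H ^ (1 - a / 2)) ⊆
          Finset.Ioc 0 ⌊H ^ (1 - a / 2)⌋₊ := by
        intro h hh
        simp only [Finset.mem_filter, Finset.mem_Ico] at hh
        simp only [Finset.mem_Ioc]
        exact ⟨by omega, Nat.le_floor hh.2.le⟩
      have := Finset.card_le_card hsub
      rw [Nat.card_Ioc, Nat.sub_zero] at this
      exact (Nat.cast_le.2 this).trans (Nat.floor_le (by positivity))
    have hcard2 : ((Finset.Ico 1 X).card : ℝ) ≤ H := by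
      rw [Nat.card_Ico]; exact le_trans (by exact_mod_cast Nat.sub_le _ _) hX
    have hb1 : H ^ (1 - a / 2) * H ≤ H ^ (2 - c) := by
      calc H ^ (1 - a / 2) * H = H ^ (1 - a / 2) * H ^ (1 : ℝ) := by rw [Real.rpow_one]
        _ = H ^ (2 - a / 2) := by rw [← Real.rpow_add hH0]; congr 1; ring
        _ ≤ _ := Real.rpow_le_rpow_of_exponent_le hH1 (by linarith [min_le_left (a / 2) (min c' 1)])
    have hb2 : H * H ^ (1 - c') ≤ H ^ (2 - c) := by
      calc H * H ^ (1 - c') = H ^ (1 : ℝ) * H ^ (1 - c') := by rw [Real.rpow_one]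
        _ = H ^ (2 - c') := by rw [← Real.rpow_add hH0]; congr 1; ring
        _ ≤ _ := Real.rpow_le_rpow_of_exponent_le hH1
          (by linarith [(min_le_right (a / 2) (min c' 1)).trans (min_le_left _ _)])
    have hb3 : H ≤ H ^ (2 - c) := by
      calc H = H ^ (1 : ℝ) := by rw [Real.rpow_one]
        _ ≤ _ := Real.rpow_le_rpow_of_exponent_le hH1
          (by linarith [(min_le_right (a / 2) (min c' 1)).trans (min_le_right _ _)])
    have hfin : ‖∑ x ∈ Finset.range X, f x‖ ^ 2 ≤ (H ^ (1 - c / 4)) ^ 2 := by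
      have e1 : (((Finset.Ico 1 X).filter (fun h : ℕ => (h : ℝ) < H ^ (1 - a / 2))).card : ℝ) * H ≤
          H ^ (1 - a / 2) * H := by gcongr
      have e2 : ((Finset.Ico 1 X).card : ℝ) * H ^ (1 - c') ≤ H * H ^ (1 - c') := by gcongr
      have e3 : H ^ (c / 2) * H ^ (2 - c) = (H ^ (1 - c / 4)) ^ 2 := by
        rw [← Real.rpow_natCast, ← Real.rpow_mul hH0.le, ← Real.rpow_add hH0]
        congr 1; push_cast; ring
      have e4 := hI₃ H hH.2.2
      have e5 : 0 ≤ H ^ (2 - c) := by positivity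
      nlinarith
    exact le_of_sq_le_sq hfin (by positivity)

theorem norm_sum_Ioc_shift_le (φ : ℕ → ℂ) (hφ : ∀ x, ‖φ x‖ ≤ 1) (Y L : ℕ) :
    L * ‖∑ z ∈ Finset.Ioc Y (2 * Y), φ z‖ ≤
      (∑ z ∈ Finset.Ioc Y (2 * Y), ‖∑ h ∈ Finset.range L, φ (z + h)‖) + 2 * L ^ 2 := by
  have h1 : ∀ h : ℕ, ‖∑ z ∈ Finset.Ioc Y (2 * Y), φ z - ∑ z ∈ Finset.Ioc Y (2 * Y), φ (z + h)‖
      ≤ 2 * h := by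
    intro h
    have hb : ∀ a : ℕ, ‖∑ z ∈ Finset.Ioc a (a + h), φ z‖ ≤ h := by
      intro a
      refine (norm_sum_le _ _).trans ((Finset.sum_le_sum fun i _ => hφ i).trans ?_)
      simp
    have e1 : ∑ z ∈ Finset.Ioc Y (2 * Y), φ (z + h) = ∑ z ∈ Finset.Ioc (Y + h) (2 * Y + h), φ z := by
      rw [← Finset.map_add_right_Ioc, Finset.sum_map]; rfl
    have e2 := Finset.sum_Ioc_consecutive φ (show Y ≤ 2 * Y by omega) (show 2 * Y ≤ 2 * Y + h by omega)
    have e3 := Finset.sum_Ioc_consecutive φ (show Y ≤ Y + h by omega) (show Y + h ≤ 2 * Y + h by omega)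
    have e4 : ∑ z ∈ Finset.Ioc Y (2 * Y), φ z - ∑ z ∈ Finset.Ioc Y (2 * Y), φ (z + h) =
        ∑ z ∈ Finset.Ioc Y (Y + h), φ z - ∑ z ∈ Finset.Ioc (2 * Y) (2 * Y + h), φ z := by
      rw [e1]; linear_combination e2 - e3
    rw [e4]
    refine (norm_sub_le _ _).trans ?_
    linarith [hb Y, hb (2 * Y)]
  have h2 : (L : ℂ) * ∑ z ∈ Finset.Ioc Y (2 * Y), φ z =
      ∑ z ∈ Finset.Ioc Y (2 * Y), ∑ h ∈ Finset.range L, φ (z + h) +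
      ∑ h ∈ Finset.range L, (∑ z ∈ Finset.Ioc Y (2 * Y), φ z -
        ∑ z ∈ Finset.Ioc Y (2 * Y), φ (z + h)) := by
    rw [Finset.sum_sub_distrib, Finset.sum_comm (s := Finset.Ioc Y (2 * Y))]
    simp
  have h3 : (L : ℝ) * ‖∑ z ∈ Finset.Ioc Y (2 * Y), φ z‖ =
      ‖(L : ℂ) * ∑ z ∈ Finset.Ioc Y (2 * Y), φ z‖ := by
    rw [norm_mul, Complex.norm_natCast]
  rw [h3, h2]
  refine (norm_add_le _ _).trans (add_le_add (norm_sum_le _ _) ?_)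
  refine (norm_sum_le _ _).trans ((Finset.sum_le_sum fun h _ => h1 h).trans ?_)
  have : ∀ h ∈ Finset.range L, (2 * (h : ℝ)) ≤ 2 * L := by
    intro h hh
    have := Finset.mem_range.1 hh
    have : (h : ℝ) ≤ L := by exact_mod_cast this.le
    linarith
  refine (Finset.sum_le_sum this).trans ?_
  simp; nlinarith

theorem norm_exp_sub_exp_le (a b : ℝ) :
    ‖Complex.exp (Complex.I * (a : ℂ)) - Complex.exp (Complex.I * (b : ℂ))‖ ≤ |a - b| := by
  have : Complex.exp (Complex.I * (a : ℂ)) - Complex.exp (Complex.I * (b : ℂ)) =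
      Complex.exp (Complex.I * (b : ℂ)) * (Complex.exp (Complex.I * ((a - b : ℝ) : ℂ)) - 1) := by
    rw [mul_sub, ← Complex.exp_add]; congr 2; push_cast; ring; ring
  rw [this, norm_mul, mul_comm Complex.I, Complex.norm_exp_ofReal_mul_I, one_mul]
  exact Real.norm_exp_I_mul_ofReal_sub_one_le

theorem exists_polynomial_log_approx (k : ℕ) (s z : ℝ) (hz : 0 < z) :
    ∃ p : Polynomial ℝ, p.natDegree ≤ k + 1 ∧ |p.coeff (k + 1)| = |s| / ((k + 1) * z ^ (k + 1)) ∧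
      ∀ h : ℝ, 0 ≤ h → h ≤ z / 2 →
        |s * Real.log (z + h) - p.eval h| ≤ 2 * |s| * (h / z) ^ (k + 2) := by
  refine ⟨Polynomial.C (s * Real.log z) +
    ∑ i ∈ Finset.range (k + 1), Polynomial.C (-s * ((-1 / z) ^ (i + 1) / (i + 1))) *
      Polynomial.X ^ (i + 1), ?_, ?_, ?_⟩
  · refine Polynomial.natDegree_add_le_of_degree_le (by rw [Polynomial.natDegree_C]; omega) ?_
    refine Polynomial.natDegree_sum_le_of_forall_le _ _ fun i hi => ?_
    refine (Polynomial.natDegree_C_mul_X_pow_le _ _).trans ?_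
    have := Finset.mem_range.1 hi
    omega
  · rw [Polynomial.coeff_add, Polynomial.finsetSum_coeff]
    simp only [Polynomial.coeff_C_mul, Polynomial.coeff_X_pow, Polynomial.coeff_C]
    rw [Finset.sum_eq_single k]
    · simp [abs_mul, abs_div, abs_pow, abs_of_pos hz]
      rw [abs_of_nonneg (by positivity : (0:ℝ) ≤ k + 1)]
      field_simp
    · intro b _ hb; simp [Ne.symm hb]
    · simp
  · intro h h0 h1
    have hq : 0 ≤ h / z := by positivity
    have hq2 : h / z ≤ 1 / 2 := by rw [div_le_iff₀ hz]; linarith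
    have hx : |(-(h / z))| < 1 := by rw [abs_neg, abs_of_nonneg hq]; linarith
    have := Real.abs_log_sub_add_sum_range_le hx (k + 1)
    rw [abs_neg, abs_of_nonneg hq] at this
    have e1 : Real.log (z + h) = Real.log z + Real.log (1 - -(h / z)) := by
      rw [← Real.log_mul hz.ne' (by linarith)]; congr 1; field_simp; ring
    rw [e1, Polynomial.eval_add, Polynomial.eval_finsetSum]
    simp only [Polynomial.eval_mul, Polynomial.eval_C, Polynomial.eval_pow, Polynomial.eval_X]
    have e2 : s * (Real.log z + Real.log (1 - -(h / z))) - (s * Real.log z +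
        ∑ i ∈ Finset.range (k + 1), -s * ((-1 / z) ^ (i + 1) / (i + 1)) * h ^ (i + 1)) =
        s * (∑ i ∈ Finset.range (k + 1), (-(h / z)) ^ (i + 1) / (i + 1) +
          Real.log (1 - -(h / z))) := by
      have : ∑ i ∈ Finset.range (k + 1), -s * ((-1 / z) ^ (i + 1) / (i + 1)) * h ^ (i + 1) =
          -s * ∑ i ∈ Finset.range (k + 1), (-(h / z)) ^ (i + 1) / ((i : ℝ) + 1) := by
        rw [Finset.mul_sum]
        refine Finset.sum_congr rfl fun i _ => ?_
        have : (-(h / z)) = (-1 / z) * h := by ring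
        rw [this, mul_pow]; ring
      rw [this]; ring
    rw [e2, abs_mul]
    have e3 : (h / z) ^ (k + 1 + 1) / (1 - h / z) ≤ 2 * (h / z) ^ (k + 2) := by
      rw [div_le_iff₀ (by linarith)]
      have : 0 ≤ (h / z) ^ (k + 2) := by positivity
      show (h / z) ^ (k + 2) ≤ _
      nlinarith
    calc _ ≤ |s| * (2 * (h / z) ^ (k + 2)) := by gcongr; exact this.trans e3
      _ = _ := by ring

theorem norm_sum_exp_log_le_of_pos (A : ℝ) (hA : 1 ≤ A) : ∃ c : ℝ, 0 < c ∧ ∃ Y₀ : ℝ, 1 ≤ Y₀ ∧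
    ∀ Y : ℕ, Y₀ ≤ Y → ∀ s : ℝ, (Y : ℝ) ^ (1 / 2 : ℝ) ≤ s → s ≤ (Y : ℝ) ^ A →
      ‖∑ z ∈ Finset.Ioc Y (2 * Y), Complex.exp (Complex.I * ((s * Real.log z : ℝ) : ℂ))‖ ≤
        (Y : ℝ) ^ (1 - c) := by
  set k := ⌈2 * A⌉₊ with hk
  have hkA : 2 * A ≤ k := Nat.le_ceil _
  set κ : ℝ := k + 3 / 2 with hκ
  have hκ0 : 0 < κ := by positivity
  set δ : ℝ := 1 / (2 * κ) with hδ
  have hδ0 : 0 < δ := by positivity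
  have hδ1 : δ ≤ 1 / 4 := by
    rw [hδ, div_le_div_iff₀ (by positivity) (by positivity)]; linarith
  obtain ⟨c, hc, H₀, hH₀, hweyl⟩ := weyl_sum_le k (δ / 4) (by positivity)
  obtain ⟨Y₁, hY₁, hI₁⟩ := eventually_const_le_rpow (((k : ℝ) + 1) * 2 ^ (k + 1)) (δ / 4) (by positivity)
  obtain ⟨Y₂, hY₂, hI₂⟩ := eventually_const_le_rpow H₀ (1 / 2) (by positivity)
  set c' := min (c / 2) (δ / 2) with hc'
  have hc'0 : 0 < c' := by simp [hc', hc, hδ0]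
  obtain ⟨Y₃, hY₃, hI₃⟩ := eventually_const_le_rpow 6 (c' / 2) (by positivity)
  obtain ⟨Y₄, hY₄, hI₄⟩ := eventually_const_le_rpow 2 δ (by positivity)
  refine ⟨c' / 2, by positivity, max Y₁ (max Y₂ (max Y₃ Y₄)), le_max_of_le_left hY₁, ?_⟩
  intro Y hY s hs1 hs2
  simp only [max_le_iff] at hY
  obtain ⟨hYa, hYb, hYc, hYd⟩ := hY
  have hY1 : (1 : ℝ) ≤ Y := hY₁.trans hYa
  have hY0 : (0 : ℝ) < Y := by linarith
  have hs0 : 0 < s := lt_of_lt_of_le (by positivity) hs1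
  set W : ℝ := s ^ (1 / κ) with hW
  have hW0 : 0 < W := by positivity
  have hWs : s = W ^ κ := by
    rw [hW, ← Real.rpow_mul hs0.le, one_div, inv_mul_cancel₀ hκ0.ne', Real.rpow_one]
  have hWlo : (Y : ℝ) ^ δ ≤ W := by
    calc (Y : ℝ) ^ δ = ((Y : ℝ) ^ (1 / 2 : ℝ)) ^ (1 / κ) := by
          rw [← Real.rpow_mul hY0.le]; congr 1; rw [hδ]; field_simp
      _ ≤ _ := by rw [hW]; gcongr
  have hWhi : W ≤ (Y : ℝ) ^ (1 / 2 : ℝ) := by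
    calc W ≤ ((Y : ℝ) ^ A) ^ (1 / κ) := by rw [hW]; gcongr
      _ = (Y : ℝ) ^ (A * (1 / κ)) := by rw [← Real.rpow_mul hY0.le]
      _ ≤ _ := by
        apply Real.rpow_le_rpow_of_exponent_le hY1
        rw [mul_one_div, div_le_div_iff₀ hκ0 (by positivity)]; linarith
  have hW2 : 2 ≤ W := (hI₄ Y hYd).trans hWlo
  set H : ℝ := Y / W with hH
  have hH0 : 0 < H := by positivity
  have hYHW : (Y : ℝ) = H * W := by rw [hH]; field_simp
  have hHlo : (Y : ℝ) ^ (1 / 2 : ℝ) ≤ H := by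
    rw [hH, le_div_iff₀ hW0]
    calc (Y : ℝ) ^ (1 / 2 : ℝ) * W ≤ (Y : ℝ) ^ (1 / 2 : ℝ) * (Y : ℝ) ^ (1 / 2 : ℝ) := by gcongr
      _ = Y := by rw [← Real.rpow_add hY0]; norm_num
  have hHY : H ≤ Y := by rw [hH]; exact div_le_self hY0.le (by linarith)
  have hHH : H₀ ≤ H := (hI₂ Y hYb).trans hHlo
  have hH1 : 1 ≤ H := hH₀.trans hHH
  set L := ⌊H⌋₊ with hL
  have hLH : (L : ℝ) ≤ H := Nat.floor_le hH0.le
  have hL1 : 1 ≤ L := Nat.le_floor (by simpa using hH1)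
  have hL1' : (1 : ℝ) ≤ L := by exact_mod_cast hL1
  have hHL : H ≤ 2 * L := by
    have := Nat.lt_floor_add_one H
    linarith
  have hsc : s = W ^ (1 / 2 : ℝ) * W ^ (k + 1) := by
    rw [hWs, ← Real.rpow_natCast W (k + 1), ← Real.rpow_add hW0]; congr 1; rw [hκ]; push_cast; ring
  have hWh : (Y : ℝ) ^ (δ / 2) ≤ W ^ (1 / 2 : ℝ) := by
    calc (Y : ℝ) ^ (δ / 2) = ((Y : ℝ) ^ δ) ^ (1 / 2 : ℝ) := by
          rw [← Real.rpow_mul hY0.le]; congr 1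
          ring
      _ ≤ _ := by gcongr
  have hWinv : W ^ (1 / 2 : ℝ) * W⁻¹ ≤ (Y : ℝ) ^ (-(δ / 2)) := by
    have e : W ^ (1 / 2 : ℝ) * W⁻¹ = (W ^ (1 / 2 : ℝ))⁻¹ := by
      rw [← Real.rpow_neg_one W, ← Real.rpow_add hW0, ← Real.rpow_neg hW0.le]; norm_num
    rw [e, Real.rpow_neg hY0.le]
    exact inv_anti₀ (by positivity) hWh
  set φ : ℕ → ℂ := fun z => Complex.exp (Complex.I * ((s * Real.log z : ℝ) : ℂ)) with hφ
  have hφn : ∀ x, ‖φ x‖ ≤ 1 := by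
    intro x; simp only [hφ]; rw [mul_comm, Complex.norm_exp_ofReal_mul_I]
  have hinner : ∀ z ∈ Finset.Ioc Y (2 * Y), ‖∑ h ∈ Finset.range L, φ (z + h)‖ ≤
      H ^ (1 - c) + L * (2 * (Y : ℝ) ^ (-(δ / 2))) := by
    intro z hz
    rw [Finset.mem_Ioc] at hz
    have hz1 : (Y : ℝ) ≤ z := by exact_mod_cast hz.1.le
    have hz2 : (z : ℝ) ≤ 2 * Y := by exact_mod_cast hz.2
    have hz0 : (0 : ℝ) < z := by linarith
    obtain ⟨p, hpd, hpc, hpe⟩ := exists_polynomial_log_approx k s z hz0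
    have hclose : ∀ h ∈ Finset.range L, ‖φ (z + h) - Complex.exp (Complex.I * ((p.eval (h : ℝ) : ℝ) : ℂ))‖ ≤
        2 * (Y : ℝ) ^ (-(δ / 2)) := by
      intro h hh
      have hhL : (h : ℝ) ≤ L := by exact_mod_cast (Finset.mem_range.1 hh).le
      have hhH : (h : ℝ) ≤ H := hhL.trans hLH
      have hHz : H ≤ z / 2 := by
        have : H * 2 ≤ H * W := by gcongr
        linarith
      simp only [hφ]
      refine (norm_exp_sub_exp_le _ _).trans ?_
      push_cast
      refine (hpe h (by positivity) (hhH.trans hHz)).trans ?_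
      have hq : (h : ℝ) / z ≤ W⁻¹ := by
        rw [div_le_iff₀ hz0]
        calc (h : ℝ) ≤ H := hhH
          _ = W⁻¹ * Y := by rw [hH]; ring
          _ ≤ _ := by gcongr
      rw [abs_of_pos hs0]
      calc 2 * s * ((h : ℝ) / z) ^ (k + 2) ≤ 2 * s * (W⁻¹) ^ (k + 2) := by gcongr
        _ = 2 * (W ^ (1 / 2 : ℝ) * W⁻¹) := by
          have e : W ^ (k + 1) * W⁻¹ ^ (k + 2) = W⁻¹ := by
            rw [pow_succ W⁻¹ (k + 1), ← mul_assoc, ← mul_pow, mul_inv_cancel₀ hW0.ne', one_pow,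
              one_mul]
          linear_combination 2 * W⁻¹ ^ (k + 2) * hsc + 2 * W ^ (1 / 2 : ℝ) * e
        _ ≤ _ := by gcongr
    have hw : ‖∑ h ∈ Finset.range L, Complex.exp (Complex.I * ((p.eval (h : ℝ) : ℝ) : ℂ))‖ ≤
        H ^ (1 - c) := by
      refine hweyl H hHH p hpd ?_ ?_ L hLH
      · rw [hpc, abs_of_pos hs0, le_div_iff₀ (by positivity)]
        have e1 : H ^ (-((k : ℝ) + 1) + δ / 4) * H ^ (k + 1) = H ^ (δ / 4) := by
          rw [← Real.rpow_natCast H (k + 1), ← Real.rpow_add hH0]; congr 1; push_cast; ring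
        calc H ^ (-((k : ℝ) + 1) + δ / 4) * ((k + 1) * (z : ℝ) ^ (k + 1))
            ≤ H ^ (-((k : ℝ) + 1) + δ / 4) * ((k + 1) * (2 * (H * W)) ^ (k + 1)) := by
              rw [← hYHW]; gcongr
          _ = (H ^ (-((k : ℝ) + 1) + δ / 4) * H ^ (k + 1)) * (((k : ℝ) + 1) * 2 ^ (k + 1)) * W ^ (k + 1) := by
              rw [mul_pow, mul_pow]; ring
          _ ≤ (Y : ℝ) ^ (δ / 4) * (Y : ℝ) ^ (δ / 4) * W ^ (k + 1) := by
              rw [e1]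
              gcongr
              exact hI₁ Y hYa
          _ = (Y : ℝ) ^ (δ / 2) * W ^ (k + 1) := by
              rw [← Real.rpow_add hY0]; congr 2; ring
          _ ≤ _ := by rw [hsc]; gcongr
      · rw [hpc, abs_of_pos hs0, div_le_iff₀ (by positivity)]
        have e1 : H ^ (-(k : ℝ) - δ / 4) * H ^ (k + 1) = H ^ (1 - δ / 4) := by
          rw [← Real.rpow_natCast H (k + 1), ← Real.rpow_add hH0]; congr 1; push_cast; ring
        have e2 : W ^ (1 / 2 : ℝ) ≤ H ^ (1 - δ / 4) := by
          calc W ^ (1 / 2 : ℝ) ≤ ((Y : ℝ) ^ (1 / 2 : ℝ)) ^ (1 / 2 : ℝ) := by gcongr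
            _ ≤ ((Y : ℝ) ^ (1 / 2 : ℝ)) ^ (1 - δ / 4 : ℝ) := by
              apply Real.rpow_le_rpow_of_exponent_le
              · exact Real.one_le_rpow hY1 (by norm_num)
              · linarith
            _ ≤ _ := by
              have : 0 ≤ 1 - δ / 4 := by linarith
              gcongr
        calc s = W ^ (1 / 2 : ℝ) * W ^ (k + 1) := hsc
          _ ≤ H ^ (1 - δ / 4) * W ^ (k + 1) := by gcongr
          _ = H ^ (-(k : ℝ) - δ / 4) * (1 * (H * W) ^ (k + 1)) := by rw [← e1, mul_pow]; ring
          _ ≤ _ := by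
            rw [← hYHW]
            gcongr
            linarith [(Nat.cast_nonneg k : (0 : ℝ) ≤ k)]
    have hd : ∑ h ∈ Finset.range L, φ (z + h) =
        ∑ h ∈ Finset.range L, Complex.exp (Complex.I * ((p.eval (h : ℝ) : ℝ) : ℂ)) +
        ∑ h ∈ Finset.range L, (φ (z + h) - Complex.exp (Complex.I * ((p.eval (h : ℝ) : ℝ) : ℂ))) := by
      rw [← Finset.sum_add_distrib]; exact Finset.sum_congr rfl fun _ _ => by ring
    rw [hd]
    refine (norm_add_le _ _).trans (add_le_add hw ?_)
    refine (norm_sum_le _ _).trans ((Finset.sum_le_sum hclose).trans ?_)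
    simp
  have hmain := norm_sum_Ioc_shift_le φ hφn Y L
  have hsum := Finset.sum_le_sum hinner
  rw [Finset.sum_const, Nat.card_Ioc, nsmul_eq_mul] at hsum
  have hYY : ((2 * Y - Y : ℕ) : ℝ) = Y := by congr 1; omega
  rw [hYY] at hsum
  have hHc : H ^ (1 - c) ≤ 2 * L * (Y : ℝ) ^ (-c') := by
    calc H ^ (1 - c) = H * H ^ (-c) := by
          rw [sub_eq_add_neg, Real.rpow_add hH0, Real.rpow_one]
      _ ≤ 2 * L * (Y : ℝ) ^ (-c') := by
          gcongr
          rw [Real.rpow_neg hH0.le, Real.rpow_neg hY0.le]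
          refine inv_anti₀ (by positivity) ?_
          calc (Y : ℝ) ^ c' ≤ (Y : ℝ) ^ (1 / 2 * c) :=
                Real.rpow_le_rpow_of_exponent_le hY1 (by linarith [min_le_left (c / 2) (δ / 2)])
            _ = ((Y : ℝ) ^ (1 / 2 : ℝ)) ^ c := by rw [Real.rpow_mul hY0.le]
            _ ≤ _ := by gcongr
  have hδc : (Y : ℝ) ^ (-(δ / 2)) ≤ (Y : ℝ) ^ (-c') :=
    Real.rpow_le_rpow_of_exponent_le hY1 (by linarith [min_le_right (c / 2) (δ / 2)])
  have hLY : (L : ℝ) ≤ Y * (Y : ℝ) ^ (-c') := by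
    calc (L : ℝ) ≤ H := hLH
      _ = Y * W⁻¹ := by rw [hH]; ring
      _ ≤ _ := by
        gcongr
        rw [Real.rpow_neg hY0.le]
        refine inv_anti₀ (by positivity) (le_trans ?_ hWlo)
        exact Real.rpow_le_rpow_of_exponent_le hY1 (by linarith [min_le_right (c / 2) (δ / 2)])
  have hfin : (L : ℝ) * ‖∑ z ∈ Finset.Ioc Y (2 * Y), φ z‖ ≤ L * (6 * (Y * (Y : ℝ) ^ (-c'))) := by
    refine hmain.trans ?_
    have e1 : (Y : ℝ) * (H ^ (1 - c) + L * (2 * (Y : ℝ) ^ (-(δ / 2)))) ≤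
        Y * (2 * L * (Y : ℝ) ^ (-c') + L * (2 * (Y : ℝ) ^ (-c'))) := by gcongr
    have e2 : 2 * (L : ℝ) ^ 2 ≤ 2 * L * (Y * (Y : ℝ) ^ (-c')) := by
      rw [sq, ← mul_assoc]; gcongr
    linarith
  have hfin2 := le_of_mul_le_mul_left hfin (by linarith)
  refine hfin2.trans ?_
  calc 6 * (Y * (Y : ℝ) ^ (-c')) ≤ (Y : ℝ) ^ (c' / 2) * ((Y : ℝ) ^ (1 : ℝ) * (Y : ℝ) ^ (-c')) := by
        rw [Real.rpow_one]; gcongr; exact hI₃ Y hYc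
    _ = _ := by rw [← Real.rpow_add hY0, ← Real.rpow_add hY0]; congr 1; ring

theorem norm_sum_exp_log_le (A : ℝ) (hA : 1 ≤ A) : ∃ c : ℝ, 0 < c ∧ ∃ Y₀ : ℝ, 1 ≤ Y₀ ∧
    ∀ Y : ℕ, Y₀ ≤ Y → ∀ s : ℝ, (Y : ℝ) ^ (1 / 2 : ℝ) ≤ |s| → |s| ≤ (Y : ℝ) ^ A →
      ‖∑ z ∈ Finset.Ioc Y (2 * Y), Complex.exp (Complex.I * ((s * Real.log z : ℝ) : ℂ))‖ ≤
        (Y : ℝ) ^ (1 - c) := by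
  obtain ⟨c, hc, Y₀, hY₀, h⟩ := norm_sum_exp_log_le_of_pos A hA
  refine ⟨c, hc, Y₀, hY₀, fun Y hY s h1 h2 => ?_⟩
  have h3 := h Y hY |s| h1 h2
  rcases abs_cases s with ⟨hs, _⟩ | ⟨hs, _⟩
  · rwa [hs] at h3
  · rw [hs] at h3
    have e : ∑ z ∈ Finset.Ioc Y (2 * Y), Complex.exp (Complex.I * ((s * Real.log z : ℝ) : ℂ)) =
        (starRingEnd ℂ) (∑ z ∈ Finset.Ioc Y (2 * Y),
          Complex.exp (Complex.I * ((-s * Real.log z : ℝ) : ℂ))) := by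
      rw [map_sum]
      refine Finset.sum_congr rfl fun z _ => ?_
      rw [← Complex.exp_conj]
      congr 1
      simp only [map_mul, map_neg, Complex.conj_I, Complex.conj_ofReal, Complex.ofReal_mul,
        Complex.ofReal_neg]
      ring
    rw [e, Complex.norm_conj]
    exact h3

theorem integrable_gaussian_mul_cos (σ : ℝ) (hσ : 0 < σ) (x : ℝ) :
    Integrable fun t : ℝ => Real.exp (-(Real.pi * σ) * t ^ 2) * Real.cos (2 * Real.pi * t * x) := by
  refine (integrable_exp_neg_mul_sq (mul_pos Real.pi_pos hσ)).mul_bdd (c := 1) ?_ ?_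
  · exact (by fun_prop : Continuous fun t : ℝ => Real.cos (2 * Real.pi * t * x)).aestronglyMeasurable
  · exact ae_of_all _ fun t => by rw [Real.norm_eq_abs]; exact Real.abs_cos_le_one _

theorem integral_gaussian_mul_cos (σ : ℝ) (hσ : 0 < σ) (x : ℝ) :
    ∫ t : ℝ, Real.exp (-(Real.pi * σ) * t ^ 2) * Real.cos (2 * Real.pi * t * x) =
      (√σ)⁻¹ * Real.exp (-(Real.pi * x ^ 2 / σ)) := by
  have hb : 0 < ((Real.pi * σ : ℝ) : ℂ).re := by simpa using mul_pos Real.pi_pos hσ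
  have h := fourierIntegral_gaussian hb ((2 * Real.pi * x : ℝ) : ℂ)
  have hr : ((Real.pi : ℂ) / ((Real.pi * σ : ℝ) : ℂ)) ^ (1 / 2 : ℂ) = (((√σ)⁻¹ : ℝ) : ℂ) := by
    have : (Real.pi : ℂ) / ((Real.pi * σ : ℝ) : ℂ) = ((σ⁻¹ : ℝ) : ℂ) := by
      push_cast
      have : (Real.pi : ℂ) ≠ 0 := by exact_mod_cast Real.pi_ne_zero
      field_simp
    rw [this, ← Real.sqrt_inv, Real.sqrt_eq_rpow, Complex.ofReal_cpow (by positivity)]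
    norm_num
  have he : -((2 * Real.pi * x : ℝ) : ℂ) ^ 2 / (4 * ((Real.pi * σ : ℝ) : ℂ)) =
      ((-(Real.pi * x ^ 2 / σ) : ℝ) : ℂ) := by
    push_cast
    have : (Real.pi : ℂ) ≠ 0 := by exact_mod_cast Real.pi_ne_zero
    have : (σ : ℂ) ≠ 0 := by exact_mod_cast hσ.ne'
    field_simp
    ring
  rw [hr, he, ← Complex.ofReal_exp, ← Complex.ofReal_mul] at h
  have h2 := congrArg Complex.re h
  rw [Complex.ofReal_re] at h2
  rw [← h2]
  have h_integral : Integrable fun t : ℝ => Complex.exp (Complex.I * ((2 * Real.pi * x : ℝ) : ℂ) * t) *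
      Complex.exp (-((Real.pi * σ : ℝ) : ℂ) * (t : ℂ) ^ 2) := by
    refine (integrable_cexp_neg_mul_sq hb).bdd_mul (c := 1) ?_ ?_
    · exact (by fun_prop : Continuous fun t : ℝ => Complex.exp (Complex.I * ((2 * Real.pi * x : ℝ) : ℂ) * t)).aestronglyMeasurable
    · refine ae_of_all _ fun t => ?_
      rw [mul_assoc, ← Complex.ofReal_mul, mul_comm, Complex.norm_exp_ofReal_mul_I]
  have h3 := integral_re h_integral
  simp only [RCLike.re_eq_complex_re] at h3
  rw [← h3]
  congr 1
  ext t
  have e1 : Complex.I * ((2 * Real.pi * x : ℝ) : ℂ) * t = ((2 * Real.pi * t * x : ℝ) : ℂ) * Complex.I := by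
    push_cast; ring
  have e2 : -((Real.pi * σ : ℝ) : ℂ) * (t : ℂ) ^ 2 = ((-(Real.pi * σ) * t ^ 2 : ℝ) : ℂ) := by
    push_cast; ring
  rw [e1, e2, ← Complex.ofReal_exp, Complex.re_mul_ofReal, Complex.exp_ofReal_mul_I_re, mul_comm]

/-- The Gaussian probability density of width `1 / A`. -/
noncomputable def gaussianBump (A u : ℝ) : ℝ := A * Real.exp (-Real.pi * A ^ 2 * u ^ 2)

theorem gaussianBump_mul_eq (A B : ℝ) (hA : 0 < A) (hB : 0 < B) (a b u : ℝ) :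
    gaussianBump A (u - a) * gaussianBump B (u - b) =
      (A * B * Real.exp (-(Real.pi * (a - b) ^ 2 / (1 / A ^ 2 + 1 / B ^ 2)))) *
      Real.exp (-(Real.pi * (A ^ 2 + B ^ 2)) *
        (u - (A ^ 2 * a + B ^ 2 * b) / (A ^ 2 + B ^ 2)) ^ 2) := by
  unfold gaussianBump
  have : A * Real.exp (-Real.pi * A ^ 2 * (u - a) ^ 2) * (B * Real.exp (-Real.pi * B ^ 2 * (u - b) ^ 2))
      = A * B * (Real.exp (-Real.pi * A ^ 2 * (u - a) ^ 2) * Real.exp (-Real.pi * B ^ 2 * (u - b) ^ 2)) := by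
    ring
  rw [this, mul_assoc (A * B), ← Real.exp_add, ← Real.exp_add]
  congr 2
  have h1 : A ^ 2 + B ^ 2 ≠ 0 := by positivity
  field_simp
  ring

theorem integrable_gaussianBump_mul (A B : ℝ) (hA : 0 < A) (hB : 0 < B) (a b : ℝ) :
    Integrable fun u => gaussianBump A (u - a) * gaussianBump B (u - b) := by
  simp_rw [gaussianBump_mul_eq A B hA hB]
  refine Integrable.const_mul ?_ _
  exact (integrable_exp_neg_mul_sq (b := Real.pi * (A ^ 2 + B ^ 2))
    (by have := Real.pi_pos; positivity)).comp_sub_right _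

theorem integral_gaussianBump_mul (A B : ℝ) (hA : 0 < A) (hB : 0 < B) (a b : ℝ) :
    ∫ u, gaussianBump A (u - a) * gaussianBump B (u - b) =
      ∫ t : ℝ, Real.exp (-(Real.pi * (1 / A ^ 2 + 1 / B ^ 2)) * t ^ 2) *
        Real.cos (2 * Real.pi * t * (a - b)) := by
  rw [integral_gaussian_mul_cos _ (by positivity)]
  simp_rw [gaussianBump_mul_eq A B hA hB]
  rw [integral_const_mul, integral_sub_right_eq_self
    (fun u : ℝ => Real.exp (-(Real.pi * (A ^ 2 + B ^ 2)) * u ^ 2)), integral_gaussian]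
  have e1 : Real.pi / (Real.pi * (A ^ 2 + B ^ 2)) = (A ^ 2 + B ^ 2)⁻¹ := by
    have := Real.pi_ne_zero
    field_simp
  have e2 : 1 / A ^ 2 + 1 / B ^ 2 = (A ^ 2 + B ^ 2) / (A * B) ^ 2 := by field_simp; ring
  have e3 : √(1 / A ^ 2 + 1 / B ^ 2) = √(A ^ 2 + B ^ 2) / (A * B) := by
    rw [e2, Real.sqrt_div (by positivity), Real.sqrt_sq (by positivity)]
  rw [e1, e3, Real.sqrt_inv]
  have : 0 < √(A ^ 2 + B ^ 2) := by positivity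
  field_simp

theorem norm_sum_exp_sq_eq {ι : Type*} (Q : Finset ι) (θ : ι → ℝ) :
    ‖∑ q ∈ Q, Complex.exp (Complex.I * (θ q : ℂ))‖ ^ 2 = ∑ q ∈ Q, ∑ q' ∈ Q, Real.cos (θ q - θ q') := by
  rw [← Complex.normSq_eq_norm_sq, Complex.normSq_apply]
  have hre : ∀ x : ℝ, (Complex.exp (Complex.I * (x : ℂ))).re = Real.cos x := by
    intro x; rw [mul_comm, Complex.exp_ofReal_mul_I_re]
  have him : ∀ x : ℝ, (Complex.exp (Complex.I * (x : ℂ))).im = Real.sin x := by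
    intro x; rw [mul_comm, Complex.exp_ofReal_mul_I_im]
  simp only [Complex.re_sum, Complex.im_sum, hre, him, Real.cos_sub]
  rw [Finset.sum_mul_sum, Finset.sum_mul_sum, ← Finset.sum_add_distrib]
  refine Finset.sum_congr rfl fun q _ => ?_
  rw [← Finset.sum_add_distrib]

theorem integral_sq_sum_gaussianBump_sub {ι : Type*} (Q : Finset ι) (a : ι → ℝ) (T τ : ℝ)
    (hT : 0 < T) (hτ : 0 < τ) :
    Integrable (fun u => (∑ q ∈ Q, (gaussianBump T (u - a q) - gaussianBump τ (u - a q))) ^ 2) ∧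
    Integrable (fun t : ℝ => (Real.exp (-Real.pi * t ^ 2 / T ^ 2) -
        Real.exp (-Real.pi * t ^ 2 / τ ^ 2)) ^ 2 *
        ‖∑ q ∈ Q, Complex.exp (Complex.I * ((2 * Real.pi * t * a q : ℝ) : ℂ))‖ ^ 2) ∧
    ∫ u, (∑ q ∈ Q, (gaussianBump T (u - a q) - gaussianBump τ (u - a q))) ^ 2 =
      ∫ t : ℝ, (Real.exp (-Real.pi * t ^ 2 / T ^ 2) - Real.exp (-Real.pi * t ^ 2 / τ ^ 2)) ^ 2 *
        ‖∑ q ∈ Q, Complex.exp (Complex.I * ((2 * Real.pi * t * a q : ℝ) : ℂ))‖ ^ 2 := by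
  set F : ℝ → ℝ → ℝ → ℝ → ℝ → ℝ := fun A B x y u => gaussianBump A (u - x) * gaussianBump B (u - y)
  set G : ℝ → ℝ → ℝ → ℝ → ℝ → ℝ := fun A B x y t =>
    Real.exp (-(Real.pi * (1 / A ^ 2 + 1 / B ^ 2)) * t ^ 2) * Real.cos (2 * Real.pi * t * (x - y))
  have hF : ∀ A B x y, 0 < A → 0 < B → Integrable (F A B x y) := fun A B x y hA hB =>
    integrable_gaussianBump_mul A B hA hB x y
  have hG : ∀ A B x y, 0 < A → 0 < B → Integrable (G A B x y) := fun A B x y hA hB =>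
    integrable_gaussian_mul_cos _ (by positivity) _
  have hFG : ∀ A B x y, 0 < A → 0 < B → ∫ u, F A B x y u = ∫ t, G A B x y t := fun A B x y hA hB =>
    integral_gaussianBump_mul A B hA hB x y
  have e1 : (fun u => (∑ q ∈ Q, (gaussianBump T (u - a q) - gaussianBump τ (u - a q))) ^ 2) =
      fun u => ∑ q ∈ Q, ∑ q' ∈ Q, (F T T (a q) (a q') u - F T τ (a q) (a q') u -
        F τ T (a q) (a q') u + F τ τ (a q) (a q') u) := by
    ext u
    rw [sq, Finset.sum_mul_sum]
    refine Finset.sum_congr rfl fun q _ => Finset.sum_congr rfl fun q' _ => ?_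
    simp only [F]; ring
  have e2 : (fun t : ℝ => (Real.exp (-Real.pi * t ^ 2 / T ^ 2) -
        Real.exp (-Real.pi * t ^ 2 / τ ^ 2)) ^ 2 *
        ‖∑ q ∈ Q, Complex.exp (Complex.I * ((2 * Real.pi * t * a q : ℝ) : ℂ))‖ ^ 2) =
      fun t => ∑ q ∈ Q, ∑ q' ∈ Q, (G T T (a q) (a q') t - G T τ (a q) (a q') t -
        G τ T (a q) (a q') t + G τ τ (a q) (a q') t) := by
    ext t
    rw [norm_sum_exp_sq_eq, Finset.mul_sum]
    refine Finset.sum_congr rfl fun q _ => ?_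
    rw [Finset.mul_sum]
    refine Finset.sum_congr rfl fun q' _ => ?_
    have hm : ∀ A B : ℝ, Real.exp (-(Real.pi * (1 / A ^ 2 + 1 / B ^ 2)) * t ^ 2) =
        Real.exp (-Real.pi * t ^ 2 / A ^ 2) * Real.exp (-Real.pi * t ^ 2 / B ^ 2) := by
      intro A B; rw [← Real.exp_add]; congr 1; ring
    simp only [G, hm, mul_sub]
    ring
  have i1 : ∀ q q', Integrable fun u => F T T (a q) (a q') u - F T τ (a q) (a q') u -
        F τ T (a q) (a q') u + F τ τ (a q) (a q') u := fun q q' =>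
    (((hF _ _ _ _ hT hT).sub (hF _ _ _ _ hT hτ)).sub (hF _ _ _ _ hτ hT)).add (hF _ _ _ _ hτ hτ)
  have i2 : ∀ q q', Integrable fun u => G T T (a q) (a q') u - G T τ (a q) (a q') u -
        G τ T (a q) (a q') u + G τ τ (a q) (a q') u := fun q q' =>
    (((hG _ _ _ _ hT hT).sub (hG _ _ _ _ hT hτ)).sub (hG _ _ _ _ hτ hT)).add (hG _ _ _ _ hτ hτ)
  rw [e1, e2]
  refine ⟨integrable_finsetSum _ fun q _ => integrable_finsetSum _ fun q' _ => i1 q q',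
    integrable_finsetSum _ fun q _ => integrable_finsetSum _ fun q' _ => i2 q q', ?_⟩
  rw [integral_finsetSum _ fun q _ => integrable_finsetSum _ fun q' _ => i1 q q',
    integral_finsetSum _ fun q _ => integrable_finsetSum _ fun q' _ => i2 q q']
  refine Finset.sum_congr rfl fun q _ => ?_
  rw [integral_finsetSum _ fun q' _ => i1 q q', integral_finsetSum _ fun q' _ => i2 q q']
  refine Finset.sum_congr rfl fun q' _ => ?_
  have s : ∀ (f1 f2 f3 f4 : ℝ → ℝ), Integrable f1 → Integrable f2 → Integrable f3 → Integrable f4 →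
      ∫ u, (f1 u - f2 u - f3 u + f4 u) = (∫ u, f1 u) - (∫ u, f2 u) - (∫ u, f3 u) + ∫ u, f4 u := by
    intro f1 f2 f3 f4 h1 h2 h3 h4
    have a1 := integral_add ((h1.sub h2).sub h3) h4
    have a2 := integral_sub (h1.sub h2) h3
    have a3 := integral_sub h1 h2
    simp only [Pi.sub_apply] at a1 a2 a3
    rw [a1, a2, a3]
  rw [s _ _ _ _ (hF _ _ _ _ hT hT) (hF _ _ _ _ hT hτ) (hF _ _ _ _ hτ hT) (hF _ _ _ _ hτ hτ),
    s _ _ _ _ (hG _ _ _ _ hT hT) (hG _ _ _ _ hT hτ) (hG _ _ _ _ hτ hT) (hG _ _ _ _ hτ hτ),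
    hFG _ _ _ _ hT hT, hFG _ _ _ _ hT hτ, hFG _ _ _ _ hτ hT, hFG _ _ _ _ hτ hτ]

theorem norm_sum_exp_le_card {ι : Type*} (Q : Finset ι) (θ : ι → ℝ) :
    ‖∑ q ∈ Q, Complex.exp (Complex.I * (θ q : ℂ))‖ ≤ Q.card := by
  refine (norm_sum_le _ _).trans ?_
  simp [mul_comm Complex.I, Complex.norm_exp_ofReal_mul_I]

theorem integral_gaussian_mul_norm_sum_exp_sq_le {ι : Type*} (P : Finset ι) (U : ι → ℝ) (T r N : ℝ)
    (hT : 0 < T)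
    (hN : (((P ×ˢ P).filter fun x : ι × ι => |U x.1 - U x.2| ≤ r).card : ℝ) ≤ N) (hr : 0 ≤ r) :
    Integrable (fun t : ℝ => Real.exp (-(Real.pi * (2 / T ^ 2)) * t ^ 2) *
      ‖∑ p ∈ P, Complex.exp (Complex.I * ((2 * Real.pi * t * U p : ℝ) : ℂ))‖ ^ 2) ∧
    ∫ t : ℝ, Real.exp (-(Real.pi * (2 / T ^ 2)) * t ^ 2) *
      ‖∑ p ∈ P, Complex.exp (Complex.I * ((2 * Real.pi * t * U p : ℝ) : ℂ))‖ ^ 2 ≤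
      T * (N + (P.card : ℝ) ^ 2 * Real.exp (-(Real.pi * T ^ 2 * r ^ 2 / 2))) := by
  have hσ : 0 < 2 / T ^ 2 := by positivity
  have e : (fun t : ℝ => Real.exp (-(Real.pi * (2 / T ^ 2)) * t ^ 2) *
      ‖∑ p ∈ P, Complex.exp (Complex.I * ((2 * Real.pi * t * U p : ℝ) : ℂ))‖ ^ 2) =
      fun t => ∑ x ∈ P ×ˢ P, Real.exp (-(Real.pi * (2 / T ^ 2)) * t ^ 2) *
        Real.cos (2 * Real.pi * t * (U x.1 - U x.2)) := by
    ext t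
    rw [norm_sum_exp_sq_eq, Finset.sum_product, Finset.mul_sum]
    refine Finset.sum_congr rfl fun q _ => ?_
    rw [Finset.mul_sum]
    exact Finset.sum_congr rfl fun q' _ => by rw [mul_sub]
  rw [e]
  refine ⟨integrable_finsetSum _ fun x _ => integrable_gaussian_mul_cos _ hσ _, ?_⟩
  rw [integral_finsetSum _ fun x _ => integrable_gaussian_mul_cos _ hσ _]
  simp_rw [integral_gaussian_mul_cos _ hσ]
  have hs : (√(2 / T ^ 2))⁻¹ ≤ T := by
    rw [Real.sqrt_div (by norm_num), Real.sqrt_sq hT.le, inv_div]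
    refine div_le_self hT.le ?_
    rw [Real.one_le_sqrt]; norm_num
  have hterm : ∀ x ∈ P ×ˢ P, (√(2 / T ^ 2))⁻¹ * Real.exp (-(Real.pi * (U x.1 - U x.2) ^ 2 / (2 / T ^ 2))) ≤
      T * ((if |U x.1 - U x.2| ≤ r then 1 else 0) + Real.exp (-(Real.pi * T ^ 2 * r ^ 2 / 2))) := by
    intro x _
    refine mul_le_mul hs ?_ (by positivity) hT.le
    split_ifs with h
    · have h1 : Real.exp (-(Real.pi * (U x.1 - U x.2) ^ 2 / (2 / T ^ 2))) ≤ 1 := by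
        rw [Real.exp_le_one_iff]
        have : 0 ≤ Real.pi * (U x.1 - U x.2) ^ 2 / (2 / T ^ 2) := by
          have := Real.pi_pos; positivity
        linarith
      linarith [Real.exp_pos (-(Real.pi * T ^ 2 * r ^ 2 / 2))]
    · rw [zero_add, Real.exp_le_exp]
      push Not at h
      have h1 : r ^ 2 ≤ (U x.1 - U x.2) ^ 2 := by
        rw [← sq_abs (U x.1 - U x.2)]; gcongr
      have : Real.pi * (U x.1 - U x.2) ^ 2 / (2 / T ^ 2) = Real.pi * T ^ 2 * (U x.1 - U x.2) ^ 2 / 2 := by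
        field_simp
      rw [this]
      have hp := Real.pi_pos
      gcongr
  refine (Finset.sum_le_sum hterm).trans ?_
  rw [← Finset.mul_sum, Finset.sum_add_distrib, Finset.sum_boole, Finset.sum_const, nsmul_eq_mul,
    Finset.card_product]
  push_cast
  rw [← sq]
  gcongr

theorem volume_gap_le {ι κ : Type*} (P : Finset ι) (Z : Finset κ) (U : ι → ℝ) (V : κ → ℝ)
    (T τ r t₁ t₂ R lam N : ℝ) (hτ : 0 < τ) (hτT : τ ≤ T) (hr : 0 ≤ r) (ht₁ : 0 ≤ t₁) (ht₂ : 0 ≤ t₂)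
    (hlam : 0 < lam)
    (hR : ∀ t : ℝ, t₁ ≤ |t| → |t| ≤ t₂ →
      ‖∑ z ∈ Z, Complex.exp (Complex.I * ((2 * Real.pi * t * V z : ℝ) : ℂ))‖ ≤ R)
    (I : Set ℝ) (hlow : ∀ u ∈ I, lam ≤ ∑ p ∈ P, ∑ z ∈ Z, gaussianBump τ (u - (U p + V z)))
    (hsmall : P.card * Z.card * (T * Real.exp (-Real.pi * T ^ 2 * r ^ 2)) ≤ lam / 2)
    (hN : (((P ×ˢ P).filter fun x : ι × ι => |U x.1 - U x.2| ≤ r).card : ℝ) ≤ N) :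
    volume {u ∈ I | ∀ p ∈ P, ∀ z ∈ Z, r < |u - (U p + V z)|} ≤ ENNReal.ofReal
      ((2 * t₁ * (Real.pi * t₁ ^ 2 / τ ^ 2) ^ 2 * (P.card * Z.card : ℝ) ^ 2 +
        R ^ 2 * (T * (N + (P.card : ℝ) ^ 2 * Real.exp (-(Real.pi * T ^ 2 * r ^ 2 / 2)))) +
        (P.card * Z.card : ℝ) ^ 2 * (Real.exp (-Real.pi * t₂ ^ 2 / T ^ 2) * T)) / (lam / 2) ^ 2) := by
  have hT : 0 < T := hτ.trans_le hτT
  have hpi := Real.pi_pos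
  set a : ι × κ → ℝ := fun q => U q.1 + V q.2 with ha
  set h : ℝ → ℝ := fun u => ∑ q ∈ P ×ˢ Z, (gaussianBump T (u - a q) - gaussianBump τ (u - a q)) with hh
  obtain ⟨i1, i2, i3⟩ := integral_sq_sum_gaussianBump_sub (P ×ˢ Z) a T τ hT hτ
  set S : ℝ → ℂ := fun t => ∑ p ∈ P, Complex.exp (Complex.I * ((2 * Real.pi * t * U p : ℝ) : ℂ)) with hS
  set W : ℝ → ℂ := fun t => ∑ z ∈ Z, Complex.exp (Complex.I * ((2 * Real.pi * t * V z : ℝ) : ℂ)) with hW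
  have hSW : ∀ t, ∑ q ∈ P ×ˢ Z, Complex.exp (Complex.I * ((2 * Real.pi * t * a q : ℝ) : ℂ)) =
      S t * W t := by
    intro t
    rw [hS, hW]
    simp only
    rw [Finset.sum_mul_sum, Finset.sum_product]
    refine Finset.sum_congr rfl fun p _ => Finset.sum_congr rfl fun z _ => ?_
    rw [← Complex.exp_add]; congr 1; simp only [ha]; push_cast; ring
  have hSn : ∀ t, ‖S t‖ ≤ P.card := fun t => norm_sum_exp_le_card P _
  have hWn : ∀ t, ‖W t‖ ≤ Z.card := fun t => norm_sum_exp_le_card Z _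
  obtain ⟨j1, j2⟩ := integral_gaussian_mul_norm_sum_exp_sq_le P U T r N hT hN hr
  set M₁ : ℝ := (Real.pi * t₁ ^ 2 / τ ^ 2) ^ 2 * (P.card * Z.card : ℝ) ^ 2 with hM₁
  set M₃ : ℝ := (P.card * Z.card : ℝ) ^ 2 * Real.exp (-Real.pi * t₂ ^ 2 / T ^ 2) with hM₃
  have hpt : ∀ t : ℝ, (Real.exp (-Real.pi * t ^ 2 / T ^ 2) - Real.exp (-Real.pi * t ^ 2 / τ ^ 2)) ^ 2 *
        ‖∑ q ∈ P ×ˢ Z, Complex.exp (Complex.I * ((2 * Real.pi * t * a q : ℝ) : ℂ))‖ ^ 2 ≤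
      (Set.Icc (-t₁) t₁).indicator (fun _ => M₁) t +
      R ^ 2 * (Real.exp (-(Real.pi * (2 / T ^ 2)) * t ^ 2) * ‖S t‖ ^ 2) +
      M₃ * Real.exp (-(Real.pi / T ^ 2) * t ^ 2) := by
    intro t
    rw [hSW, norm_mul]
    have hM₁0 : 0 ≤ M₁ := by positivity
    have hM₃0 : 0 ≤ M₃ := by positivity
    have q0 : 0 ≤ (Set.Icc (-t₁) t₁).indicator (fun _ => M₁) t := Set.indicator_nonneg (fun _ _ => hM₁0) _
    have q1 : 0 ≤ R ^ 2 * (Real.exp (-(Real.pi * (2 / T ^ 2)) * t ^ 2) * ‖S t‖ ^ 2) := by positivity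
    have q2 : 0 ≤ M₃ * Real.exp (-(Real.pi / T ^ 2) * t ^ 2) := by positivity
    have hφ0 : 0 ≤ Real.exp (-Real.pi * t ^ 2 / T ^ 2) - Real.exp (-Real.pi * t ^ 2 / τ ^ 2) := by
      rw [sub_nonneg, Real.exp_le_exp, neg_mul, neg_div, neg_div, neg_le_neg_iff]
      gcongr
    have hφ1 : Real.exp (-Real.pi * t ^ 2 / T ^ 2) - Real.exp (-Real.pi * t ^ 2 / τ ^ 2) ≤
        Real.exp (-Real.pi * t ^ 2 / T ^ 2) := by
      linarith [Real.exp_pos (-Real.pi * t ^ 2 / τ ^ 2)]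
    have hφ2 : (Real.exp (-Real.pi * t ^ 2 / T ^ 2) - Real.exp (-Real.pi * t ^ 2 / τ ^ 2)) ^ 2 ≤
        Real.exp (-(Real.pi * (2 / T ^ 2)) * t ^ 2) := by
      have : Real.exp (-(Real.pi * (2 / T ^ 2)) * t ^ 2) = Real.exp (-Real.pi * t ^ 2 / T ^ 2) ^ 2 := by
        rw [← Real.exp_nat_mul]; congr 1; push_cast; ring
      rw [this]; gcongr
    have hSWn : (‖S t‖ * ‖W t‖) ^ 2 ≤ (P.card * Z.card : ℝ) ^ 2 := by
      have := hSn t; have := hWn t; gcongr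
    by_cases hc1 : |t| ≤ t₁
    · have hmem : t ∈ Set.Icc (-t₁) t₁ := abs_le.1 hc1
      rw [Set.indicator_of_mem hmem]
      have hφ3 : Real.exp (-Real.pi * t ^ 2 / T ^ 2) - Real.exp (-Real.pi * t ^ 2 / τ ^ 2) ≤
          Real.pi * t₁ ^ 2 / τ ^ 2 := by
        have a1 : Real.exp (-Real.pi * t ^ 2 / T ^ 2) ≤ 1 := by
          rw [Real.exp_le_one_iff, neg_mul, neg_div, neg_nonpos]; positivity
        have a2 := Real.add_one_le_exp (-Real.pi * t ^ 2 / τ ^ 2)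
        have a3 : Real.pi * t ^ 2 / τ ^ 2 ≤ Real.pi * t₁ ^ 2 / τ ^ 2 := by
          have : t ^ 2 ≤ t₁ ^ 2 := by rw [← sq_abs]; gcongr
          gcongr
        have a4 : -Real.pi * t ^ 2 / τ ^ 2 = -(Real.pi * t ^ 2 / τ ^ 2) := by ring
        linarith
      have : (Real.exp (-Real.pi * t ^ 2 / T ^ 2) - Real.exp (-Real.pi * t ^ 2 / τ ^ 2)) ^ 2 *
          (‖S t‖ * ‖W t‖) ^ 2 ≤ M₁ := by
        rw [hM₁]; gcongr
      linarith
    · push Not at hc1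
      by_cases hc2 : |t| ≤ t₂
      · have hWR := hR t hc1.le hc2
        have : (Real.exp (-Real.pi * t ^ 2 / T ^ 2) - Real.exp (-Real.pi * t ^ 2 / τ ^ 2)) ^ 2 *
          (‖S t‖ * ‖W t‖) ^ 2 ≤ Real.exp (-(Real.pi * (2 / T ^ 2)) * t ^ 2) * (‖S t‖ * R) ^ 2 := by
          gcongr
        rw [mul_pow ‖S t‖ R] at this
        linarith
      · push Not at hc2
        have e1 : Real.exp (-(Real.pi * (2 / T ^ 2)) * t ^ 2) ≤
            Real.exp (-Real.pi * t₂ ^ 2 / T ^ 2) * Real.exp (-(Real.pi / T ^ 2) * t ^ 2) := by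
          rw [← Real.exp_add, Real.exp_le_exp]
          have : t₂ ^ 2 ≤ t ^ 2 := by rw [← sq_abs t]; gcongr
          have : Real.pi / T ^ 2 * t₂ ^ 2 ≤ Real.pi / T ^ 2 * t ^ 2 := by gcongr
          have e : -(Real.pi * (2 / T ^ 2)) * t ^ 2 = -(Real.pi / T ^ 2 * t ^ 2) - Real.pi / T ^ 2 * t ^ 2 := by ring
          have e' : -Real.pi * t₂ ^ 2 / T ^ 2 + -(Real.pi / T ^ 2) * t ^ 2 =
            -(Real.pi / T ^ 2 * t₂ ^ 2) - Real.pi / T ^ 2 * t ^ 2 := by ring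
          rw [e, e']; linarith
        have : (Real.exp (-Real.pi * t ^ 2 / T ^ 2) - Real.exp (-Real.pi * t ^ 2 / τ ^ 2)) ^ 2 *
          (‖S t‖ * ‖W t‖) ^ 2 ≤ (Real.exp (-Real.pi * t₂ ^ 2 / T ^ 2) * Real.exp (-(Real.pi / T ^ 2) * t ^ 2)) *
            (P.card * Z.card : ℝ) ^ 2 := mul_le_mul (hφ2.trans e1) hSWn (by positivity) (by positivity)
        rw [hM₃] at q2 ⊢
        linarith
  have k0 : Integrable ((Set.Icc (-t₁) t₁).indicator (fun _ : ℝ => M₁)) := by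
    rw [integrable_indicator_iff measurableSet_Icc]
    exact integrableOn_const (by rw [Real.volume_Icc]; exact ENNReal.ofReal_ne_top)
  have k2 : Integrable fun t : ℝ => M₃ * Real.exp (-(Real.pi / T ^ 2) * t ^ 2) :=
    (integrable_exp_neg_mul_sq (by positivity)).const_mul _
  have h_integral : ∫ u, h u ^ 2 ≤ 2 * t₁ * (Real.pi * t₁ ^ 2 / τ ^ 2) ^ 2 * (P.card * Z.card : ℝ) ^ 2 +
        R ^ 2 * (T * (N + (P.card : ℝ) ^ 2 * Real.exp (-(Real.pi * T ^ 2 * r ^ 2 / 2)))) +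
        (P.card * Z.card : ℝ) ^ 2 * (Real.exp (-Real.pi * t₂ ^ 2 / T ^ 2) * T) := by
    simp only [hh]
    rw [i3]
    refine (integral_mono i2 ((k0.add (j1.const_mul (R ^ 2))).add k2) hpt).trans ?_
    have a1 := integral_add (k0.add (j1.const_mul (R ^ 2))) k2
    have a2 := integral_add k0 (j1.const_mul (R ^ 2))
    simp only [Pi.add_apply] at a1 a2
    simp only [Pi.add_apply]
    rw [a1, a2, integral_const_mul, integral_const_mul, integral_gaussian,
      integral_indicator measurableSet_Icc, setIntegral_const]
    have e1 : √(Real.pi / (Real.pi / T ^ 2)) = T := by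
      rw [div_div_cancel₀ hpi.ne', Real.sqrt_sq hT.le]
    have e2 : volume.real (Set.Icc (-t₁) t₁) = 2 * t₁ := by
      rw [measureReal_def, Real.volume_Icc, ENNReal.toReal_ofReal (by linarith)]; ring
    rw [e1, e2, smul_eq_mul]
    have : R ^ 2 * ∫ t : ℝ, Real.exp (-(Real.pi * (2 / T ^ 2)) * t ^ 2) * ‖S t‖ ^ 2 ≤
      R ^ 2 * (T * (N + (P.card : ℝ) ^ 2 * Real.exp (-(Real.pi * T ^ 2 * r ^ 2 / 2)))) := by
      gcongr
    rw [hM₁, hM₃]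
    linarith
  have hsub : {u ∈ I | ∀ p ∈ P, ∀ z ∈ Z, r < |u - (U p + V z)|} ⊆ {u | (lam / 2) ^ 2 ≤ h u ^ 2} := by
    rintro u ⟨hu, hgap⟩
    have b1 : ∑ q ∈ P ×ˢ Z, gaussianBump T (u - a q) ≤ lam / 2 := by
      refine le_trans ?_ hsmall
      have : ∀ q ∈ P ×ˢ Z, gaussianBump T (u - a q) ≤ T * Real.exp (-Real.pi * T ^ 2 * r ^ 2) := by
        intro q hq
        rw [Finset.mem_product] at hq
        have := hgap q.1 hq.1 q.2 hq.2
        unfold gaussianBump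
        have h2 : r ^ 2 ≤ (u - a q) ^ 2 := by rw [← sq_abs (u - a q)]; gcongr
        gcongr ?_ * Real.exp ?_
        simp only [neg_mul, neg_le_neg_iff]
        gcongr
      refine (Finset.sum_le_sum this).trans ?_
      rw [Finset.sum_const, nsmul_eq_mul, Finset.card_product]
      push_cast
      exact le_rfl
    have b2 : lam ≤ ∑ q ∈ P ×ˢ Z, gaussianBump τ (u - a q) := by
      rw [Finset.sum_product]; exact hlow u hu
    have b3 : h u ≤ -(lam / 2) := by
      simp only [hh]; rw [Finset.sum_sub_distrib]; linarith
    show (lam / 2) ^ 2 ≤ h u ^ 2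
    nlinarith
  refine (measure_mono hsub).trans ?_
  have hpos : 0 < (lam / 2) ^ 2 := by positivity
  have hmk := mul_meas_ge_le_integral_of_nonneg (ae_of_all _ fun u => sq_nonneg (h u)) i1 ((lam / 2) ^ 2)
  have hfin : volume {u | (lam / 2) ^ 2 ≤ h u ^ 2} < ⊤ := i1.measure_ge_lt_top hpos
  rw [← ENNReal.ofReal_toReal hfin.ne]
  apply ENNReal.ofReal_le_ofReal
  rw [le_div_iff₀ hpos, mul_comm]
  exact hmk.trans h_integral

theorem card_le_of_separated {ι : Type*} (S : Finset ι) (f : ι → ℝ) (δ L c : ℝ) (hδ : 0 < δ)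
    (hL : 0 ≤ L) (hsep : ∀ x ∈ S, ∀ y ∈ S, x ≠ y → δ ≤ |f x - f y|)
    (hmem : ∀ x ∈ S, |f x - c| ≤ L) : (S.card : ℝ) ≤ 2 * L / δ + 1 := by
  have h : S.card ≤ (Finset.range (⌊2 * L / δ⌋₊ + 1)).card := by
    refine Finset.card_le_card_of_injOn (fun x => ⌊(f x - c + L) / δ⌋₊) ?_ ?_
    · intro x hx
      have := abs_le.1 (hmem x hx)
      simp only [Finset.coe_range, Set.mem_Iio]
      exact Nat.lt_succ_of_le (Nat.floor_le_floor (by gcongr; linarith))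
    · intro x hx y hy hxy
      by_contra hne
      have h1 := hsep x hx y hy hne
      have hx' := abs_le.1 (hmem x hx)
      have hy' := abs_le.1 (hmem y hy)
      have ax : 0 ≤ (f x - c + L) / δ := div_nonneg (by linarith) hδ.le
      have ay : 0 ≤ (f y - c + L) / δ := div_nonneg (by linarith) hδ.le
      have a1 := Nat.floor_le ax
      have a2 := Nat.lt_floor_add_one ((f x - c + L) / δ)
      have b1 := Nat.floor_le ay
      have b2 := Nat.lt_floor_add_one ((f y - c + L) / δ)
      simp only at hxy
      rw [hxy] at a1 a2
      have h2 : |(f x - c + L) / δ - (f y - c + L) / δ| < 1 := by rw [abs_lt]; constructor <;> linarith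
      have h3 : (f x - c + L) / δ - (f y - c + L) / δ = (f x - f y) / δ := by ring
      rw [h3, abs_div, abs_of_pos hδ, div_lt_one hδ] at h2
      linarith
  rw [Finset.card_range] at h
  have h2 : (S.card : ℝ) ≤ (⌊2 * L / δ⌋₊ : ℝ) + 1 := by exact_mod_cast h
  linarith [Nat.floor_le (by positivity : 0 ≤ 2 * L / δ)]

theorem one_div_le_abs_log_sub_log (x y X : ℕ) (hx : 0 < x) (hy : 0 < y) (hxy : x ≠ y) (hxX : x ≤ X)
    (hyX : y ≤ X) : 1 / (X : ℝ) ≤ |Real.log x - Real.log y| := by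
  have key : ∀ a b : ℕ, 0 < a → 0 < b → a < b → b ≤ X → 1 / (X : ℝ) ≤ Real.log b - Real.log a := by
    intro a b ha hb hab hbX
    have ha' : (0 : ℝ) < a := by exact_mod_cast ha
    have hb' : (0 : ℝ) < b := by exact_mod_cast hb
    have hab' : (a : ℝ) + 1 ≤ b := by exact_mod_cast hab
    have hbX' : (b : ℝ) ≤ X := by exact_mod_cast hbX
    rw [← Real.log_div hb'.ne' ha'.ne']
    have h1 := Real.one_sub_inv_le_log_of_pos (div_pos hb' ha')
    refine le_trans ?_ h1
    rw [inv_div]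
    have : (a : ℝ) / b ≤ 1 - 1 / b := by
      rw [div_le_iff₀ hb', sub_mul, one_div, inv_mul_cancel₀ hb'.ne']; linarith
    have : 1 / (X : ℝ) ≤ 1 / b := by gcongr
    linarith
  rcases lt_or_gt_of_ne hxy with h | h
  · rw [abs_sub_comm]
    exact (key x y hx hy h hyX).trans (le_abs_self _)
  · exact (key y x hy hx h hxX).trans (le_abs_self _)

theorem Nat.Prime.eq_of_dvd_prime {p q : ℕ} (hp : p.Prime) (hq : q.Prime) (h : p ∣ q) : p = q :=
  (Nat.prime_dvd_prime_iff_eq hp hq).1 h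

/-- The primes in `(x, 3x]`. -/
def primesIoc (x : ℕ) : Finset ℕ := (Finset.Ioc x (3 * x)).filter Nat.Prime

theorem mem_primesIoc {x p : ℕ} : p ∈ primesIoc x ↔ (x < p ∧ p ≤ 3 * x) ∧ p.Prime := by
  simp [primesIoc]

theorem card_primesIoc_le (x : ℕ) : (primesIoc x).card ≤ 3 * x := by
  refine (Finset.card_filter_le _ _).trans ?_
  simp

theorem card_ratio_close_le (D K : ℕ) (hDK : 3 * D ≤ K) (c L : ℝ) (hL : 0 ≤ L)
    (hLK : L * (18 * (K : ℝ) ^ 2) ≤ 1) :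
    ((((primesIoc D ×ˢ primesIoc K) ×ˢ (primesIoc D ×ˢ primesIoc K)).filter
      fun x : (ℕ × ℕ) × (ℕ × ℕ) => x.1.2 ≠ x.2.2 ∧
        |(Real.log x.1.1 - Real.log x.1.2 - Real.log x.2.1 + Real.log x.2.2) - c| ≤ L).card : ℝ) ≤
      2 * L * (9 * D * K : ℝ) ^ 2 + 1 + 6 * D := by
  set S := (((primesIoc D ×ˢ primesIoc K) ×ˢ (primesIoc D ×ˢ primesIoc K)).filter
      fun x : (ℕ × ℕ) × (ℕ × ℕ) => x.1.2 ≠ x.2.2 ∧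
        |(Real.log x.1.1 - Real.log x.1.2 - Real.log x.2.1 + Real.log x.2.2) - c| ≤ L) with hS
  have hmem : ∀ x ∈ S, x.1.1 ∈ primesIoc D ∧ x.1.2 ∈ primesIoc K ∧ x.2.1 ∈ primesIoc D ∧
      x.2.2 ∈ primesIoc K ∧ x.1.2 ≠ x.2.2 ∧
      |(Real.log x.1.1 - Real.log x.1.2 - Real.log x.2.1 + Real.log x.2.2) - c| ≤ L := by
    intro x hx
    simp only [hS, Finset.mem_filter, Finset.mem_product] at hx
    tauto
  rw [← Finset.card_filter_add_card_filter_not (s := S) (fun x => x.1.1 ≠ x.2.1)]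
  push_cast
  have h1 : ((S.filter fun x => x.1.1 ≠ x.2.1).card : ℝ) ≤ 2 * L * (9 * D * K : ℝ) ^ 2 + 1 := by
    rcases Finset.eq_empty_or_nonempty (S.filter fun x => x.1.1 ≠ x.2.1) with he | ⟨x0, hx0⟩
    · rw [he]; simp; positivity
    have hx0' := hmem x0 (Finset.mem_filter.1 hx0).1
    have hD0 : 0 < D := by
      have := (mem_primesIoc.1 hx0'.1).1
      omega
    have hK0 : 0 < K := by omega
    have hpos : (0 : ℝ) < 1 / (((9 * D * K) ^ 2 : ℕ) : ℝ) := by positivity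
    have := card_le_of_separated (S.filter fun x => x.1.1 ≠ x.2.1)
      (fun x => Real.log x.1.1 - Real.log x.1.2 - Real.log x.2.1 + Real.log x.2.2)
      (1 / (((9 * D * K) ^ 2 : ℕ) : ℝ)) L c hpos hL ?_ ?_
    · refine this.trans (le_of_eq ?_)
      rw [div_div_eq_mul_div, div_one]; push_cast; ring
    · intro x hx y hy hxy
      rw [Finset.mem_filter] at hx hy
      obtain ⟨a1, a2, a3, a4, a5, -⟩ := hmem x hx.1
      obtain ⟨b1, b2, b3, b4, b5, -⟩ := hmem y hy.1
      have hxd := hx.2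
      have hyd := hy.2
      obtain ⟨⟨d, k⟩, ⟨d', k'⟩⟩ := x
      obtain ⟨⟨e, l⟩, ⟨e', l'⟩⟩ := y
      simp only [mem_primesIoc] at *
      have p1 := a1.2.pos
      have p2 := a2.2.pos
      have p3 := a3.2.pos
      have p4 := a4.2.pos
      have q1 := b1.2.pos
      have q2 := b2.2.pos
      have q3 := b3.2.pos
      have q4 := b4.2.pos
      have hlog : Real.log d - Real.log k - Real.log d' + Real.log k' -
          (Real.log e - Real.log l - Real.log e' + Real.log l') =
          Real.log (((d * k') * (e' * l) : ℕ) : ℝ) - Real.log (((e * l') * (d' * k) : ℕ) : ℝ) := by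
        have r1 : (d : ℝ) ≠ 0 := by exact_mod_cast p1.ne'
        have r2 : (k : ℝ) ≠ 0 := by exact_mod_cast p2.ne'
        have r3 : (d' : ℝ) ≠ 0 := by exact_mod_cast p3.ne'
        have r4 : (k' : ℝ) ≠ 0 := by exact_mod_cast p4.ne'
        have s1 : (e : ℝ) ≠ 0 := by exact_mod_cast q1.ne'
        have s2 : (l : ℝ) ≠ 0 := by exact_mod_cast q2.ne'
        have s3 : (e' : ℝ) ≠ 0 := by exact_mod_cast q3.ne'
        have s4 : (l' : ℝ) ≠ 0 := by exact_mod_cast q4.ne'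
        push_cast
        rw [Real.log_mul (by positivity) (by positivity), Real.log_mul r1 r4, Real.log_mul s3 s2,
          Real.log_mul (by positivity) (by positivity), Real.log_mul s1 s4, Real.log_mul r3 r2]
        ring
      rw [hlog]
      have hbd : ∀ u v w z : ℕ, u ≤ 3 * D → v ≤ 3 * K → w ≤ 3 * D → z ≤ 3 * K →
          (u * v) * (w * z) ≤ (9 * D * K) ^ 2 := by
        intro u v w z hu hv hw hz
        calc (u * v) * (w * z) ≤ (3 * D * (3 * K)) * (3 * D * (3 * K)) := by gcongr
          _ = _ := by ring
      refine one_div_le_abs_log_sub_log _ _ _ (by positivity) (by positivity) ?_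
        (hbd _ _ _ _ a1.1.2 a4.1.2 b3.1.2 b2.1.2) (hbd _ _ _ _ b1.1.2 b4.1.2 a3.1.2 a2.1.2)
      intro heq
      have neq : ∀ {p q : ℕ}, p.Prime → q.Prime → p ≠ q → ¬ p ∣ q := fun hp hq hne h =>
        hne (hp.eq_of_dvd_prime hq h)
      have hkl : k = l := by
        have hdv : k ∣ (d * k') * (e' * l) := by rw [heq]; exact ⟨e * l' * d', by ring⟩
        rcases (Nat.Prime.dvd_mul a2.2).1 hdv with h | h
        · rcases (Nat.Prime.dvd_mul a2.2).1 h with h | h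
          · exact absurd h (neq a2.2 a1.2 (by omega))
          · exact absurd h (neq a2.2 a4.2 a5)
        · rcases (Nat.Prime.dvd_mul a2.2).1 h with h | h
          · exact absurd h (neq a2.2 b3.2 (by omega))
          · exact a2.2.eq_of_dvd_prime b2.2 h
      have hkl' : k' = l' := by
        have hdv : k' ∣ (e * l') * (d' * k) := by rw [← heq]; exact ⟨d * (e' * l), by ring⟩
        rcases (Nat.Prime.dvd_mul a4.2).1 hdv with h | h
        · rcases (Nat.Prime.dvd_mul a4.2).1 h with h | h
          · exact absurd h (neq a4.2 b1.2 (by omega))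
          · exact a4.2.eq_of_dvd_prime b4.2 h
        · rcases (Nat.Prime.dvd_mul a4.2).1 h with h | h
          · exact absurd h (neq a4.2 a3.2 (by omega))
          · exact absurd h (neq a4.2 a2.2 (Ne.symm a5))
      subst hkl hkl'
      have heq2 : d * e' = e * d' := by
        have : (d * e') * (k * k') = (e * d') * (k * k') := by linarith
        exact Nat.eq_of_mul_eq_mul_right (by positivity) this
      have hde : d = e := by
        have hdv : d ∣ e * d' := by rw [← heq2]; exact dvd_mul_right _ _
        rcases (Nat.Prime.dvd_mul a1.2).1 hdv with h | h
        · exact a1.2.eq_of_dvd_prime b1.2 h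
        · exact absurd h (neq a1.2 a3.2 hxd)
      subst hde
      have : e' = d' := Nat.eq_of_mul_eq_mul_left p1 heq2
      subst this
      exact hxy rfl
    · intro x hx
      exact (hmem x (Finset.mem_filter.1 hx).1).2.2.2.2.2
  have h2 : ((S.filter fun x => ¬ (x.1.1 ≠ x.2.1)).card : ℝ) ≤ 6 * D := by
    have hfib := Finset.card_le_mul_card_image (f := fun x : (ℕ × ℕ) × (ℕ × ℕ) => x.1.1)
      (S.filter fun x => ¬ (x.1.1 ≠ x.2.1)) 2 ?_
    · have himg : ((S.filter fun x => ¬ (x.1.1 ≠ x.2.1)).image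
          (fun x : (ℕ × ℕ) × (ℕ × ℕ) => x.1.1)).card ≤ 3 * D := by
        refine (Finset.card_le_card (Finset.image_subset_iff.2 ?_)).trans (card_primesIoc_le D)
        intro x hx
        exact (hmem x (Finset.mem_filter.1 hx).1).1
      have : (S.filter fun x => ¬ (x.1.1 ≠ x.2.1)).card ≤ 6 * D := by omega
      exact_mod_cast this
    · intro d₀ hd₀
      obtain ⟨x0, hx0, -⟩ := Finset.mem_image.1 hd₀
      have hx0' := hmem x0 (Finset.mem_filter.1 hx0).1
      have hD0 : 0 < D := by
        have := (mem_primesIoc.1 hx0'.1).1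
        omega
      have hK0 : 0 < K := by omega
      have hpos : (0 : ℝ) < 1 / ((9 * K ^ 2 : ℕ) : ℝ) := by positivity
      have := card_le_of_separated ((S.filter fun x => ¬ (x.1.1 ≠ x.2.1)).filter fun x => x.1.1 = d₀)
        (fun x => Real.log x.1.1 - Real.log x.1.2 - Real.log x.2.1 + Real.log x.2.2)
        (1 / ((9 * K ^ 2 : ℕ) : ℝ)) L c hpos hL ?_ ?_
      · have e1 : 2 * L / (1 / ((9 * K ^ 2 : ℕ) : ℝ)) + 1 ≤ 2 := by
          rw [div_div_eq_mul_div, div_one]; push_cast; linarith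
        have := this.trans e1
        exact_mod_cast this
      · intro x hx y hy hxy
        simp only [Finset.mem_filter, not_not] at hx hy
        obtain ⟨a1, a2, a3, a4, a5, -⟩ := hmem x hx.1.1
        obtain ⟨b1, b2, b3, b4, b5, -⟩ := hmem y hy.1.1
        have hx1 := hx.2
        have hx2 := hx.1.2
        have hy1 := hy.2
        have hy2 := hy.1.2
        obtain ⟨⟨d, k⟩, ⟨d', k'⟩⟩ := x
        obtain ⟨⟨e, l⟩, ⟨e', l'⟩⟩ := y
        simp only [mem_primesIoc] at *
        subst hx2 hy2 hx1 hy1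
        have p2 := a2.2.pos
        have p4 := a4.2.pos
        have q2 := b2.2.pos
        have q4 := b4.2.pos
        have hlog : Real.log e - Real.log k - Real.log e + Real.log k' -
            (Real.log e - Real.log l - Real.log e + Real.log l') =
            Real.log ((k' * l : ℕ) : ℝ) - Real.log ((l' * k : ℕ) : ℝ) := by
          have r2 : (k : ℝ) ≠ 0 := by exact_mod_cast p2.ne'
          have r4 : (k' : ℝ) ≠ 0 := by exact_mod_cast p4.ne'
          have s2 : (l : ℝ) ≠ 0 := by exact_mod_cast q2.ne'
          have s4 : (l' : ℝ) ≠ 0 := by exact_mod_cast q4.ne'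
          push_cast
          rw [Real.log_mul r4 s2, Real.log_mul s4 r2]
          ring
        rw [hlog]
        have hbd : ∀ v z : ℕ, v ≤ 3 * K → z ≤ 3 * K → v * z ≤ 9 * K ^ 2 := by
          intro v z hv hz
          calc v * z ≤ (3 * K) * (3 * K) := by gcongr
            _ = _ := by ring
        refine one_div_le_abs_log_sub_log _ _ _ (by positivity) (by positivity) ?_
          (hbd _ _ a4.1.2 b2.1.2) (hbd _ _ b4.1.2 a2.1.2)
        intro heq
        have hkl : k = l := by
          have hdv : k ∣ k' * l := by rw [heq]; exact dvd_mul_left _ _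
          rcases (Nat.Prime.dvd_mul a2.2).1 hdv with h | h
          · exact absurd (a2.2.eq_of_dvd_prime a4.2 h) a5
          · exact a2.2.eq_of_dvd_prime b2.2 h
        subst hkl
        have : k' = l' := Nat.eq_of_mul_eq_mul_right p2 heq
        subst this
        exact hxy rfl
      · intro x hx
        simp only [Finset.mem_filter, not_not] at hx
        exact (hmem x hx.1.1).2.2.2.2.2
  linarith

theorem eq_and_eq_of_mul_prime_eq {D n n' d d' : ℕ} (hd : d.Prime) (hd' : d'.Prime) (hn0 : 0 < n')
    (hn' : n' ≤ D) (hDd : D < d) (h : n * d = n' * d') : n = n' ∧ d = d' := by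
  have hdd : d = d' := by
    have hdv : d ∣ n' * d' := by rw [← h]; exact dvd_mul_left _ _
    rcases (Nat.Prime.dvd_mul hd).1 hdv with h1 | h1
    · exact absurd (Nat.le_of_dvd hn0 h1) (by omega)
    · exact hd.eq_of_dvd_prime hd' h1
  subst hdd
  exact ⟨Nat.eq_of_mul_eq_mul_right hd.pos h, rfl⟩

theorem card_fiber_le (F : Finset (((ℕ × ℕ) × ℕ) × ((ℕ × ℕ) × ℕ))) (w v : ℤ) (hw : w ≠ 0)
    (hv : v ≠ 0) (D : ℕ)
    (hF : ∀ x ∈ F, (x.1.2.Prime ∧ D < x.1.2 ∧ 0 < x.1.1.2 ∧ x.1.1.2 ≤ D) ∧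
      (x.2.2.Prime ∧ D < x.2.2 ∧ 0 < x.2.1.2 ∧ x.2.1.2 ≤ D) ∧
      ((x.1.1.2 * x.1.2 : ℕ) : ℤ) ^ 2 - ((x.2.1.2 * x.2.2 : ℕ) : ℤ) ^ 2 = w ∧
      ((x.1.1.1 * x.1.2 : ℕ) : ℤ) ^ 2 - ((x.2.1.1 * x.2.2 : ℕ) : ℤ) ^ 2 = v) :
    F.card ≤ w.natAbs.divisors.card * v.natAbs.divisors.card := by
  rw [← Finset.card_product]
  refine Finset.card_le_card_of_injOn
    (fun x => (x.1.1.2 * x.1.2 + x.2.1.2 * x.2.2, x.1.1.1 * x.1.2 + x.2.1.1 * x.2.2)) ?_ ?_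
  · intro x hx
    obtain ⟨-, -, h1, h2⟩ := hF x hx
    have key : ∀ (p q : ℕ) (y : ℤ), y ≠ 0 → (p : ℤ) ^ 2 - (q : ℤ) ^ 2 = y → p + q ∈ y.natAbs.divisors := by
      intro p q y hy h
      rw [Nat.mem_divisors]
      refine ⟨?_, by simpa using hy⟩
      rw [← Int.natCast_dvd]
      refine ⟨(p : ℤ) - q, ?_⟩
      rw [← h]; push_cast; ring
    simp only [Finset.coe_product, Set.mem_prod, Finset.mem_coe]
    exact ⟨key _ _ _ hw h1, key _ _ _ hv h2⟩
  · intro x hx y hy hxy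
    obtain ⟨⟨a1, a2, a3, a4⟩, ⟨a5, a6, a7, a8⟩, a9, a10⟩ := hF x hx
    obtain ⟨⟨b1, b2, b3, b4⟩, ⟨b5, b6, b7, b8⟩, b9, b10⟩ := hF y hy
    simp only [Prod.mk.injEq] at hxy
    have key : ∀ (p q p' q' : ℕ) (z : ℤ), z ≠ 0 → (p : ℤ) ^ 2 - (q : ℤ) ^ 2 = z →
        (p' : ℤ) ^ 2 - (q' : ℤ) ^ 2 = z → p + q = p' + q' → p = p' ∧ q = q' := by
      intro p q p' q' z hz h1 h2 h3
      have h4 : (p : ℤ) + q = p' + q' := by exact_mod_cast h3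
      have h5 : (p : ℤ) + q ≠ 0 := by
        intro h
        apply hz
        rw [← h1]
        linear_combination ((p : ℤ) - q) * h
      have h6 : (p : ℤ) - q = p' - q' := by
        apply mul_left_cancel₀ h5
        have : ((p : ℤ) + q) * (p' - q') = (p' + q') * (p' - q') := by rw [h4]
        linear_combination h1 - h2 - this
      constructor <;> omega
    obtain ⟨c1, c2⟩ := key _ _ _ _ w hw a9 b9 hxy.1
    obtain ⟨c3, c4⟩ := key _ _ _ _ v hv a10 b10 hxy.2
    obtain ⟨e1, e2⟩ := eq_and_eq_of_mul_prime_eq a1 b1 b3 b4 a2 c1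
    obtain ⟨e3, e4⟩ := eq_and_eq_of_mul_prime_eq a5 b5 b7 b8 a6 c2
    rw [e2] at c3
    rw [e4] at c4
    have e5 := Nat.eq_of_mul_eq_mul_right b1.pos c3
    have e6 := Nat.eq_of_mul_eq_mul_right b5.pos c4
    ext <;> assumption

theorem card_near_lattice_le (S : Finset ℤ) (g : ℤ → ℤ) (α ξ : ℝ) (hξ : 0 ≤ ξ) (X : ℕ) (a b : ℤ)
    (hb : 0 < b) (hab : IsCoprime a b) (happ : |b * α - a| ≤ 1 / (2 * X + 1))
    (hS : ∀ w ∈ S, |w| ≤ X ∧ |(g w : ℝ) - α * w| ≤ ξ) :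
    (∀ w ∈ S, |((b * g w - a * w : ℤ) : ℝ)| ≤ b * ξ + 1 / 2) ∧
    (S.card : ℝ) ≤ (2 * X / b + 2) * (2 * (b * ξ) + 2) := by
  have hbR : (0 : ℝ) < b := by exact_mod_cast hb
  have herr : ∀ w ∈ S, |((b * g w - a * w : ℤ) : ℝ)| ≤ b * ξ + 1 / 2 := by
    intro w hw
    obtain ⟨h1, h2⟩ := hS w hw
    have h1' : |(w : ℝ)| ≤ X := by exact_mod_cast h1
    have e : ((b * g w - a * w : ℤ) : ℝ) = b * ((g w : ℝ) - α * w) + (b * α - a) * w := by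
      push_cast; ring
    rw [e]
    refine (abs_add_le _ _).trans ?_
    rw [abs_mul, abs_mul, abs_of_pos hbR]
    have h3 : |b * α - a| * |(w : ℝ)| ≤ 1 / (2 * X + 1) * X := by gcongr
    have h4 : 1 / (2 * (X : ℝ) + 1) * X ≤ 1 / 2 := by
      rw [one_div_mul_eq_div, div_le_div_iff₀ (by positivity) (by norm_num)]; linarith
    have h5 : (b : ℝ) * |(g w : ℝ) - α * w| ≤ b * ξ := by gcongr
    linarith
  refine ⟨herr, ?_⟩
  set E : ℤ := ⌊b * ξ + 1 / 2⌋ with hE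
  have hE0 : 0 ≤ E := Int.floor_nonneg.2 (by positivity)
  have hq0 : 0 ≤ (X : ℤ) / b := Int.ediv_nonneg (by positivity) hb.le
  have hcard : S.card ≤ (Finset.Icc (-((X : ℤ) / b) - 1) ((X : ℤ) / b) ×ˢ Finset.Icc (-E) E).card := by
    refine Finset.card_le_card_of_injOn (fun w => (w / b, b * g w - a * w)) ?_ ?_
    · intro w hw
      have hwX := abs_le.1 (hS w hw).1
      have he := abs_le.1 (herr w hw)
      simp only [Finset.coe_product, Set.mem_prod, Finset.coe_Icc, Set.mem_Icc]
      refine ⟨⟨?_, Int.ediv_le_ediv hb hwX.2⟩, ?_, Int.le_floor.2 he.2⟩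
      · rw [Int.le_ediv_iff_mul_le hb]
        have := Int.lt_ediv_add_one_mul_self (X : ℤ) hb
        nlinarith [hwX.1]
      · rw [neg_le]
        refine Int.le_floor.2 ?_
        push_cast at he ⊢
        linarith [he.1]
    · intro w hw w' hw' hww
      simp only [Prod.mk.injEq] at hww
      obtain ⟨h1, h2⟩ := hww
      have h3 : a * (w - w') = b * (g w - g w') := by linarith
      have h4 : b ∣ w - w' := hab.symm.dvd_of_dvd_mul_left ⟨_, h3⟩
      have h5 := Int.emod_emod_of_dvd w (dvd_refl b)
      have h6 : w % b = w' % b := Int.ModEq.symm ((Int.modEq_iff_dvd).2 h4)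
      rw [← Int.mul_ediv_add_emod w b, ← Int.mul_ediv_add_emod w' b, h1, h6]
  rw [Finset.card_product, Int.card_Icc, Int.card_Icc] at hcard
  have h1 : (((X : ℤ) / b + 1 - (-((X : ℤ) / b) - 1)).toNat : ℝ) ≤ 2 * X / b + 2 := by
    have e1 : ((((X : ℤ) / b + 1 - (-((X : ℤ) / b) - 1)).toNat : ℤ) : ℝ) = 2 * (((X : ℤ) / b : ℤ) : ℝ) + 2 := by
      rw [Int.toNat_of_nonneg (by linarith)]; push_cast; ring
    have e2 : (((X : ℤ) / b : ℤ) : ℝ) ≤ X / b := by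
      rw [le_div_iff₀ hbR]
      exact_mod_cast Int.ediv_mul_le (X : ℤ) hb.ne'
    calc _ = 2 * (((X : ℤ) / b : ℤ) : ℝ) + 2 := by exact_mod_cast e1
      _ ≤ 2 * (X / b) + 2 := by linarith
      _ = _ := by ring
  have h2 : ((E + 1 - (-E)).toNat : ℝ) ≤ 2 * (b * ξ) + 2 := by
    have e1 : (((E + 1 - (-E)).toNat : ℤ) : ℝ) = 2 * (E : ℝ) + 1 := by
      rw [Int.toNat_of_nonneg (by linarith)]; push_cast; ring
    have e2 : (E : ℝ) ≤ b * ξ + 1 / 2 := Int.floor_le _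
    calc _ = 2 * (E : ℝ) + 1 := by exact_mod_cast e1
      _ ≤ _ := by linarith
  calc (S.card : ℝ) ≤ (((X : ℤ) / b + 1 - (-((X : ℤ) / b) - 1)).toNat : ℝ) * ((E + 1 - (-E)).toNat : ℝ) := by
        exact_mod_cast hcard
    _ ≤ _ := by gcongr

theorem eq_of_sq_dvd_of_sq_dvd {d : ℕ} {a b n m₁ m₂ : ℤ} (hd : d.Prime) (hd2 : 2 < d)
    (hb : ¬ (d : ℤ) ∣ b) (ha : ¬ (d : ℤ) ∣ a) (hn : ¬ (d : ℤ) ∣ n) (h₁ : 0 < m₁) (h₂ : 0 < m₂)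
    (hlt : m₁ + m₂ < (d : ℤ) ^ 2) (hd₁ : (d : ℤ) ^ 2 ∣ b * m₁ ^ 2 - a * n ^ 2)
    (hd₂ : (d : ℤ) ^ 2 ∣ b * m₂ ^ 2 - a * n ^ 2) : m₁ = m₂ := by
  have hp : Prime (d : ℤ) := Nat.prime_iff_prime_int.1 hd
  by_contra hne
  have hcop : ∀ x : ℤ, ¬ (d : ℤ) ∣ x → IsCoprime ((d : ℤ) ^ 2) x := fun x hx =>
    ((Prime.coprime_iff_not_dvd hp).2 hx).pow_left
  have h3 : (d : ℤ) ^ 2 ∣ b * ((m₁ - m₂) * (m₁ + m₂)) := by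
    have e : b * ((m₁ - m₂) * (m₁ + m₂)) = b * m₁ ^ 2 - a * n ^ 2 - (b * m₂ ^ 2 - a * n ^ 2) := by
      ring
    rw [e]
    exact dvd_sub hd₁ hd₂
  have h4 := (hcop b hb).dvd_of_dvd_mul_left h3
  have h5 : ¬ ((d : ℤ) ∣ m₁ - m₂ ∧ (d : ℤ) ∣ m₁ + m₂) := by
    rintro ⟨e1, e2⟩
    have e3 : (d : ℤ) ∣ 2 * m₁ := by
      have e : 2 * m₁ = m₁ - m₂ + (m₁ + m₂) := by ring
      rw [e]
      exact dvd_add e1 e2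
    rcases hp.dvd_or_dvd e3 with e4 | e4
    · have := Int.le_of_dvd (by norm_num) e4
      omega
    · have e5 : (d : ℤ) ∣ a * n ^ 2 := by
        have s1 : (d : ℤ) ∣ b * m₁ ^ 2 := Dvd.dvd.mul_left (Dvd.dvd.pow e4 two_ne_zero) b
        have s2 : (d : ℤ) ∣ b * m₁ ^ 2 - a * n ^ 2 := (dvd_pow_self _ two_ne_zero).trans hd₁
        have e : a * n ^ 2 = b * m₁ ^ 2 - (b * m₁ ^ 2 - a * n ^ 2) := by ring
        rw [e]
        exact dvd_sub s1 s2
      rcases hp.dvd_or_dvd e5 with e6 | e6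
      · exact ha e6
      · exact hn (hp.dvd_of_dvd_pow e6)
  have habs : |m₁ - m₂| < (d : ℤ) ^ 2 := by rw [abs_lt]; constructor <;> linarith
  by_cases e1 : (d : ℤ) ∣ m₁ - m₂
  · have e2 : ¬ (d : ℤ) ∣ m₁ + m₂ := fun h => h5 ⟨e1, h⟩
    have e3 := (hcop _ e2).dvd_of_dvd_mul_right h4
    exact hne (by linarith [Int.eq_zero_of_abs_lt_dvd e3 habs])
  · have e3 := (hcop _ e1).dvd_of_dvd_mul_left h4
    have := Int.le_of_dvd (by linarith) e3
    linarith

/-- For `x = (((m, n), d), ((m', n'), d'))`, the integer `(m d)² - (m' d')²`. -/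
def fstSqDiff (x : ((ℕ × ℕ) × ℕ) × ((ℕ × ℕ) × ℕ)) : ℤ :=
  ((x.1.1.1 * x.1.2 : ℕ) : ℤ) ^ 2 - ((x.2.1.1 * x.2.2 : ℕ) : ℤ) ^ 2

/-- For `x = (((m, n), d), ((m', n'), d'))`, the integer `(n d)² - (n' d')²`. -/
def sndSqDiff (x : ((ℕ × ℕ) × ℕ) × ((ℕ × ℕ) × ℕ)) : ℤ :=
  ((x.1.1.2 * x.1.2 : ℕ) : ℤ) ^ 2 - ((x.2.1.2 * x.2.2 : ℕ) : ℤ) ^ 2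

theorem abs_sq_sub_sq_le {p q r : ℕ} (hp : p ≤ r) (hq : q ≤ r) :
    |(p : ℤ) ^ 2 - (q : ℤ) ^ 2| ≤ (r : ℤ) ^ 2 := by
  have h1 : (p : ℤ) ^ 2 ≤ (r : ℤ) ^ 2 := by gcongr
  have h2 : (q : ℤ) ^ 2 ≤ (r : ℤ) ^ 2 := by gcongr
  rw [abs_le]
  constructor <;> nlinarith [sq_nonneg (p : ℤ), sq_nonneg (q : ℤ)]

theorem card_image_sndSqDiff_le {α : ℝ} {Y : ℕ} (hY : 2000 ≤ Y) {a b : ℤ} (hb : 0 < b)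
    (hbX : b ≤ 2 * (9 * Y ^ 80 : ℕ)) (hab : IsCoprime a b)
    (happ : |(b : ℝ) * α - a| ≤ 1 / (2 * (9 * Y ^ 80 : ℕ) + 1))
    (S : Finset (((ℕ × ℕ) × ℕ) × ((ℕ × ℕ) × ℕ)))
    (hS : ∀ x ∈ S, (x.1.2 ∈ primesIoc (Y ^ 20) ∧ x.1.1.2 ≤ Y ^ 20) ∧
      (x.2.2 ∈ primesIoc (Y ^ 20) ∧ x.2.1.2 ≤ Y ^ 20) ∧
      |(fstSqDiff x : ℝ) - α * sndSqDiff x| ≤ 882 / (Y : ℝ) ^ 20)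
    (hdvd : b ≤ Y ^ 19 → ∀ x ∈ S, ∀ d ∈ primesIoc (Y ^ 20),
      ¬ (d : ℤ) ^ 2 ∣ b * (x.2.1.1 : ℤ) ^ 2 - a * (x.2.1.2 : ℤ) ^ 2) :
    ((S.image sndSqDiff).card : ℝ) ≤ 100000 * (Y : ℝ) ^ 61 := by
  have hYR : (2000 : ℝ) ≤ Y := by exact_mod_cast hY
  have hY0 : (0 : ℝ) < Y := by linarith
  have hξ : 882 / (Y : ℝ) ^ 20 < 1 / 2 := by
    rw [div_lt_iff₀ (by positivity)]
    have : (Y : ℝ) ≤ Y ^ 20 := le_self_pow₀ (by linarith) (by norm_num)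
    linarith
  have hround : ∀ x ∈ S, round (α * (sndSqDiff x : ℝ)) = fstSqDiff x := by
    intro x hx
    obtain ⟨-, -, h⟩ := hS x hx
    rw [round_eq, Int.floor_eq_iff]
    rw [abs_le] at h
    constructor <;> linarith [h.1, h.2]
  obtain ⟨h1, h2⟩ := card_near_lattice_le (S.image sndSqDiff) (fun w => round (α * (w : ℝ))) α
    (882 / (Y : ℝ) ^ 20) (by positivity) (9 * Y ^ 80) a b hb hab happ (by
      intro w hw
      obtain ⟨x, hx, rfl⟩ := Finset.mem_image.1 hw
      obtain ⟨⟨h1, h2⟩, ⟨h3, h4⟩, h5⟩ := hS x hx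
      refine ⟨?_, by simpa [hround x hx] using h5⟩
      have e1 : x.1.1.2 * x.1.2 ≤ 3 * Y ^ 40 := by
        calc _ ≤ Y ^ 20 * (3 * Y ^ 20) := Nat.mul_le_mul h2 (mem_primesIoc.1 h1).1.2
          _ = _ := by ring
      have e2 : x.2.1.2 * x.2.2 ≤ 3 * Y ^ 40 := by
        calc _ ≤ Y ^ 20 * (3 * Y ^ 20) := Nat.mul_le_mul h4 (mem_primesIoc.1 h3).1.2
          _ = _ := by ring
      refine (abs_sq_sub_sq_le e1 e2).trans (le_of_eq ?_)
      push_cast; ring)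
  by_cases hbY : b ≤ Y ^ 19
  · have hbR : (b : ℝ) ≤ (Y : ℝ) ^ 19 := by exact_mod_cast hbY
    have hsub : S.image sndSqDiff ⊆ (primesIoc (Y ^ 20) ×ˢ
        (Finset.range (Y ^ 20 + 1) ×ˢ Finset.range (Y ^ 20 + 1))).image
        (fun t : ℕ × ℕ × ℕ => (t.1 : ℤ) ^ 2 * ((t.2.1 : ℤ) ^ 2 - (t.2.2 : ℤ) ^ 2)) := by
      intro w hw
      have hh := h1 w hw
      obtain ⟨x, hx, rfl⟩ := Finset.mem_image.1 hw
      simp only [hround x hx] at hh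
      obtain ⟨⟨p1, p2⟩, ⟨p3, p4⟩, -⟩ := hS x hx
      have hlt : (b : ℝ) * (882 / (Y : ℝ) ^ 20) + 1 / 2 < 1 := by
        have : (b : ℝ) * (882 / (Y : ℝ) ^ 20) ≤ (Y : ℝ) ^ 19 * (882 / (Y : ℝ) ^ 20) := by gcongr
        have e : (Y : ℝ) ^ 19 * (882 / (Y : ℝ) ^ 20) = 882 / Y := by field_simp
        have e' : 882 / (Y : ℝ) < 1 / 2 := by
          rw [div_lt_iff₀ hY0]; linarith
        linarith
      have hz : b * fstSqDiff x - a * sndSqDiff x = 0 := by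
        have : |((b * fstSqDiff x - a * sndSqDiff x : ℤ) : ℝ)| < 1 := hh.trans_lt hlt
        rw [← Int.cast_abs] at this
        exact Int.abs_lt_one_iff.1 (by exact_mod_cast this)
      have hdd : x.1.2 = x.2.2 := by
        by_contra hne
        have hpr := (mem_primesIoc.1 p1).2
        have hpr' := (mem_primesIoc.1 p3).2
        have hcop : IsCoprime (((x.1.2 : ℕ) : ℤ) ^ 2) (((x.2.2 : ℕ) : ℤ) ^ 2) :=
          (Nat.isCoprime_iff_coprime.2 ((Nat.coprime_primes hpr hpr').2 hne)).pow
        refine hdvd hbY x hx x.1.2 p1 (hcop.dvd_of_dvd_mul_left ?_)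
        refine ⟨b * (x.1.1.1 : ℤ) ^ 2 - a * (x.1.1.2 : ℤ) ^ 2, ?_⟩
        simp only [fstSqDiff, sndSqDiff] at hz
        push_cast at hz
        linear_combination -hz
      refine Finset.mem_image.2 ⟨(x.1.2, x.1.1.2, x.2.1.2), ?_, ?_⟩
      · simp only [Finset.mem_product, Finset.mem_range]
        exact ⟨p1, by omega, by omega⟩
      · simp only [sndSqDiff, ← hdd]
        push_cast; ring
    have hc := (Finset.card_le_card hsub).trans Finset.card_image_le
    rw [Finset.card_product, Finset.card_product, Finset.card_range] at hc
    have hc' := hc.trans (Nat.mul_le_mul_right _ (card_primesIoc_le (Y ^ 20)))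
    have hc2 : ((S.image sndSqDiff).card : ℝ) ≤ 3 * (Y : ℝ) ^ 20 * (((Y : ℝ) ^ 20 + 1) * ((Y : ℝ) ^ 20 + 1)) := by
      exact_mod_cast hc'
    have h1Y : (1 : ℝ) ≤ (Y : ℝ) ^ 20 := one_le_pow₀ (by linarith)
    calc _ ≤ _ := hc2
      _ ≤ 3 * (Y : ℝ) ^ 20 * ((2 * (Y : ℝ) ^ 20) * (2 * (Y : ℝ) ^ 20)) := by
        gcongr <;> linarith
      _ = 12 * (Y : ℝ) ^ 60 * 1 := by ring
      _ ≤ 100000 * (Y : ℝ) ^ 60 * Y := by gcongr <;> linarith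
      _ = _ := by ring
  · push Not at hbY
    have hbR : (Y : ℝ) ^ 19 ≤ b := by exact_mod_cast hbY.le
    have hb0 : (0 : ℝ) < b := by exact_mod_cast hb
    have hbX' : (b : ℝ) ≤ 18 * (Y : ℝ) ^ 80 := by
      have : (b : ℝ) ≤ 2 * (9 * Y ^ 80 : ℕ) := by exact_mod_cast hbX
      push_cast at this; linarith
    refine h2.trans ?_
    push_cast
    have e1 : 2 * (9 * (Y : ℝ) ^ 80) / b ≤ 18 * (Y : ℝ) ^ 61 := by
      rw [div_le_iff₀ hb0]
      calc 2 * (9 * (Y : ℝ) ^ 80) = 18 * (Y : ℝ) ^ 61 * (Y : ℝ) ^ 19 := by ring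
        _ ≤ _ := by gcongr
    have e2 : (b : ℝ) * (882 / (Y : ℝ) ^ 20) ≤ 15876 * (Y : ℝ) ^ 60 := by
      calc _ ≤ (18 * (Y : ℝ) ^ 80) * (882 / (Y : ℝ) ^ 20) := by gcongr
        _ = _ := by field_simp; norm_num
    have e3 : (2 * (9 * (Y : ℝ) ^ 80) / b) * (b * (882 / (Y : ℝ) ^ 20)) = 15876 * (Y : ℝ) ^ 60 := by
      field_simp; norm_num
    have e4 : (1 : ℝ) ≤ (Y : ℝ) ^ 60 := one_le_pow₀ (by linarith)
    have e5 : (Y : ℝ) ^ 61 = Y ^ 60 * Y := by ring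
    nlinarith

theorem exists_rat_approx_and_filter {α : ℝ} (hα : 0 < α) : ∃ Y₀ : ℕ, ∀ Y : ℕ, Y₀ ≤ Y →
    ∃ (a b : ℤ) (A : Finset (ℕ × ℕ)), 0 < b ∧ b ≤ 2 * (9 * Y ^ 80 : ℕ) ∧ IsCoprime a b ∧
      |(b : ℝ) * α - a| ≤ 1 / (2 * (9 * Y ^ 80 : ℕ) + 1) ∧
      (∀ x ∈ A, 1 ≤ x.2 ∧ x.2 ≤ Y ^ 20 ∧ Y ^ 22 ≤ 5 * x.1 ∧ x.1 ≤ 7 * Y ^ 22) ∧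
      (∀ n ∈ Finset.Icc 1 (Y ^ 20), ((Finset.range (7 * Y ^ 22 + 1)).filter
        fun m => Y ^ 22 ≤ 5 * m ∧ (m, n) ∉ A).card ≤ 3 * Y ^ 20) ∧
      (b ≤ Y ^ 19 → ∀ x ∈ A, ∀ d ∈ primesIoc (Y ^ 20),
        ¬ (d : ℤ) ^ 2 ∣ b * (x.1 : ℤ) ^ 2 - a * (x.2 : ℤ) ^ 2) := by
  refine ⟨⌈α⌉₊ + ⌈1 / α⌉₊ + 3, fun Y hY => ?_⟩
  have hYα : α ≤ Y - 3 := by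
    have h1 := Nat.le_ceil α
    have h2 : ((⌈α⌉₊ + ⌈1 / α⌉₊ + 3 : ℕ) : ℝ) ≤ Y := by exact_mod_cast hY
    push_cast at h2
    have : (0 : ℝ) ≤ ⌈1 / α⌉₊ := by positivity
    linarith
  have hYα' : 1 / α ≤ Y - 3 := by
    have h1 := Nat.le_ceil (1 / α)
    have h2 : ((⌈α⌉₊ + ⌈1 / α⌉₊ + 3 : ℕ) : ℝ) ≤ Y := by exact_mod_cast hY
    push_cast at h2
    have : (0 : ℝ) ≤ ⌈α⌉₊ := by positivity
    linarith
  have hY3 : 3 ≤ Y := by omega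
  have hYR : (3 : ℝ) ≤ Y := by exact_mod_cast hY3
  have hX0 : 0 < 9 * Y ^ 80 := by positivity
  obtain ⟨q, hq, hqd⟩ := Real.exists_rat_abs_sub_le_and_den_le α (n := 2 * (9 * Y ^ 80)) (by omega)
  set X := 9 * Y ^ 80 with hX
  have hqd0 : (0 : ℝ) < q.den := by exact_mod_cast q.den_pos
  have happ : |((q.den : ℤ) : ℝ) * α - q.num| ≤ 1 / (2 * (X : ℕ) + 1) := by
    have e : ((q.den : ℤ) : ℝ) * α - q.num = q.den * (α - q) := by
      have : (q : ℝ) * q.den = q.num := by exact_mod_cast Rat.mul_den_eq_num q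
      push_cast
      linear_combination this
    rw [e, abs_mul, abs_of_pos hqd0]
    calc _ ≤ (q.den : ℝ) * (1 / (((2 * X : ℕ) + 1) * q.den)) := by gcongr
      _ = _ := by push_cast; field_simp
  have hXY : (Y : ℝ) ≤ X := by
    have : Y ≤ X := by
      calc Y ≤ Y ^ 80 := Nat.le_self_pow (by norm_num) Y
        _ ≤ X := by omega
    exact_mod_cast this
  have hsmall : 1 / (2 * (X : ℝ) + 1) < α := by
    rw [div_lt_iff₀ (by positivity)]
    rw [div_le_iff₀ hα] at hYα'
    nlinarith
  have hden1 : (1 : ℝ) ≤ q.den := by exact_mod_cast q.den_pos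
  have hnum : 0 < q.num := by
    have h := (abs_le.1 happ).2
    have h2 : (0 : ℝ) < q.num := by
      have : α ≤ q.den * α := le_mul_of_one_le_left hα.le hden1
      push_cast at h
      linarith
    exact_mod_cast h2
  have hcop : IsCoprime q.num (q.den : ℤ) := by
    rw [Int.isCoprime_iff_gcd_eq_one]
    exact q.reduced
  refine ⟨q.num, q.den, ((Finset.range (7 * Y ^ 22 + 1) ×ˢ Finset.Icc 1 (Y ^ 20)).filter fun x =>
    Y ^ 22 ≤ 5 * x.1 ∧ ((q.den : ℤ) ≤ Y ^ 19 → ∀ d ∈ primesIoc (Y ^ 20),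
        ¬ (d : ℤ) ^ 2 ∣ q.den * (x.1 : ℤ) ^ 2 - q.num * (x.2 : ℤ) ^ 2)),
    by exact_mod_cast q.den_pos, by exact_mod_cast hqd, hcop, happ, ?_, ?_, ?_⟩
  · intro x hx
    simp only [Finset.mem_filter, Finset.mem_product, Finset.mem_range, Finset.mem_Icc] at hx
    omega
  · intro n hn
    rw [Finset.mem_Icc] at hn
    by_cases hden : (q.den : ℤ) ≤ Y ^ 19
    · have hdenN : q.den ≤ Y ^ 19 := by exact_mod_cast hden
      have hlt : Y ^ 19 < Y ^ 20 := Nat.pow_lt_pow_right (by omega) (by norm_num)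
      have hnumlt : q.num < Y ^ 20 := by
        have h := (abs_le.1 happ).1
        have h3 : (q.den : ℝ) ≤ (Y : ℝ) ^ 19 := by exact_mod_cast hdenN
        have h4 : (q.den : ℝ) * α ≤ (Y : ℝ) ^ 19 * (Y - 3) := by gcongr
        have h5 : (1 : ℝ) ≤ (Y : ℝ) ^ 19 := one_le_pow₀ (by linarith)
        have h6 : 1 / (2 * (X : ℝ) + 1) ≤ 1 := by
          rw [div_le_one (by positivity)]; linarith
        have : (q.num : ℝ) < (Y : ℝ) ^ 20 := by
          push_cast at h
          have : (Y : ℝ) ^ 20 = Y ^ 19 * Y := by ring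
          nlinarith
        exact_mod_cast this
      refine le_trans ?_ (card_primesIoc_le (Y ^ 20))
      have hex : ∀ m ∈ (Finset.range (7 * Y ^ 22 + 1)).filter (fun m => Y ^ 22 ≤ 5 * m ∧
          (m, n) ∉ ((Finset.range (7 * Y ^ 22 + 1) ×ˢ Finset.Icc 1 (Y ^ 20)).filter fun x =>
            Y ^ 22 ≤ 5 * x.1 ∧ ((q.den : ℤ) ≤ Y ^ 19 → ∀ d ∈ primesIoc (Y ^ 20),
        ¬ (d : ℤ) ^ 2 ∣ q.den * (x.1 : ℤ) ^ 2 - q.num * (x.2 : ℤ) ^ 2))),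
          ∃ d, d ∈ primesIoc (Y ^ 20) ∧ (d : ℤ) ^ 2 ∣ q.den * (m : ℤ) ^ 2 - q.num * (n : ℤ) ^ 2 := by
        intro m hm
        simp only [Finset.mem_filter, Finset.mem_product, Finset.mem_Icc, not_and] at hm
        obtain ⟨h1, h2, h3⟩ := hm
        by_contra hcon
        push Not at hcon
        exact h3 ⟨h1, hn⟩ h2 fun _ => hcon
      choose! f hf1 hf2 using hex
      refine Finset.card_le_card_of_injOn f (fun m hm => hf1 m hm) ?_
      intro m hm m' hm' hff
      have hd1 := hf2 m hm
      have hd2 := hf2 m' hm'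
      rw [← hff] at hd2
      obtain ⟨⟨hd, -⟩, hpr⟩ := mem_primesIoc.1 (hf1 m hm)
      simp only [Finset.coe_filter, Finset.mem_range, Set.mem_ofPred_eq] at hm hm'
      have hpos : 0 < Y ^ 22 := by positivity
      have hYd : Y ≤ Y ^ 20 := Nat.le_self_pow (by norm_num) Y
      have hbig : 14 * Y ^ 22 < f m ^ 2 := by
        calc 14 * Y ^ 22 ≤ Y ^ 3 * Y ^ 22 := by
              gcongr
              calc 14 ≤ 3 ^ 3 := by norm_num
                _ ≤ _ := by gcongr
          _ = Y ^ 25 := by ring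
          _ ≤ Y ^ 40 := Nat.pow_le_pow_right (by omega) (by norm_num)
          _ = (Y ^ 20) ^ 2 := by ring
          _ < _ := by gcongr
      have hnd : ∀ t : ℤ, 0 < t → t ≤ (Y : ℤ) ^ 20 → ¬ (f m : ℤ) ∣ t := by
        intro t ht0 ht hdv
        have h1 := Int.le_of_dvd ht0 hdv
        have h2 : (Y : ℤ) ^ 20 < f m := by exact_mod_cast hd
        omega
      have := eq_of_sq_dvd_of_sq_dvd (m₁ := (m : ℤ)) (m₂ := m') hpr (by omega)
        (hnd _ (by exact_mod_cast q.den_pos) (by exact_mod_cast hdenN.trans hlt.le))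
        (hnd _ hnum hnumlt.le) (hnd n (by omega) (by exact_mod_cast hn.2)) (by omega) (by omega)
        (by
          have : m + m' < f m ^ 2 := by omega
          exact_mod_cast this) hd1 hd2
      exact_mod_cast this
    · have hz : (Finset.range (7 * Y ^ 22 + 1)).filter (fun m => Y ^ 22 ≤ 5 * m ∧
          (m, n) ∉ ((Finset.range (7 * Y ^ 22 + 1) ×ˢ Finset.Icc 1 (Y ^ 20)).filter fun x =>
            Y ^ 22 ≤ 5 * x.1 ∧ ((q.den : ℤ) ≤ Y ^ 19 → ∀ d ∈ primesIoc (Y ^ 20),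
        ¬ (d : ℤ) ^ 2 ∣ q.den * (x.1 : ℤ) ^ 2 - q.num * (x.2 : ℤ) ^ 2))) = ∅ := by
        rw [Finset.filter_eq_empty_iff]
        intro m hm
        simp only [Finset.mem_filter, Finset.mem_product, Finset.mem_Icc]
        exact fun h => h.2 ⟨⟨hm, hn⟩, h.1, fun h' => absurd h' hden⟩
      rw [hz]; simp
  · intro hden x hx
    exact (Finset.mem_filter.1 hx).2.2 hden

theorem nat_eq_of_sq_sub_sq_eq_zero {p q : ℕ} (h : (p : ℤ) ^ 2 - (q : ℤ) ^ 2 = 0) : p = q := by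
  have h1 : (p : ℤ) ^ 2 = (q : ℤ) ^ 2 := by linarith
  have h2 : p ^ 2 = q ^ 2 := by exact_mod_cast h1
  exact Nat.pow_left_injective two_ne_zero h2

/-- The finite set of pairs of points `(m d, n d)`, `(m' d', n' d')` whose squares are close to
satisfying a linear relation with slope `α`. -/
noncomputable def closePairs (α : ℝ) (Y : ℕ) (A : Finset (ℕ × ℕ)) :
    Finset (((ℕ × ℕ) × ℕ) × ((ℕ × ℕ) × ℕ)) :=
  ((A ×ˢ primesIoc (Y ^ 20)) ×ˢ (A ×ˢ primesIoc (Y ^ 20))).filter fun x =>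
    |(fstSqDiff x : ℝ) - α * sndSqDiff x| ≤ 882 / (Y : ℝ) ^ 20

theorem card_closePairs_le {α : ℝ} (hα : 0 < α) {ε : ℝ} (hε : 0 < ε) : ∃ (C : ℝ) (Y₀ : ℕ), 0 < C ∧
    ∀ Y : ℕ, Y₀ ≤ Y → ∀ (a b : ℤ) (A : Finset (ℕ × ℕ)), 0 < b → b ≤ 2 * (9 * Y ^ 80 : ℕ) →
      IsCoprime a b → |(b : ℝ) * α - a| ≤ 1 / (2 * (9 * Y ^ 80 : ℕ) + 1) →
      (∀ x ∈ A, 1 ≤ x.2 ∧ x.2 ≤ Y ^ 20 ∧ Y ^ 22 ≤ 5 * x.1 ∧ x.1 ≤ 7 * Y ^ 22) →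
      A.card ≤ 7 * Y ^ 42 →
      (b ≤ Y ^ 19 → ∀ x ∈ A, ∀ d ∈ primesIoc (Y ^ 20),
        ¬ (d : ℤ) ^ 2 ∣ b * (x.1 : ℤ) ^ 2 - a * (x.2 : ℤ) ^ 2) →
      ((closePairs α Y A).card : ℝ) ≤ C * (Y : ℝ) ^ 62 * (Y : ℝ) ^ ε := by
  obtain ⟨M, hM1, hM⟩ := Nat.card_divisors_le_rpow (ε / 200) (by positivity)
  refine ⟨21 + M ^ 2 * 100000, 2000 + ⌈1 / α⌉₊, by positivity, ?_⟩
  intro Y hY a b A hb hbX hab happ hA hAc hdvd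
  have hY2 : 2000 ≤ Y := by omega
  have hYR : (2000 : ℝ) ≤ Y := by exact_mod_cast hY2
  have hY0 : (0 : ℝ) < Y := by linarith
  have hYα : 1 / α ≤ Y := (Nat.le_ceil _).trans (by exact_mod_cast (by omega : ⌈1 / α⌉₊ ≤ Y))
  have hξ : 882 / (Y : ℝ) ^ 20 < 1 := by
    rw [div_lt_one (by positivity)]
    have : (Y : ℝ) ≤ Y ^ 20 := le_self_pow₀ (by linarith) (by norm_num)
    linarith
  have hξα : 882 / (Y : ℝ) ^ 20 < α := by
    rw [div_lt_iff₀ (by positivity)]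
    rw [div_le_iff₀ hα] at hYα
    have : (Y : ℝ) ^ 2 ≤ Y ^ 20 := pow_le_pow_right₀ (by linarith) (by norm_num)
    nlinarith
  have hYε : (1 : ℝ) ≤ (Y : ℝ) ^ ε := Real.one_le_rpow (by linarith) hε.le
  have hmem : ∀ x ∈ closePairs α Y A, (x.1.1 ∈ A ∧ x.1.2 ∈ primesIoc (Y ^ 20)) ∧
      (x.2.1 ∈ A ∧ x.2.2 ∈ primesIoc (Y ^ 20)) ∧
      |(fstSqDiff x : ℝ) - α * sndSqDiff x| ≤ 882 / (Y : ℝ) ^ 20 := by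
    intro x hx
    simp only [closePairs, Finset.mem_filter, Finset.mem_product] at hx
    exact ⟨hx.1.1, hx.1.2, hx.2⟩
  have h0 : (((closePairs α Y A).filter fun x => sndSqDiff x = 0).card : ℝ) ≤ 21 * (Y : ℝ) ^ 62 := by
    have hle : ((closePairs α Y A).filter fun x => sndSqDiff x = 0).card ≤
        (A ×ˢ primesIoc (Y ^ 20)).card := by
      refine Finset.card_le_card_of_injOn Prod.fst ?_ ?_
      · intro x hx
        have h := hmem x (Finset.mem_filter.1 hx).1
        exact Finset.mem_product.2 h.1
      · have key : ∀ x ∈ (closePairs α Y A).filter (fun x => sndSqDiff x = 0), x.2 = x.1 := by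
          intro x hx
          obtain ⟨hx, hs⟩ := Finset.mem_filter.1 hx
          obtain ⟨⟨h1, h2⟩, ⟨h3, h4⟩, h5⟩ := hmem x hx
          obtain ⟨h2, hp⟩ := mem_primesIoc.1 h2
          obtain ⟨h4, hp'⟩ := mem_primesIoc.1 h4
          have h1 := hA _ h1
          have h3 := hA _ h3
          obtain ⟨e1, e2⟩ := eq_and_eq_of_mul_prime_eq hp hp' (by omega) h3.2.1 h2.1
            (nat_eq_of_sq_sub_sq_eq_zero hs)
          rw [hs] at h5
          have e3 : fstSqDiff x = 0 := by
            have : |(fstSqDiff x : ℝ)| < 1 := by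
              refine lt_of_le_of_lt ?_ hξ
              simpa using h5
            rw [← Int.cast_abs] at this
            exact Int.abs_lt_one_iff.1 (by exact_mod_cast this)
          have e4 := nat_eq_of_sq_sub_sq_eq_zero e3
          rw [e2] at e4
          have e5 := Nat.eq_of_mul_eq_mul_right hp'.pos e4
          exact Prod.ext (Prod.ext e5.symm e1.symm) e2.symm
        intro x hx y hy hxy
        exact Prod.ext hxy (by rw [key x hx, key y hy]; exact hxy)
    rw [Finset.card_product] at hle
    have := hle.trans (Nat.mul_le_mul hAc (card_primesIoc_le (Y ^ 20)))
    calc (((closePairs α Y A).filter fun x => sndSqDiff x = 0).card : ℝ)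
        ≤ ((7 * Y ^ 42 * (3 * Y ^ 20) : ℕ) : ℝ) := by exact_mod_cast this
      _ = _ := by push_cast; ring
  have h1 : (((closePairs α Y A).filter fun x => ¬ sndSqDiff x = 0).card : ℝ) ≤
      (M ^ 2 * (Y : ℝ) ^ ε) * (100000 * (Y : ℝ) ^ 61) := by
    set S := (closePairs α Y A).filter fun x => ¬ sndSqDiff x = 0 with hSdef
    have hS : ∀ x ∈ S, sndSqDiff x ≠ 0 ∧ (x.1.1 ∈ A ∧ x.1.2 ∈ primesIoc (Y ^ 20)) ∧
      (x.2.1 ∈ A ∧ x.2.2 ∈ primesIoc (Y ^ 20)) ∧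
      |(fstSqDiff x : ℝ) - α * sndSqDiff x| ≤ 882 / (Y : ℝ) ^ 20 := fun x hx =>
        ⟨(Finset.mem_filter.1 hx).2, hmem x (Finset.mem_filter.1 hx).1⟩
    have himg := card_image_sndSqDiff_le hY2 hb hbX hab happ S
      (fun x hx => ⟨⟨(hS x hx).2.1.2, (hA _ (hS x hx).2.1.1).2.1⟩,
        ⟨(hS x hx).2.2.1.2, (hA _ (hS x hx).2.2.1.1).2.1⟩, (hS x hx).2.2.2⟩)
      (fun hbY x hx => hdvd hbY _ (hS x hx).2.2.1.1)
    have hdivb : ∀ t : ℤ, t ≠ 0 → |t| ≤ 441 * (Y : ℤ) ^ 84 →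
        ((t.natAbs.divisors.card : ℕ) : ℝ) ≤ M * (Y : ℝ) ^ (ε / 2) := by
      intro t ht hle
      refine (hM _ (by simpa using ht)).trans ?_
      have hb1 : ((t.natAbs : ℕ) : ℝ) ≤ (Y : ℝ) ^ (100 : ℝ) := by
        have : ((t.natAbs : ℕ) : ℝ) ≤ 441 * (Y : ℝ) ^ 84 := by
          have : ((t.natAbs : ℕ) : ℤ) ≤ 441 * (Y : ℤ) ^ 84 := by rwa [Int.natCast_natAbs]
          exact_mod_cast this
        refine this.trans ?_
        calc 441 * (Y : ℝ) ^ 84 ≤ Y * (Y : ℝ) ^ 84 := by gcongr; linarith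
          _ = (Y : ℝ) ^ 85 := by ring
          _ ≤ (Y : ℝ) ^ 100 := pow_le_pow_right₀ (by linarith) (by norm_num)
          _ = _ := by rw [← Real.rpow_natCast]; norm_num
      have : ((t.natAbs : ℕ) : ℝ) ^ (ε / 200) ≤ ((Y : ℝ) ^ (100 : ℝ)) ^ (ε / 200) := by gcongr
      rw [← Real.rpow_mul hY0.le, (by ring : 100 * (ε / 200) = ε / 2)] at this
      gcongr
    have hfib : ∀ w ∈ S.image sndSqDiff, (S.filter fun x => sndSqDiff x = w).card ≤
        ⌊M ^ 2 * (Y : ℝ) ^ ε⌋₊ := by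
      intro w hw
      obtain ⟨x₀, hx₀, rfl⟩ := Finset.mem_image.1 hw
      have hw0 := (hS x₀ hx₀).1
      have hfst : ∀ x ∈ S, round (α * (sndSqDiff x : ℝ)) = fstSqDiff x := by
        intro x hx
        have h := (hS x hx).2.2.2
        have : 882 / (Y : ℝ) ^ 20 < 1 / 2 := by
          rw [div_lt_iff₀ (by positivity)]
          have : (Y : ℝ) ≤ Y ^ 20 := le_self_pow₀ (by linarith) (by norm_num)
          linarith
        rw [round_eq, Int.floor_eq_iff]
        rw [abs_le] at h
        constructor <;> linarith [h.1, h.2]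
      have hv0 : fstSqDiff x₀ ≠ 0 := by
        intro h
        have h5 := (hS x₀ hx₀).2.2.2
        rw [h, Int.cast_zero, zero_sub, abs_neg, abs_mul, abs_of_pos hα] at h5
        have : (1 : ℝ) ≤ |(sndSqDiff x₀ : ℝ)| := by
          rw [← Int.cast_abs]; exact_mod_cast Int.one_le_abs hw0
        nlinarith
      have hbd : ∀ p q : ℕ, p ≤ 21 * Y ^ 42 → q ≤ 21 * Y ^ 42 →
          |(p : ℤ) ^ 2 - (q : ℤ) ^ 2| ≤ 441 * (Y : ℤ) ^ 84 := by
        intro p q hp hq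
        refine (abs_sq_sub_sq_le hp hq).trans (le_of_eq ?_)
        push_cast; ring
      have hrange : ∀ y : (ℕ × ℕ) × ℕ, y.1 ∈ A → y.2 ∈ primesIoc (Y ^ 20) →
          y.1.1 * y.2 ≤ 21 * Y ^ 42 ∧ y.1.2 * y.2 ≤ 21 * Y ^ 42 := by
        intro y hy1 hy2
        obtain ⟨e1, e2, e3, e4⟩ := hA _ hy1
        have e5 := (mem_primesIoc.1 hy2).1.2
        constructor
        · calc _ ≤ (7 * Y ^ 22) * (3 * Y ^ 20) := Nat.mul_le_mul e4 e5
            _ = _ := by ring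
        · calc _ ≤ Y ^ 20 * (3 * Y ^ 20) := Nat.mul_le_mul e2 e5
            _ = 3 * Y ^ 40 := by ring
            _ ≤ 21 * Y ^ 42 := by gcongr <;> omega
      obtain ⟨-, ⟨g1, g2⟩, ⟨g3, g4⟩, -⟩ := hS x₀ hx₀
      have b1 := hdivb _ hw0 (hbd _ _ (hrange _ g1 g2).2 (hrange _ g3 g4).2)
      have b2 := hdivb _ hv0 (hbd _ _ (hrange _ g1 g2).1 (hrange _ g3 g4).1)
      refine (card_fiber_le _ (sndSqDiff x₀) (fstSqDiff x₀) hw0 hv0 (Y ^ 20) ?_).trans ?_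
      · intro x hx
        obtain ⟨hx, hxw⟩ := Finset.mem_filter.1 hx
        obtain ⟨-, ⟨k1, k2⟩, ⟨k3, k4⟩, -⟩ := hS x hx
        have k1 := hA _ k1
        have k3 := hA _ k3
        have k2 := mem_primesIoc.1 k2
        have k4 := mem_primesIoc.1 k4
        refine ⟨⟨k2.2, k2.1.1, by omega, k1.2.1⟩, ⟨k4.2, k4.1.1, by omega, k3.2.1⟩, hxw, ?_⟩
        change fstSqDiff x = _
        rw [← hfst x hx, ← hfst x₀ hx₀, hxw]
      · refine Nat.le_floor ?_
        push_cast
        calc _ ≤ (M * (Y : ℝ) ^ (ε / 2)) * (M * (Y : ℝ) ^ (ε / 2)) := by gcongr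
          _ = M ^ 2 * ((Y : ℝ) ^ (ε / 2) * (Y : ℝ) ^ (ε / 2)) := by ring
          _ = _ := by rw [← Real.rpow_add hY0, add_halves]
    have hc := Finset.card_le_mul_card_image S _ hfib
    calc (S.card : ℝ) ≤ (⌊M ^ 2 * (Y : ℝ) ^ ε⌋₊ : ℝ) * ((S.image sndSqDiff).card : ℝ) := by
          exact_mod_cast hc
      _ ≤ _ := by
          gcongr
          exact Nat.floor_le (by positivity)
  have hsum := Finset.card_filter_add_card_filter_not (s := closePairs α Y A)
    (fun x => sndSqDiff x = 0)
  have h61 : (Y : ℝ) ^ 61 ≤ (Y : ℝ) ^ 62 := pow_le_pow_right₀ (by linarith) (by norm_num)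
  calc ((closePairs α Y A).card : ℝ) = _ + _ := by rw [← hsum]; push_cast; rfl
    _ ≤ 21 * (Y : ℝ) ^ 62 + (M ^ 2 * (Y : ℝ) ^ ε) * (100000 * (Y : ℝ) ^ 61) := add_le_add h0 h1
    _ ≤ 21 * (Y : ℝ) ^ 62 * (Y : ℝ) ^ ε + (M ^ 2 * (Y : ℝ) ^ ε) * (100000 * (Y : ℝ) ^ 62) := by
        exact add_le_add (le_mul_of_one_le_right (by positivity) hYε) (by gcongr)
    _ = _ := by ring

/-- The logarithm of `(m² - α n²) d² / k²` for `p = ((m, n), (d, k))`. -/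
noncomputable def quadLog (α : ℝ) (p : (ℕ × ℕ) × (ℕ × ℕ)) : ℝ :=
  Real.log ((p.1.1 : ℝ) ^ 2 - α * (p.1.2 : ℝ) ^ 2) + 2 * Real.log p.2.1 - 2 * Real.log p.2.2

theorem abs_sub_le_of_abs_log_sub_log_le {x y δ B : ℝ} (hx : 0 < x) (hy : 0 < y) (hyB : y ≤ B)
    (hδ : δ ≤ 1) (h : |Real.log x - Real.log y| ≤ δ) : |x - y| ≤ 2 * δ * B := by
  have h1 := Real.abs_exp_sub_one_le (h.trans hδ)
  rw [Real.exp_sub, Real.exp_log hx, Real.exp_log hy] at h1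
  have h2 : x - y = y * (x / y - 1) := by field_simp
  rw [h2, abs_mul, abs_of_pos hy]
  calc y * |x / y - 1| ≤ B * (2 * δ) := by
        gcongr
        · linarith
        · linarith
    _ = _ := by ring

theorem card_close_quadLog_le {α : ℝ} (hα : 0 < α) {ε : ℝ} (hε : 0 < ε) : ∃ (C : ℝ) (Y₀ : ℕ), 0 < C ∧
    ∀ Y : ℕ, Y₀ ≤ Y → ∃ A : Finset (ℕ × ℕ),
      (∀ x ∈ A, 1 ≤ x.2 ∧ x.2 ≤ Y ^ 20 ∧ Y ^ 22 ≤ 5 * x.1 ∧ x.1 ≤ 7 * Y ^ 22) ∧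
      (∀ n ∈ Finset.Icc 1 (Y ^ 20), ((Finset.range (7 * Y ^ 22 + 1)).filter
        fun m => Y ^ 22 ≤ 5 * m ∧ (m, n) ∉ A).card ≤ 3 * Y ^ 20) ∧
      A.card ≤ 7 * Y ^ 42 ∧ (∀ x ∈ A, 0 < (x.1 : ℝ) ^ 2 - α * (x.2 : ℝ) ^ 2) ∧
      (((((A ×ˢ (primesIoc (Y ^ 20) ×ˢ primesIoc (Y ^ 42))) ×ˢ
        (A ×ˢ (primesIoc (Y ^ 20) ×ˢ primesIoc (Y ^ 42)))).filter fun x =>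
          |quadLog α x.1 - quadLog α x.2| ≤ 1 / (Y : ℝ) ^ 104).card : ℕ) : ℝ) ≤
        C * (Y : ℝ) ^ 104 * (Y : ℝ) ^ ε := by
  obtain ⟨Y₁, hA⟩ := exists_rat_approx_and_filter hα
  obtain ⟨C, Y₂, hC, hclose⟩ := card_closePairs_le hα hε
  refine ⟨4312 + 3 * C, Y₁ + Y₂ + 2 + ⌈25 * α⌉₊, by positivity, fun Y hY => ?_⟩
  obtain ⟨a, b, A, hb, hbX, hab, happ, hrange, hexc, hdvd⟩ := hA Y (by omega)
  have hY2 : 2 ≤ Y := by omega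
  have hYR : (2 : ℝ) ≤ Y := by exact_mod_cast hY2
  have hY0 : (0 : ℝ) < Y := by linarith
  have hYα : 25 * α ≤ Y := (Nat.le_ceil _).trans (by exact_mod_cast (by omega : ⌈25 * α⌉₊ ≤ Y))
  have hYε : (1 : ℝ) ≤ (Y : ℝ) ^ ε := Real.one_le_rpow (by linarith) hε.le
  have hY22 : 0 < Y ^ 22 := by positivity
  have hAc : A.card ≤ 7 * Y ^ 42 := by
    have : A ⊆ Finset.Icc 1 (7 * Y ^ 22) ×ˢ Finset.Icc 1 (Y ^ 20) := by
      intro x hx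
      obtain ⟨h1, h2, h3, h4⟩ := hrange x hx
      simp only [Finset.mem_product, Finset.mem_Icc]
      omega
    refine (Finset.card_le_card this).trans (le_of_eq ?_)
    simp only [Finset.card_product, Nat.card_Icc, Nat.add_sub_cancel]
    ring
  have hpos : ∀ x ∈ A, 0 < (x.1 : ℝ) ^ 2 - α * (x.2 : ℝ) ^ 2 := by
    intro x hx
    obtain ⟨h1, h2, h3, h4⟩ := hrange x hx
    have h2 : (x.2 : ℝ) ≤ (Y : ℝ) ^ 20 := by exact_mod_cast h2
    have h3 : (Y : ℝ) ^ 22 ≤ 5 * x.1 := by exact_mod_cast h3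
    have h5 : (Y : ℝ) ^ 44 ≤ 25 * (x.1 : ℝ) ^ 2 := by
      calc (Y : ℝ) ^ 44 = ((Y : ℝ) ^ 22) ^ 2 := by ring
        _ ≤ (5 * x.1 : ℝ) ^ 2 := by gcongr
        _ = _ := by ring
    have h6 : 25 * (α * (x.2 : ℝ) ^ 2) < (Y : ℝ) ^ 44 := by
      calc 25 * (α * (x.2 : ℝ) ^ 2) = 25 * α * (x.2 : ℝ) ^ 2 := by ring
        _ ≤ Y * ((Y : ℝ) ^ 20) ^ 2 := by gcongr
        _ = (Y : ℝ) ^ 41 := by ring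
        _ < _ := pow_lt_pow_right₀ (by linarith) (by norm_num)
    linarith
  refine ⟨A, hrange, hexc, hAc, hpos, ?_⟩
  set F := ((A ×ˢ (primesIoc (Y ^ 20) ×ˢ primesIoc (Y ^ 42))) ×ˢ
        (A ×ˢ (primesIoc (Y ^ 20) ×ˢ primesIoc (Y ^ 42)))).filter fun x =>
          |quadLog α x.1 - quadLog α x.2| ≤ 1 / (Y : ℝ) ^ 104 with hF
  have hmem : ∀ x ∈ F, (x.1.1 ∈ A ∧ x.1.2.1 ∈ primesIoc (Y ^ 20) ∧ x.1.2.2 ∈ primesIoc (Y ^ 42)) ∧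
      (x.2.1 ∈ A ∧ x.2.2.1 ∈ primesIoc (Y ^ 20) ∧ x.2.2.2 ∈ primesIoc (Y ^ 42)) ∧
      |quadLog α x.1 - quadLog α x.2| ≤ 1 / (Y : ℝ) ^ 104 := by
    intro x hx
    simp only [hF, Finset.mem_filter, Finset.mem_product] at hx
    exact ⟨hx.1.1, hx.1.2, hx.2⟩
  have hδ : 1 / (Y : ℝ) ^ 104 ≤ 1 := by
    rw [div_le_one (by positivity)]; exact one_le_pow₀ (by linarith)
  have heq : ((F.filter fun x => x.1.2.2 = x.2.2.2).card : ℝ) ≤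
      (C * (Y : ℝ) ^ 62 * (Y : ℝ) ^ ε) * (3 * (Y : ℝ) ^ 42) := by
    have hle : (F.filter fun x => x.1.2.2 = x.2.2.2).card ≤
        (closePairs α Y A ×ˢ primesIoc (Y ^ 42)).card := by
      refine Finset.card_le_card_of_injOn
        (fun x => (((x.1.1, x.1.2.1), (x.2.1, x.2.2.1)), x.1.2.2)) ?_ ?_
      · intro x hx
        obtain ⟨hx, hk⟩ := Finset.mem_filter.1 hx
        obtain ⟨⟨h1, h2, h3⟩, ⟨h4, h5, h6⟩, h7⟩ := hmem x hx
        simp only [Finset.coe_product, Set.mem_prod, Finset.mem_coe, closePairs,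
          Finset.mem_filter, Finset.mem_product]
        refine ⟨⟨⟨⟨h1, h2⟩, h4, h5⟩, ?_⟩, h3⟩
        have hd := mem_primesIoc.1 h2
        have hd' := mem_primesIoc.1 h5
        have hd0 : (0 : ℝ) < x.1.2.1 := by exact_mod_cast hd.2.pos
        have hd0' : (0 : ℝ) < x.2.2.1 := by exact_mod_cast hd'.2.pos
        have hp := hpos _ h1
        have hp' := hpos _ h4
        have key := abs_sub_le_of_abs_log_sub_log_le (δ := 1 / (Y : ℝ) ^ 104)
          (x := ((x.1.1.1 : ℝ) ^ 2 - α * (x.1.1.2 : ℝ) ^ 2) * (x.1.2.1 : ℝ) ^ 2)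
          (y := ((x.2.1.1 : ℝ) ^ 2 - α * (x.2.1.2 : ℝ) ^ 2) * (x.2.2.1 : ℝ) ^ 2)
          (B := 441 * (Y : ℝ) ^ 84) (by positivity) (by positivity) (by
            obtain ⟨-, -, -, e⟩ := hrange _ h4
            have e : (x.2.1.1 : ℝ) ≤ 7 * (Y : ℝ) ^ 22 := by exact_mod_cast e
            have e' : (x.2.2.1 : ℝ) ≤ 3 * (Y : ℝ) ^ 20 := by exact_mod_cast hd'.1.2
            calc _ ≤ ((x.2.1.1 : ℝ) ^ 2) * (x.2.2.1 : ℝ) ^ 2 := by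
                  gcongr
                  linarith [show 0 ≤ α * (x.2.1.2 : ℝ) ^ 2 by positivity]
              _ ≤ (7 * (Y : ℝ) ^ 22) ^ 2 * (3 * (Y : ℝ) ^ 20) ^ 2 := by gcongr
              _ = _ := by ring) hδ (by
            rw [Real.log_mul hp.ne' (by positivity), Real.log_mul hp'.ne' (by positivity),
              Real.log_pow, Real.log_pow]
            rw [quadLog, quadLog, hk] at h7
            convert h7 using 2
            push_cast; ring)
        have e1 : 2 * (1 / (Y : ℝ) ^ 104) * (441 * (Y : ℝ) ^ 84) = 882 / (Y : ℝ) ^ 20 := by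
          field_simp; norm_num
        rw [e1] at key
        convert key using 2
        simp only [fstSqDiff, sndSqDiff]
        push_cast; ring
      · intro x hx y hy hxy
        have hk := (Finset.mem_filter.1 hx).2
        have hk' := (Finset.mem_filter.1 hy).2
        simp only [Prod.mk.injEq] at hxy
        obtain ⟨⟨⟨h1, h2⟩, h3, h4⟩, h5⟩ := hxy
        exact Prod.ext (Prod.ext h1 (Prod.ext h2 h5))
          (Prod.ext h3 (Prod.ext h4 (by rw [← hk, ← hk', h5])))
    rw [Finset.card_product] at hle
    have h2 := hle.trans (Nat.mul_le_mul_left _ (card_primesIoc_le (Y ^ 42)))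
    calc _ ≤ ((closePairs α Y A).card : ℝ) * (3 * (Y : ℝ) ^ 42) := by exact_mod_cast h2
      _ ≤ _ := by
        gcongr
        exact hclose Y (by omega) a b A hb hbX hab happ hrange hAc hdvd
  have hne : ((F.filter fun x => ¬ x.1.2.2 = x.2.2.2).card : ℝ) ≤ 4312 * (Y : ℝ) ^ 104 := by
    have hle := Finset.card_le_mul_card_image_of_maps_to (s := F.filter fun x => ¬ x.1.2.2 = x.2.2.2)
      (t := A ×ˢ A) (f := fun x => (x.1.1, x.2.1)) (fun x hx => by
        have := hmem x (Finset.mem_filter.1 hx).1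
        exact Finset.mem_product.2 ⟨this.1.1, this.2.1.1⟩) (88 * Y ^ 20) (by
        rintro ⟨p, p'⟩ -
        have hinj : ((F.filter fun x => ¬ x.1.2.2 = x.2.2.2).filter
            fun x => (x.1.1, x.2.1) = (p, p')).card ≤
          (((primesIoc (Y ^ 20) ×ˢ primesIoc (Y ^ 42)) ×ˢ
            (primesIoc (Y ^ 20) ×ˢ primesIoc (Y ^ 42))).filter fun x => x.1.2 ≠ x.2.2 ∧
            |(Real.log x.1.1 - Real.log x.1.2 - Real.log x.2.1 + Real.log x.2.2) -
              (Real.log ((p'.1 : ℝ) ^ 2 - α * (p'.2 : ℝ) ^ 2) -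
                Real.log ((p.1 : ℝ) ^ 2 - α * (p.2 : ℝ) ^ 2)) / 2| ≤
              1 / (2 * (Y : ℝ) ^ 104)).card := by
          refine Finset.card_le_card_of_injOn (fun x => (x.1.2, x.2.2)) ?_ ?_
          · intro x hx
            obtain ⟨hx, hpp⟩ := Finset.mem_filter.1 hx
            obtain ⟨hx, hk⟩ := Finset.mem_filter.1 hx
            obtain ⟨⟨h1, h2, h3⟩, ⟨h4, h5, h6⟩, h7⟩ := hmem x hx
            simp only [Prod.mk.injEq] at hpp
            simp only [Finset.coe_filter, Finset.mem_product, Set.mem_ofPred_eq]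
            refine ⟨⟨⟨h2, h3⟩, h5, h6⟩, hk, ?_⟩
            rw [quadLog, quadLog, hpp.1, hpp.2, abs_le] at h7
            have e : 1 / (2 * (Y : ℝ) ^ 104) = 1 / (Y : ℝ) ^ 104 / 2 := by field_simp
            rw [e, abs_le]
            constructor <;> linarith [h7.1, h7.2]
          · intro x hx y hy hxy
            have hx := (Finset.mem_filter.1 hx).2
            have hy := (Finset.mem_filter.1 hy).2
            simp only [Prod.mk.injEq] at hx hy hxy
            exact Prod.ext (Prod.ext (hx.1.trans hy.1.symm) hxy.1)
              (Prod.ext (hx.2.trans hy.2.symm) hxy.2)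
        have h2 := card_ratio_close_le (Y ^ 20) (Y ^ 42) (by
            calc 3 * Y ^ 20 ≤ 2 ^ 22 * Y ^ 20 := by gcongr; norm_num
              _ ≤ Y ^ 22 * Y ^ 20 := by gcongr
              _ = _ := by ring)
          ((Real.log ((p'.1 : ℝ) ^ 2 - α * (p'.2 : ℝ) ^ 2) -
                Real.log ((p.1 : ℝ) ^ 2 - α * (p.2 : ℝ) ^ 2)) / 2) (1 / (2 * (Y : ℝ) ^ 104))
          (by positivity) (by
            push_cast
            rw [div_mul_eq_mul_div, div_le_one (by positivity)]
            calc 1 * (18 * ((Y : ℝ) ^ 42) ^ 2) = 2 * (9 * (Y : ℝ) ^ 84) := by ring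
              _ ≤ 2 * (2 ^ 20 * (Y : ℝ) ^ 84) := by gcongr; norm_num
              _ ≤ 2 * ((Y : ℝ) ^ 20 * (Y : ℝ) ^ 84) := by gcongr
              _ = _ := by ring)
        have h3 : 2 * (1 / (2 * (Y : ℝ) ^ 104)) * (9 * ((Y ^ 20 : ℕ) : ℝ) * ((Y ^ 42 : ℕ) : ℝ)) ^ 2 +
            1 + 6 * ((Y ^ 20 : ℕ) : ℝ) ≤ 88 * (Y : ℝ) ^ 20 := by
          push_cast
          have e1 : 2 * (1 / (2 * (Y : ℝ) ^ 104)) * (9 * (Y : ℝ) ^ 20 * (Y : ℝ) ^ 42) ^ 2 =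
            81 * (Y : ℝ) ^ 20 := by field_simp; norm_num
          have e2 : (1 : ℝ) ≤ (Y : ℝ) ^ 20 := one_le_pow₀ (by linarith)
          rw [e1]; linarith
        have h4 := h2.trans h3
        refine hinj.trans ?_
        exact_mod_cast h4)
    rw [Finset.card_product] at hle
    have h2 : (F.filter fun x => ¬ x.1.2.2 = x.2.2.2).card ≤
        88 * Y ^ 20 * ((7 * Y ^ 42) * (7 * Y ^ 42)) :=
      hle.trans (Nat.mul_le_mul_left _ (Nat.mul_le_mul hAc hAc))
    calc _ ≤ ((88 * Y ^ 20 * ((7 * Y ^ 42) * (7 * Y ^ 42)) : ℕ) : ℝ) := by exact_mod_cast h2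
      _ = _ := by push_cast; ring
  have hsum := Finset.card_filter_add_card_filter_not (s := F) (fun x => x.1.2.2 = x.2.2.2)
  calc (F.card : ℝ) = _ + _ := by rw [← hsum]; push_cast; rfl
    _ ≤ (C * (Y : ℝ) ^ 62 * (Y : ℝ) ^ ε) * (3 * (Y : ℝ) ^ 42) + 4312 * (Y : ℝ) ^ 104 :=
      add_le_add heq hne
    _ ≤ (C * (Y : ℝ) ^ 62 * (Y : ℝ) ^ ε) * (3 * (Y : ℝ) ^ 42) +
        4312 * (Y : ℝ) ^ 104 * (Y : ℝ) ^ ε := by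
      exact add_le_add le_rfl (le_mul_of_one_le_right (by positivity) hYε)
    _ = _ := by ring

theorem abs_log_sub_le_of_mem_Icc {α s u T : ℝ} {m n : ℝ} (hs : 0 < s) (hT : 0 < T)
    (hsm : s ≤ m) (hms : m ≤ s + s / (4 * T)) (hα : 0 ≤ α) (hn : 4 * T * (α * n ^ 2) ≤ m ^ 2)
    (hT1 : 1 ≤ T) (hu : 2 * Real.log s = u) :
    |Real.log (m ^ 2 - α * n ^ 2) - u| ≤ 1 / T := by
  have hm : 0 < m := by linarith
  have h1 : 0 ≤ Real.log m - Real.log s := by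
    have := Real.log_le_log hs hsm; linarith
  have h2 : Real.log m - Real.log s ≤ 1 / (4 * T) := by
    rw [← Real.log_div hm.ne' hs.ne']
    refine (Real.log_le_sub_one_of_pos (by positivity)).trans ?_
    rw [div_sub_one hs.ne', div_le_div_iff₀ hs (by positivity)]
    have e : s / (4 * T) * (4 * T) = s := by field_simp
    nlinarith
  set q := α * n ^ 2 / m ^ 2 with hq
  have hq0 : 0 ≤ q := by positivity
  have hqT : q ≤ 1 / (4 * T) := by
    rw [hq, div_le_div_iff₀ (by positivity) (by positivity)]; linarith
  have hT4 : 1 / (4 * T) ≤ 1 / 4 := by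
    apply one_div_le_one_div_of_le <;> linarith
  have hfac : m ^ 2 - α * n ^ 2 = m ^ 2 * (1 - q) := by rw [hq]; field_simp
  have h3 : Real.log (1 - q) ≤ 0 := Real.log_nonpos (by linarith) (by linarith)
  have h4 : -(2 * q) ≤ Real.log (1 - q) := by
    have := Real.one_sub_inv_le_log_of_pos (x := 1 - q) (by linarith)
    refine le_trans ?_ this
    have e : 1 - (1 - q)⁻¹ = -(q / (1 - q)) := by
      have : 1 - q ≠ 0 := by linarith
      field_simp; ring
    rw [e, neg_le_neg_iff, div_le_iff₀ (by linarith)]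
    nlinarith
  rw [hfac, Real.log_mul (by positivity) (by linarith), Real.log_pow, ← hu]
  have e5 : 1 / T = 4 * (1 / (4 * T)) := by field_simp
  rw [e5, abs_le]
  push_cast
  constructor <;> linarith

theorem le_card_filter_close {α : ℝ} (hα : 0 < α) : ∃ Y₀ : ℕ, ∀ Y : ℕ, Y₀ ≤ Y →
    ∀ A : Finset (ℕ × ℕ),
      (∀ n ∈ Finset.Icc 1 (Y ^ 20), ((Finset.range (7 * Y ^ 22 + 1)).filter
        fun m => Y ^ 22 ≤ 5 * m ∧ (m, n) ∉ A).card ≤ 3 * Y ^ 20) →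
      ∀ u ∈ Set.Icc (-Real.log 2) 0, ∀ d ∈ primesIoc (Y ^ 20), ∀ k ∈ primesIoc (Y ^ 42),
        ∀ z ∈ Finset.Ioc Y (2 * Y), ∀ n ∈ Finset.Icc 1 (Y ^ 20),
          (Y : ℝ) ^ 21 / 40 ≤ ((A.filter fun a => |u - (quadLog α (a, (d, k)) +
            (2 * Real.log Y - 2 * Real.log z))| ≤ 1 / (Y : ℝ) ∧ a.2 = n).card : ℝ) := by
  refine ⟨1000 + ⌈100 * α⌉₊, fun Y hY A hexc u hu d hd k hk z hz n hn => ?_⟩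
  have hYR : (1000 : ℝ) ≤ Y := by exact_mod_cast (by omega : 1000 ≤ Y)
  have hY0 : (0 : ℝ) < Y := by linarith
  have hYα : 100 * α ≤ Y := (Nat.le_ceil _).trans (by exact_mod_cast (by omega : ⌈100 * α⌉₊ ≤ Y))
  obtain ⟨⟨hd1, hd2⟩, -⟩ := mem_primesIoc.1 hd
  obtain ⟨⟨hk1, hk2⟩, -⟩ := mem_primesIoc.1 hk
  rw [Finset.mem_Ioc] at hz
  have hnn := hexc n hn
  rw [Finset.mem_Icc] at hn
  have hd1 : (Y : ℝ) ^ 20 ≤ d := by exact_mod_cast hd1.le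
  have hd2 : (d : ℝ) ≤ 3 * (Y : ℝ) ^ 20 := by exact_mod_cast hd2
  have hk1 : (Y : ℝ) ^ 42 ≤ k := by exact_mod_cast hk1.le
  have hk2 : (k : ℝ) ≤ 3 * (Y : ℝ) ^ 42 := by exact_mod_cast hk2
  have hz1 : (Y : ℝ) ≤ z := by exact_mod_cast hz.1.le
  have hz2 : (z : ℝ) ≤ 2 * Y := by exact_mod_cast hz.2
  have hn2 : (n : ℝ) ≤ (Y : ℝ) ^ 20 := by exact_mod_cast hn.2
  have hd0 : (0 : ℝ) < d := lt_of_lt_of_le (by positivity) hd1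
  have hk0 : (0 : ℝ) < k := lt_of_lt_of_le (by positivity) hk1
  have hz0 : (0 : ℝ) < z := by linarith
  have hE1 : Real.exp (u / 2) ≤ 1 := Real.exp_le_one_iff.2 (by linarith [hu.2])
  have hE2 : 7 / 10 ≤ Real.exp (u / 2) := by
    have h1 : 1 / 2 ≤ Real.exp (u / 2) ^ 2 := by
      rw [← Real.exp_nat_mul]
      push_cast
      rw [mul_div_cancel₀ _ two_ne_zero]
      calc (1 / 2 : ℝ) = Real.exp (-Real.log 2) := by rw [Real.exp_neg, Real.exp_log two_pos]; norm_num
        _ ≤ _ := Real.exp_le_exp.2 hu.1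
    nlinarith [Real.exp_pos (u / 2)]
  set s := Real.exp (u / 2) * (k * z / (d * Y)) with hs
  have hs1 : 23 / 100 * (Y : ℝ) ^ 22 ≤ s := by
    have : (Y : ℝ) ^ 22 / 3 ≤ k * z / (d * Y) := by
      rw [div_le_div_iff₀ (by norm_num) (by positivity)]
      calc (Y : ℝ) ^ 22 * (d * Y) ≤ (Y : ℝ) ^ 22 * (3 * (Y : ℝ) ^ 20 * Y) := by gcongr
        _ = (Y : ℝ) ^ 42 * Y * 3 := by ring
        _ ≤ _ := by gcongr
    calc 23 / 100 * (Y : ℝ) ^ 22 ≤ 7 / 10 * ((Y : ℝ) ^ 22 / 3) := by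
          linarith [show 0 < (Y : ℝ) ^ 22 by positivity]
      _ ≤ _ := mul_le_mul hE2 this (by positivity) (Real.exp_pos _).le
  have hs2 : s ≤ 6 * (Y : ℝ) ^ 22 := by
    have : k * z / (d * Y) ≤ 6 * (Y : ℝ) ^ 22 := by
      rw [div_le_iff₀ (by positivity)]
      calc (k : ℝ) * z ≤ 3 * (Y : ℝ) ^ 42 * (2 * Y) := by gcongr
        _ = 6 * (Y : ℝ) ^ 22 * ((Y : ℝ) ^ 20 * Y) := by ring
        _ ≤ _ := by gcongr
    exact (mul_le_of_le_one_left (by positivity) hE1).trans this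
  have hs0 : 0 < s := lt_of_lt_of_le (by positivity) hs1
  have hlogs : 2 * Real.log s = u - (2 * Real.log d - 2 * Real.log k +
      (2 * Real.log Y - 2 * Real.log z)) := by
    rw [hs, Real.log_mul (Real.exp_pos _).ne' (by positivity), Real.log_exp,
      Real.log_div (by positivity) (by positivity), Real.log_mul hk0.ne' hz0.ne',
      Real.log_mul hd0.ne' hY0.ne']
    ring
  have h4Y : s / (4 * Y) ≤ s / 4 := by
    gcongr; linarith
  have h4Y' : 23 / 400 * (Y : ℝ) ^ 21 ≤ s / (4 * Y) := by
    rw [le_div_iff₀ (by positivity)]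
    calc _ = 23 / 100 * (Y : ℝ) ^ 22 := by ring
      _ ≤ _ := hs1
  set E := (Finset.range (7 * Y ^ 22 + 1)).filter fun m => Y ^ 22 ≤ 5 * m ∧ (m, n) ∉ A with hE
  have hgood : ∀ m ∈ Finset.Icc ⌈s⌉₊ ⌊s + s / (4 * Y)⌋₊ \ E, (m, n) ∈ A.filter fun a =>
      |u - (quadLog α (a, (d, k)) + (2 * Real.log Y - 2 * Real.log z))| ≤ 1 / (Y : ℝ) ∧ a.2 = n := by
    intro m hm
    rw [Finset.mem_sdiff, Finset.mem_Icc] at hm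
    obtain ⟨⟨hm1, hm2⟩, hmE⟩ := hm
    have hm1 : s ≤ m := Nat.ceil_le.1 hm1
    have hm2 : (m : ℝ) ≤ s + s / (4 * Y) := (Nat.le_floor_iff (by positivity)).1 hm2
    have hmA : (m, n) ∈ A := by
      by_contra hcon
      apply hmE
      rw [hE, Finset.mem_filter, Finset.mem_range]
      refine ⟨?_, ?_, hcon⟩
      · have : (m : ℝ) ≤ 7 * (Y : ℝ) ^ 22 := by
          have : s / (4 * Y) ≤ (Y : ℝ) ^ 22 := by
            rw [div_le_iff₀ (by positivity)]
            nlinarith [show 0 < (Y : ℝ) ^ 22 by positivity]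
          linarith
        have : m ≤ 7 * Y ^ 22 := by exact_mod_cast this
        omega
      · have : (Y : ℝ) ^ 22 ≤ 5 * m := by linarith [show 0 < (Y : ℝ) ^ 22 by positivity]
        exact_mod_cast this
    refine Finset.mem_filter.2 ⟨hmA, ?_, rfl⟩
    have key := abs_log_sub_le_of_mem_Icc (α := α) (n := (n : ℝ)) hs0 hY0 hm1 hm2 hα.le (by
      have hmY : (Y : ℝ) ^ 22 / 5 ≤ m := by linarith [show 0 < (Y : ℝ) ^ 22 by positivity]
      calc 4 * (Y : ℝ) * (α * (n : ℝ) ^ 2) ≤ 4 * (Y : ℝ) * (α * ((Y : ℝ) ^ 20) ^ 2) := by gcongr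
        _ = 100 * α * ((Y : ℝ) ^ 41 / 25) := by ring
        _ ≤ Y ^ 3 * ((Y : ℝ) ^ 41 / 25) := by
            gcongr
            exact hYα.trans (le_self_pow₀ (by linarith) (by norm_num))
        _ = ((Y : ℝ) ^ 22 / 5) ^ 2 := by ring
        _ ≤ _ := by gcongr) (by linarith) hlogs
    rw [abs_sub_comm]
    convert key using 2
    rw [quadLog]
    ring
  have hcard := Finset.card_le_card_of_injOn (s := Finset.Icc ⌈s⌉₊ ⌊s + s / (4 * Y)⌋₊ \ E)
    (fun m => (m, n)) hgood (fun a _ b _ h => congrArg Prod.fst h)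
  have hsd := Finset.le_card_sdiff E (Finset.Icc ⌈s⌉₊ ⌊s + s / (4 * Y)⌋₊)
  rw [Nat.card_Icc] at hsd
  have h5 : ⌊s + s / (4 * Y)⌋₊ + 1 ≤ (A.filter fun a => |u - (quadLog α (a, (d, k)) +
            (2 * Real.log Y - 2 * Real.log z))| ≤ 1 / (Y : ℝ) ∧ a.2 = n).card + 3 * Y ^ 20 + ⌈s⌉₊ := by
    omega
  have h6 : (⌊s + s / (4 * Y)⌋₊ : ℝ) + 1 ≤ ((A.filter fun a => |u - (quadLog α (a, (d, k)) +
            (2 * Real.log Y - 2 * Real.log z))| ≤ 1 / (Y : ℝ) ∧ a.2 = n).card : ℝ) +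
            3 * (Y : ℝ) ^ 20 + ⌈s⌉₊ := by
    exact_mod_cast h5
  have h7 := Nat.lt_floor_add_one (s + s / (4 * Y))
  have h8 := Nat.ceil_lt_add_one hs0.le
  have h9 : (Y : ℝ) ^ 21 = Y ^ 20 * Y := by ring
  have h10 : (1 : ℝ) ≤ (Y : ℝ) ^ 20 := one_le_pow₀ (by linarith)
  nlinarith

theorem variance_bound_le {y g D K P C κ T t₁ R N e₁ e₂ : ℝ} (hg : 1 ≤ g) (hgy : g ≤ y)
    (hD : y ^ 20 ≤ g * D) (hK : y ^ 42 ≤ g * K) (hD' : D ≤ 3 * y ^ 20) (hK' : K ≤ 3 * y ^ 42)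
    (hP0 : 0 ≤ P) (hP : P ≤ 7 * y ^ 42 * (D * K)) (hκ : 0 < κ) (hC : 0 ≤ C) (hT : T = y ^ 104 * g)
    (ht : 0 ≤ t₁) (ht' : t₁ ^ 2 = y) (hR : R = y / g ^ 6) (hN : N = C * y ^ 104 * g)
    (he₁ : 0 ≤ e₁) (he₁' : y ^ 200 * e₁ ≤ 1) (he₂ : 0 ≤ e₂) (he₂' : y ^ 200 * e₂ ≤ 1) :
    (2 * t₁ * (Real.pi * t₁ ^ 2 / y ^ 2) ^ 2 * (P * y) ^ 2 + R ^ 2 * (T * (N + P ^ 2 * e₁)) +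
      (P * y) ^ 2 * (e₂ * T)) / (κ * (y ^ 43 * (D * K)) / 2) ^ 2 ≤
      (4 * (C + 8000) / κ ^ 2) * g⁻¹ := by
  have hy : 1 ≤ y := hg.trans hgy
  have hg0 : 0 < g := by linarith
  have hy0 : 0 < y := by linarith
  have hD0 : 0 < D := by
    by_contra h
    have : g * D ≤ 0 := mul_nonpos_of_nonneg_of_nonpos hg0.le (not_lt.1 h)
    linarith [show 0 < y ^ 20 by positivity]
  have hK0 : 0 < K := by
    by_contra h
    have : g * K ≤ 0 := mul_nonpos_of_nonneg_of_nonpos hg0.le (not_lt.1 h)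
    linarith [show 0 < y ^ 42 by positivity]
  set L := y ^ 43 * (D * K) with hL
  have hL0 : 0 < L := by positivity
  have hPy : P * y ≤ 7 * L := by
    calc P * y ≤ 7 * y ^ 42 * (D * K) * y := by gcongr
      _ = _ := by rw [hL]; ring
  have hPyL : (P * y) ^ 2 ≤ 49 * L ^ 2 := by
    calc (P * y) ^ 2 ≤ (7 * L) ^ 2 := by gcongr
      _ = _ := by ring
  have ht1y : t₁ ≤ y := by nlinarith [sq_nonneg (t₁ - 1)]
  have hπ : Real.pi ^ 2 ≤ 16 := by nlinarith [Real.pi_le_four, Real.pi_pos]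
  have hginv : y⁻¹ ≤ g⁻¹ := inv_anti₀ hg0 hgy
  have h1 : 2 * t₁ * (Real.pi * t₁ ^ 2 / y ^ 2) ^ 2 * (P * y) ^ 2 ≤ 1568 * L ^ 2 * g⁻¹ := by
    calc _ ≤ 2 * y * (Real.pi * t₁ ^ 2 / y ^ 2) ^ 2 * (49 * L ^ 2) := by gcongr
      _ = 98 * Real.pi ^ 2 * L ^ 2 * y⁻¹ := by rw [ht']; field_simp; norm_num
      _ ≤ 98 * 16 * L ^ 2 * g⁻¹ := by gcongr
      _ = _ := by ring
  have hTy : T ≤ y ^ 105 := by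
    calc T ≤ y ^ 104 * y := by rw [hT]; gcongr
      _ = _ := by ring
  have h3 : (P * y) ^ 2 * (e₂ * T) ≤ 49 * L ^ 2 * g⁻¹ := by
    have hT0 : 0 ≤ T := by rw [hT]; positivity
    have : e₂ * T ≤ g⁻¹ := by
      refine le_trans ?_ hginv
      rw [← one_div, le_div_iff₀ hy0]
      calc e₂ * T * y ≤ e₂ * y ^ 105 * y := by gcongr
        _ = y ^ 106 * e₂ := by ring
        _ ≤ y ^ 200 * e₂ := by gcongr; norm_num
        _ ≤ 1 := he₂'
    gcongr
  have hPle : P ^ 2 * e₁ ≤ 3969 * y ^ 104 * g := by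
    have hP' : P ≤ 63 * y ^ 104 := by
      calc P ≤ 7 * y ^ 42 * (3 * y ^ 20 * (3 * y ^ 42)) := hP.trans (by gcongr)
        _ = _ := by ring
    calc P ^ 2 * e₁ ≤ (63 * y ^ 104) ^ 2 * e₁ := by gcongr
      _ = 3969 * y ^ 8 * (y ^ 200 * e₁) := by ring
      _ ≤ 3969 * y ^ 104 * g := by
        refine mul_le_mul (mul_le_mul_of_nonneg_left ?_ (by norm_num)) (he₁'.trans hg)
          (mul_nonneg (pow_nonneg hy0.le _) he₁)
          (mul_nonneg (by norm_num) (pow_nonneg hy0.le _))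
        exact pow_le_pow_right₀ hy (by norm_num)
  have h2 : R ^ 2 * (T * (N + P ^ 2 * e₁)) ≤ (C + 3969) * L ^ 2 * g⁻¹ := by
    have hL2 : y ^ 210 ≤ g ^ 4 * L ^ 2 := by
      calc y ^ 210 = (y ^ 43) ^ 2 * (y ^ 20) ^ 2 * (y ^ 42) ^ 2 := by ring
        _ ≤ (y ^ 43) ^ 2 * (g * D) ^ 2 * (g * K) ^ 2 := by gcongr
        _ = _ := by rw [hL]; ring
    have hT0 : 0 ≤ T := by rw [hT]; positivity
    calc R ^ 2 * (T * (N + P ^ 2 * e₁)) ≤ R ^ 2 * (T * (C * y ^ 104 * g + 3969 * y ^ 104 * g)) := by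
          rw [hN]; gcongr
      _ = (C + 3969) * y ^ 210 / g ^ 10 := by rw [hT, hR]; field_simp
      _ ≤ (C + 3969) * (g ^ 4 * L ^ 2) / g ^ 5 := by gcongr; norm_num
      _ = _ := by field_simp
  rw [div_le_iff₀ (by positivity)]
  calc _ ≤ 1568 * L ^ 2 * g⁻¹ + (C + 3969) * L ^ 2 * g⁻¹ + 49 * L ^ 2 * g⁻¹ := by gcongr
    _ = (C + 5586) * L ^ 2 * g⁻¹ := by ring
    _ ≤ (C + 8000) * L ^ 2 * g⁻¹ := by gcongr; norm_num
    _ = _ := by field_simp; norm_num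

theorem le_sum_gaussianBump {α : ℝ} (hα : 0 < α) : ∃ Y₀ : ℕ, ∀ Y : ℕ, Y₀ ≤ Y →
    ∀ A : Finset (ℕ × ℕ), (∀ x ∈ A, 1 ≤ x.2 ∧ x.2 ≤ Y ^ 20) →
      (∀ n ∈ Finset.Icc 1 (Y ^ 20), ((Finset.range (7 * Y ^ 22 + 1)).filter
        fun m => Y ^ 22 ≤ 5 * m ∧ (m, n) ∉ A).card ≤ 3 * Y ^ 20) →
      ∀ u ∈ Set.Icc (-Real.log 2) 0,
        Real.exp (-Real.pi) / 40 *
          ((Y : ℝ) ^ 43 * ((primesIoc (Y ^ 20)).card * (primesIoc (Y ^ 42)).card : ℝ)) ≤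
        ∑ p ∈ A ×ˢ (primesIoc (Y ^ 20) ×ˢ primesIoc (Y ^ 42)), ∑ z ∈ Finset.Ioc Y (2 * Y),
          gaussianBump Y (u - (quadLog α p + (2 * Real.log Y - 2 * Real.log z))) := by
  obtain ⟨Y₀, h⟩ := le_card_filter_close hα
  refine ⟨Y₀ + 1, fun Y hY A hA hexc u hu => ?_⟩
  have hY0 : (0 : ℝ) < Y := by exact_mod_cast (by omega : 0 < Y)
  rw [Finset.sum_product_right]
  have key : ∀ q ∈ primesIoc (Y ^ 20) ×ˢ primesIoc (Y ^ 42), ∀ z ∈ Finset.Ioc Y (2 * Y),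
      Real.exp (-Real.pi) / 40 * (Y : ℝ) ^ 42 ≤
        ∑ a ∈ A, gaussianBump Y (u - (quadLog α (a, q) + (2 * Real.log Y - 2 * Real.log z))) := by
    intro q hq z hz
    obtain ⟨hq1, hq2⟩ := Finset.mem_product.1 hq
    set G := A.filter fun a => |u - (quadLog α (a, q) +
            (2 * Real.log Y - 2 * Real.log z))| ≤ 1 / (Y : ℝ) with hG
    have hcard : (Y : ℝ) ^ 41 / 40 ≤ (G.card : ℝ) := by
      have hm : ∀ a ∈ G, a.2 ∈ Finset.Icc 1 (Y ^ 20) := fun a ha =>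
        Finset.mem_Icc.2 (hA a (Finset.mem_filter.1 ha).1)
      have := Finset.card_nsmul_le_sum (Finset.Icc 1 (Y ^ 20))
        (fun n => ((G.filter fun a => a.2 = n).card : ℝ)) ((Y : ℝ) ^ 21 / 40) (fun n hn => by
          have := h Y (by omega) A hexc u hu q.1 hq1 q.2 hq2 z hz n hn
          rwa [hG, Finset.filter_filter])
      rw [Finset.card_eq_sum_card_fiberwise hm]
      push_cast
      refine le_trans (le_of_eq ?_) this
      simp only [Nat.card_Icc, Nat.add_sub_cancel, nsmul_eq_mul]
      push_cast; ring
    have hbump : ∀ a ∈ G, (Y : ℝ) * Real.exp (-Real.pi) ≤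
        gaussianBump Y (u - (quadLog α (a, q) + (2 * Real.log Y - 2 * Real.log z))) := by
      intro a ha
      have h1 := (Finset.mem_filter.1 ha).2
      rw [gaussianBump]
      gcongr
      have h2 : (Y : ℝ) ^ 2 * (u - (quadLog α (a, q) + (2 * Real.log Y - 2 * Real.log z))) ^ 2 ≤ 1 := by
        rw [← sq_abs (u - _)]
        calc _ ≤ (Y : ℝ) ^ 2 * (1 / (Y : ℝ)) ^ 2 := by gcongr
          _ = 1 := by field_simp
      nlinarith [Real.pi_pos]
    calc Real.exp (-Real.pi) / 40 * (Y : ℝ) ^ 42 = (Y : ℝ) ^ 41 / 40 * (Y * Real.exp (-Real.pi)) := by ring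
      _ ≤ G.card * (Y * Real.exp (-Real.pi)) := by gcongr
      _ = G.card • (Y * Real.exp (-Real.pi)) := by rw [nsmul_eq_mul]
      _ ≤ ∑ a ∈ G, gaussianBump Y (u - (quadLog α (a, q) + (2 * Real.log Y - 2 * Real.log z))) :=
        Finset.card_nsmul_le_sum _ _ _ hbump
      _ ≤ _ := Finset.sum_le_sum_of_subset_of_nonneg (Finset.filter_subset _ _) fun a _ _ => by
          rw [gaussianBump]; positivity
  calc _ = ∑ q ∈ primesIoc (Y ^ 20) ×ˢ primesIoc (Y ^ 42), ∑ z ∈ Finset.Ioc Y (2 * Y),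
        Real.exp (-Real.pi) / 40 * (Y : ℝ) ^ 42 := by
        simp only [Finset.sum_const, Finset.card_product, Nat.card_Ioc, nsmul_eq_mul]
        have : 2 * Y - Y = Y := by omega
        rw [this]; push_cast; ring
    _ ≤ ∑ q ∈ primesIoc (Y ^ 20) ×ˢ primesIoc (Y ^ 42), ∑ z ∈ Finset.Ioc Y (2 * Y),
        ∑ a ∈ A, gaussianBump Y (u - (quadLog α (a, q) + (2 * Real.log Y - 2 * Real.log z))) :=
      Finset.sum_le_sum fun q hq => Finset.sum_le_sum fun z hz => key q hq z hz
    _ = _ := Finset.sum_congr rfl fun q _ => Finset.sum_comm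

theorem exists_int_triple_of_close {α u : ℝ} {Y m n d k z : ℕ} (hY : 0 < Y) (hu : u ≤ 0)
    (hpos : 0 < (m : ℝ) ^ 2 - α * (n : ℝ) ^ 2) (hm : m ≤ 7 * Y ^ 22) (hn : n ≤ Y ^ 20)
    (hd0 : 0 < d) (hd : d ≤ 3 * Y ^ 20) (hk0 : 0 < k) (hk : k ≤ 3 * Y ^ 42) (hz0 : 0 < z)
    (hz : z ≤ 2 * Y)
    (h : |u - (quadLog α ((m, n), (d, k)) + (2 * Real.log Y - 2 * Real.log z))| ≤ 1 / (Y : ℝ) ^ 104) :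
    ∃ x₁ x₂ x₃ : ℤ, x₃ ≠ 0 ∧
      max |(x₁ : ℝ)| (max |(x₂ : ℝ)| |(x₃ : ℝ)|) ≤ 21 * (Y : ℝ) ^ 43 ∧
      |(x₁ : ℝ) ^ 2 - α * (x₂ : ℝ) ^ 2 - Real.exp u * (x₃ : ℝ) ^ 2| ≤ 72 / (Y : ℝ) ^ 18 := by
  have hY1 : (1 : ℝ) ≤ Y := by exact_mod_cast hY
  have hY0 : (0 : ℝ) < Y := by linarith
  have hd0' : (0 : ℝ) < d := by exact_mod_cast hd0
  have hk0' : (0 : ℝ) < k := by exact_mod_cast hk0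
  have hz0' : (0 : ℝ) < z := by exact_mod_cast hz0
  have hm' : (m : ℝ) ≤ 7 * (Y : ℝ) ^ 22 := by exact_mod_cast hm
  have hn' : (n : ℝ) ≤ (Y : ℝ) ^ 20 := by exact_mod_cast hn
  have hd' : (d : ℝ) ≤ 3 * (Y : ℝ) ^ 20 := by exact_mod_cast hd
  have hk' : (k : ℝ) ≤ 3 * (Y : ℝ) ^ 42 := by exact_mod_cast hk
  have hz' : (z : ℝ) ≤ 2 * Y := by exact_mod_cast hz
  refine ⟨(d * m * Y : ℕ), (d * n * Y : ℕ), (k * z : ℕ), by positivity, ?_, ?_⟩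
  · simp only [Int.cast_natCast, Nat.abs_cast]
    push_cast
    refine max_le ?_ (max_le ?_ ?_)
    · calc (d : ℝ) * m * Y ≤ 3 * (Y : ℝ) ^ 20 * (7 * (Y : ℝ) ^ 22) * Y := by gcongr
        _ = _ := by ring
    · calc (d : ℝ) * n * Y ≤ 3 * (Y : ℝ) ^ 20 * (Y : ℝ) ^ 20 * Y := by gcongr
        _ = 3 * (Y : ℝ) ^ 41 := by ring
        _ ≤ _ := by gcongr <;> norm_num
    · calc (k : ℝ) * z ≤ 3 * (Y : ℝ) ^ 42 * (2 * Y) := by gcongr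
        _ = 6 * (Y : ℝ) ^ 43 := by ring
        _ ≤ _ := by gcongr <;> norm_num
  · have hexp : Real.exp u ≤ 1 := Real.exp_le_one_iff.2 hu
    have key := abs_sub_le_of_abs_log_sub_log_le
      (x := ((m : ℝ) ^ 2 - α * (n : ℝ) ^ 2) * ((d : ℝ) ^ 2 * (Y : ℝ) ^ 2))
      (y := Real.exp u * ((k : ℝ) ^ 2 * (z : ℝ) ^ 2)) (δ := 1 / (Y : ℝ) ^ 104)
      (B := 36 * (Y : ℝ) ^ 86) (by positivity) (by positivity) (by
        calc _ ≤ 1 * ((3 * (Y : ℝ) ^ 42) ^ 2 * (2 * Y) ^ 2) := by gcongr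
          _ = _ := by ring) (by
        rw [div_le_one (by positivity)]; exact one_le_pow₀ hY1) (by
        rw [Real.log_mul hpos.ne' (by positivity), Real.log_mul (by positivity) (by positivity),
          Real.log_mul (by positivity) (by positivity), Real.log_mul (by positivity) (by positivity),
          Real.log_exp, Real.log_pow, Real.log_pow, Real.log_pow, Real.log_pow, abs_sub_comm]
        rw [quadLog] at h
        convert h using 2
        push_cast; ring)
    have e : 2 * (1 / (Y : ℝ) ^ 104) * (36 * (Y : ℝ) ^ 86) = 72 / (Y : ℝ) ^ 18 := by
      field_simp; norm_num
    rw [e] at key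
    convert key using 2
    push_cast; ring

theorem eventually_pow_mul_exp_neg_rpow_le {δ : ℝ} (hδ : 0 < δ) (n : ℕ) :
    ∀ᶠ y : ℝ in atTop, y ^ n * Real.exp (-y ^ δ) ≤ 1 := by
  obtain ⟨k, hk⟩ := exists_nat_ge ((n : ℝ) / δ)
  have h1 := (Real.tendsto_pow_mul_exp_neg_atTop_nhds_zero k).comp (tendsto_rpow_atTop hδ)
  filter_upwards [h1.eventually_le_const one_pos, eventually_ge_atTop 1] with y hy hy1
  refine le_trans ?_ hy
  simp only [Function.comp]
  gcongr
  rw [← Real.rpow_natCast, ← Real.rpow_natCast, ← Real.rpow_mul (by linarith)]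
  apply Real.rpow_le_rpow_of_exponent_le hy1
  rwa [div_le_iff₀ hδ, mul_comm] at hk

theorem eventually_log_le_rpow {δ : ℝ} (hδ : 0 < δ) :
    ∀ᶠ y : ℝ in atTop, 4 * Real.log (3 * y ^ 42) ≤ y ^ δ := by
  have h := (isLittleO_log_rpow_atTop hδ).bound (by norm_num : (0 : ℝ) < 1 / 172)
  filter_upwards [h, eventually_ge_atTop 3] with y hy hy3
  rw [Real.norm_of_nonneg (Real.log_nonneg (by linarith)),
    Real.norm_of_nonneg (Real.rpow_nonneg (by linarith) _)] at hy
  have : Real.log (3 * y ^ 42) ≤ 43 * Real.log y := by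
    calc Real.log (3 * y ^ 42) ≤ Real.log (y * y ^ 42) := by
          apply Real.log_le_log (by positivity); gcongr
      _ = Real.log (y ^ 43) := by ring_nf
      _ = _ := by rw [Real.log_pow]; norm_num
  linarith

theorem eventually_le_mul_card_primesIoc {δ : ℝ} (hδ : 0 < δ) : ∀ᶠ Y : ℕ in atTop,
    (Y : ℝ) ^ 20 ≤ (Y : ℝ) ^ δ * ((primesIoc (Y ^ 20)).card : ℝ) ∧
    (Y : ℝ) ^ 42 ≤ (Y : ℝ) ^ δ * ((primesIoc (Y ^ 42)).card : ℝ) := by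
  obtain ⟨X₀, hX⟩ := exists_many_primes_Ioc
  filter_upwards [tendsto_natCast_atTop_atTop.eventually (eventually_log_le_rpow hδ),
    eventually_ge_atTop X₀, eventually_ge_atTop 1] with Y hY hYX hY1
  have hYR : (1 : ℝ) ≤ Y := by exact_mod_cast hY1
  have key : ∀ j : ℕ, j ≠ 0 → j ≤ 42 →
      (Y : ℝ) ^ j ≤ (Y : ℝ) ^ δ * ((primesIoc (Y ^ j)).card : ℝ) := by
    intro j hj hj'
    have h1 := hX (Y ^ j) (hYX.trans (Nat.le_self_pow hj Y))
    have hjR : (1 : ℝ) ≤ (Y : ℝ) ^ j := one_le_pow₀ hYR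
    push_cast at h1
    have h2 : 0 < Real.log (3 * (Y : ℝ) ^ j) := Real.log_pos (by linarith)
    have h3 : Real.log (3 * (Y : ℝ) ^ j) ≤ Real.log (3 * (Y : ℝ) ^ 42) :=
      Real.log_le_log (by positivity) (by gcongr)
    rw [div_le_iff₀ (by positivity)] at h1
    rw [primesIoc]
    refine h1.trans ?_
    rw [mul_comm]
    gcongr
    linarith
  exact ⟨key 20 (by norm_num) (by norm_num), key 42 (by norm_num) (by norm_num)⟩

theorem norm_sum_exp_log_div_eq (Y : ℕ) (t : ℝ) :
    ‖∑ z ∈ Finset.Ioc Y (2 * Y), Complex.exp (Complex.I *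
      ((2 * Real.pi * t * (2 * Real.log Y - 2 * Real.log z) : ℝ) : ℂ))‖ =
    ‖∑ z ∈ Finset.Ioc Y (2 * Y), Complex.exp (Complex.I *
      ((-(4 * Real.pi * t) * Real.log z : ℝ) : ℂ))‖ := by
  have h : ∀ z : ℕ, Complex.exp (Complex.I *
      ((2 * Real.pi * t * (2 * Real.log Y - 2 * Real.log z) : ℝ) : ℂ)) =
      Complex.exp (((4 * Real.pi * t * Real.log Y : ℝ) : ℂ) * Complex.I) * Complex.exp (Complex.I *
      ((-(4 * Real.pi * t) * Real.log z : ℝ) : ℂ)) := by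
    intro z
    rw [← Complex.exp_add]
    congr 1
    push_cast; ring
  simp_rw [h]
  rw [← Finset.mul_sum, norm_mul, Complex.norm_exp_ofReal_mul_I, one_mul]

/-- The exponents `u` for which the form `x₁² - α x₂² - eᵘ x₃²` takes no value of size
`72 Y⁻¹⁸` at integer points of height at most `21 Y⁴³`. -/
def exceptionalExponents (α : ℝ) (Y : ℕ) : Set ℝ :=
  {u ∈ Set.Icc (-Real.log 2) 0 | ¬ ∃ x₁ x₂ x₃ : ℤ, x₃ ≠ 0 ∧
      max |(x₁ : ℝ)| (max |(x₂ : ℝ)| |(x₃ : ℝ)|) ≤ 21 * (Y : ℝ) ^ 43 ∧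
      |(x₁ : ℝ) ^ 2 - α * (x₂ : ℝ) ^ 2 - Real.exp u * (x₃ : ℝ) ^ 2| ≤ 72 / (Y : ℝ) ^ 18}

set_option maxHeartbeats 1000000 in
theorem volume_exceptionalExponents_le {α : ℝ} (hα : 0 < α) : ∃ δ C : ℝ, 0 < δ ∧ 0 ≤ C ∧
    ∀ᶠ Y : ℕ in atTop,
      volume (exceptionalExponents α Y) ≤ ENNReal.ofReal (C * ((Y : ℝ) ^ δ)⁻¹) := by
  obtain ⟨c₀, hc₀, Y₁, -, hW⟩ := norm_sum_exp_log_le 106 (by norm_num)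
  set c := min c₀ 1 with hc
  have hc0 : 0 < c := lt_min hc₀ one_pos
  set δ := c / 6 with hδ
  have hδ0 : 0 < δ := by positivity
  have hδ1 : δ ≤ 1 / 6 := by rw [hδ]; linarith [min_le_right c₀ 1]
  obtain ⟨C, Y₂, hC, hP⟩ := card_close_quadLog_le hα hδ0
  obtain ⟨Y₃, hL⟩ := le_sum_gaussianBump hα
  set κ := Real.exp (-Real.pi) / 40 with hκ
  have hκ0 : 0 < κ := by positivity
  refine ⟨δ, 4 * (C + 8000) / κ ^ 2, hδ0, by positivity, ?_⟩
  have hcast : Tendsto (fun n : ℕ => (n : ℝ)) atTop atTop := tendsto_natCast_atTop_atTop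
  filter_upwards [hcast.eventually (eventually_pow_mul_exp_neg_rpow_le (δ := 2 * δ) (by positivity) 200),
    eventually_le_mul_card_primesIoc hδ0, hcast.eventually (eventually_ge_atTop Y₁),
    eventually_ge_atTop Y₂, eventually_ge_atTop Y₃, eventually_ge_atTop 16,
    hcast.eventually (eventually_ge_atTop (14 / κ))] with Y hexp hprimes hY₁ hY₂ hY₃ hY16 hYκ
  obtain ⟨A, hrange, hexc, hAc, hpos, hpairs⟩ := hP Y hY₂
  set P := A ×ˢ (primesIoc (Y ^ 20) ×ˢ primesIoc (Y ^ 42)) with hPdef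
  set y : ℝ := (Y : ℝ) with hy
  have hy16 : 16 ≤ y := by rw [hy]; exact_mod_cast hY16
  have hy0 : 0 < y := by linarith
  set g := y ^ δ with hg
  have hg1 : 1 ≤ g := Real.one_le_rpow (by linarith) hδ0.le
  have hg0 : 0 < g := by linarith
  have hg6 : g ^ 6 = y ^ c := by
    rw [hg, ← Real.rpow_natCast, ← Real.rpow_mul hy0.le]
    congr 1; rw [hδ]; push_cast; ring
  have hg2 : g ^ 2 = y ^ (2 * δ) := by
    rw [hg, ← Real.rpow_natCast, ← Real.rpow_mul hy0.le]
    congr 1; push_cast; ring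
  have hg2y : g ^ 2 ≤ y := by
    rw [hg2]
    calc y ^ (2 * δ) ≤ y ^ (1 : ℝ) := Real.rpow_le_rpow_of_exponent_le (by linarith) (by linarith)
      _ = y := Real.rpow_one y
  have hgy : g ≤ y := (le_self_pow₀ hg1 two_ne_zero).trans hg2y
  rw [← hg2] at hexp
  set D : ℝ := ((primesIoc (Y ^ 20)).card : ℝ) with hD
  set K : ℝ := ((primesIoc (Y ^ 42)).card : ℝ) with hK
  have hD' : D ≤ 3 * y ^ 20 := by rw [hD, hy]; exact_mod_cast card_primesIoc_le (Y ^ 20)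
  have hK' : K ≤ 3 * y ^ 42 := by rw [hK, hy]; exact_mod_cast card_primesIoc_le (Y ^ 42)
  have hD0 : 0 < D := by
    by_contra h
    have : g * D ≤ 0 := mul_nonpos_of_nonneg_of_nonpos hg0.le (not_lt.1 h)
    linarith [hprimes.1, show 0 < y ^ 20 by positivity]
  have hK0 : 0 < K := by
    by_contra h
    have : g * K ≤ 0 := mul_nonpos_of_nonneg_of_nonpos hg0.le (not_lt.1 h)
    linarith [hprimes.2, show 0 < y ^ 42 by positivity]
  have hPc : (P.card : ℝ) ≤ 7 * y ^ 42 * (D * K) := by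
    rw [hPdef, Finset.card_product, Finset.card_product]
    push_cast
    gcongr
    rw [hy]
    exact_mod_cast hAc
  have hZc : ((Finset.Ioc Y (2 * Y)).card : ℝ) = y := by
    rw [Nat.card_Ioc, (by omega : 2 * Y - Y = Y)]
  have hexpπ : ∀ θ : ℝ, 1 ≤ θ → y ^ 200 * Real.exp (-(θ * g ^ 2)) ≤ 1 := by
    intro θ hθ
    refine le_trans ?_ hexp
    gcongr
    exact le_mul_of_one_le_left (by positivity) hθ
  set T := y ^ 104 * g with hT
  have hT0 : 0 < T := by positivity
  have hTr : T * (1 / y ^ 104) = g := by rw [hT]; field_simp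
  have htT : (T * g) ^ 2 / T ^ 2 = g ^ 2 := by field_simp
  have hTy : T ≤ y ^ 105 := by
    calc T ≤ y ^ 104 * y := by rw [hT]; gcongr
      _ = _ := by ring
  have hsq : Real.sqrt y ^ 2 = y := Real.sq_sqrt hy0.le
  have hmain := volume_gap_le P (Finset.Ioc Y (2 * Y)) (quadLog α)
    (fun z : ℕ => 2 * Real.log Y - 2 * Real.log z) T y (1 / y ^ 104) (Real.sqrt y) (T * g)
    (y / g ^ 6) (κ * (y ^ 43 * (D * K))) (C * y ^ 104 * g) hy0 (by
      rw [hT]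
      calc y = y * 1 := (mul_one y).symm
        _ ≤ y ^ 104 * g := by
          gcongr
          exact le_self_pow₀ (by linarith) (by norm_num)) (by positivity)
    (Real.sqrt_nonneg y) (by positivity) (by positivity) (by
      intro t ht1 ht2
      rw [norm_sum_exp_log_div_eq]
      have habs : |-(4 * Real.pi * t)| = 4 * Real.pi * |t| := by
        rw [abs_neg, abs_mul, abs_of_pos (by positivity)]
      refine (hW Y hY₁ (-(4 * Real.pi * t)) ?_ ?_).trans ?_
      · rw [habs, ← Real.sqrt_eq_rpow]
        refine ht1.trans (le_mul_of_one_le_left (abs_nonneg t) ?_)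
        linarith [Real.pi_gt_three]
      · rw [habs]
        have e : (Y : ℝ) ^ (106 : ℝ) = y ^ 106 := by
          rw [hy, ← Real.rpow_natCast]; norm_num
        rw [e]
        calc 4 * Real.pi * |t| ≤ 4 * 4 * (T * g) :=
            mul_le_mul (by linarith [Real.pi_le_four]) ht2 (abs_nonneg t) (by norm_num)
          _ = 16 * (y ^ 104 * g ^ 2) := by rw [hT]; ring
          _ ≤ y * (y ^ 104 * y) := by gcongr
          _ = _ := by ring
      · rw [hg6, Real.rpow_sub hy0, Real.rpow_one]
        gcongr
        · linarith
        · exact min_le_left _ _)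
    (Set.Icc (-Real.log 2) 0)
    (fun u hu => hL Y hY₃ A (fun x hx => ⟨(hrange x hx).1, (hrange x hx).2.1⟩) hexc u hu)
    (by
      rw [hZc, (by rw [← hTr]; ring : -Real.pi * T ^ 2 * (1 / y ^ 104) ^ 2 = -(Real.pi * g ^ 2))]
      have h1 := hexpπ Real.pi (by linarith [Real.pi_gt_three])
      have h2 : T * Real.exp (-(Real.pi * g ^ 2)) ≤ 1 / y := by
        rw [le_div_iff₀ hy0]
        calc T * Real.exp (-(Real.pi * g ^ 2)) * y ≤ y ^ 105 * Real.exp (-(Real.pi * g ^ 2)) * y := by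
              gcongr
          _ = y ^ 106 * Real.exp (-(Real.pi * g ^ 2)) := by ring
          _ ≤ y ^ 200 * Real.exp (-(Real.pi * g ^ 2)) := by
              gcongr
              · linarith
              · norm_num
          _ ≤ 1 := h1
      calc _ ≤ 7 * y ^ 42 * (D * K) * y * (1 / y) := by gcongr
        _ = y ^ 42 * (D * K) * 7 := by field_simp
        _ ≤ y ^ 42 * (D * K) * (κ * y / 2) := by
            gcongr
            have := hYκ
            rw [div_le_iff₀ hκ0] at this
            linarith
        _ = _ := by ring) hpairs
  refine (measure_mono ?_).trans (hmain.trans (ENNReal.ofReal_le_ofReal ?_))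
  · rintro u ⟨hu, hno⟩
    refine ⟨hu, fun p hp z hz => ?_⟩
    by_contra hcon
    apply hno
    simp only [hPdef, Finset.mem_product] at hp
    obtain ⟨hp1, hp2, hp3⟩ := hp
    obtain ⟨r1, r2, r3, r4⟩ := hrange _ hp1
    obtain ⟨⟨d1, d2⟩, -⟩ := mem_primesIoc.1 hp2
    obtain ⟨⟨k1, k2⟩, -⟩ := mem_primesIoc.1 hp3
    rw [Finset.mem_Ioc] at hz
    exact exists_int_triple_of_close (m := p.1.1) (n := p.1.2) (d := p.2.1) (k := p.2.2)
      (by omega) hu.2 (hpos _ hp1) r4 r2 (by omega) d2 (by omega) k2 (by omega) hz.2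
      (not_lt.1 hcon)
  · rw [hZc]
    refine variance_bound_le hg1 hgy hprimes.1 hprimes.2 hD' hK' (by positivity) hPc hκ0 hC.le hT
      (Real.sqrt_nonneg y) hsq rfl rfl (Real.exp_pos _).le ?_ (Real.exp_pos _).le ?_
    · have e : -(Real.pi * T ^ 2 * (1 / y ^ 104) ^ 2 / 2) = -(Real.pi / 2 * g ^ 2) := by
        rw [← hTr]; ring
      rw [e]
      exact hexpπ _ (by linarith [Real.pi_gt_three])
    · have e : -Real.pi * (T * g) ^ 2 / T ^ 2 = -(Real.pi * g ^ 2) := by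
        rw [← htT]; ring
      rw [e]
      exact hexpπ _ (by linarith [Real.pi_gt_three])

theorem exists_ae_eventually_notMem_exceptionalExponents {α : ℝ} (hα : 0 < α) :
    ∀ᵐ u : ℝ, ∀ᶠ j : ℕ in atTop, u ∉ exceptionalExponents α (2 ^ j) := by
  obtain ⟨δ, C, hδ, hC, h⟩ := volume_exceptionalExponents_le hα
  obtain ⟨J, hJ⟩ := eventually_atTop.1
    ((tendsto_pow_atTop_atTop_of_one_lt (one_lt_two : (1 : ℕ) < 2)).eventually h)
  have hq0 : 0 < ((2 : ℝ) ^ δ)⁻¹ := by positivity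
  have hq1 : ((2 : ℝ) ^ δ)⁻¹ < 1 := inv_lt_one_of_one_lt₀ (Real.one_lt_rpow one_lt_two hδ)
  have hsum : Summable fun j : ℕ => C * (((2 : ℝ) ^ δ)⁻¹) ^ (j + J) :=
    (((summable_geometric_of_lt_one hq0.le hq1).comp_injective (add_left_injective J))).mul_left C
  have hfin : ∑' j, volume (exceptionalExponents α (2 ^ (j + J))) ≠ ⊤ := by
    refine ne_top_of_le_ne_top hsum.tsum_ofReal_ne_top (ENNReal.tsum_le_tsum fun j => ?_)
    refine (hJ (j + J) (Nat.le_add_left J j)).trans (le_of_eq ?_)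
    congr 2
    rw [inv_pow, ← Real.rpow_natCast ((2 : ℝ) ^ δ), ← Real.rpow_mul two_pos.le, mul_comm,
      Real.rpow_mul two_pos.le, Real.rpow_natCast]
    push_cast; rfl
  filter_upwards [ae_eventually_notMem hfin] with u hu
  obtain ⟨K, hK⟩ := eventually_atTop.1 hu
  refine eventually_atTop.2 ⟨K + J, fun j hj => ?_⟩
  have h' := hK (j - J) (by omega)
  rwa [Nat.sub_add_cancel (by omega)] at h'

theorem one_div_pow_le_rpow_neg {N Y ε : ℝ} (hε : 0 ≤ ε) (hN : 1 ≤ N) (hY : 1 ≤ Y)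
    (h : N ≤ 2 ^ 50 * Y ^ 45) : 1 / Y ^ 18 ≤ 2 ^ 20 * N ^ (-(2 : ℝ) / 5 + ε) := by
  have hN0 : 0 < N := by linarith
  have h1 : N ^ ((2 : ℝ) / 5) ≤ 2 ^ 20 * Y ^ 18 := by
    calc N ^ ((2 : ℝ) / 5) ≤ ((2 ^ 10 * Y ^ 9) ^ 5) ^ ((2 : ℝ) / 5) := by
          gcongr
          refine h.trans (le_of_eq ?_)
          ring
      _ = (2 ^ 10 * Y ^ 9) ^ 2 := by
          rw [← Real.rpow_natCast, ← Real.rpow_natCast, ← Real.rpow_mul (by positivity)]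
          norm_num
      _ = _ := by ring
  have h2 : N ^ (-(2 : ℝ) / 5) ≤ N ^ (-(2 : ℝ) / 5 + ε) :=
    Real.rpow_le_rpow_of_exponent_le hN (by linarith)
  refine le_trans ?_ (mul_le_mul_of_nonneg_left h2 (by positivity))
  rw [neg_div, Real.rpow_neg hN0.le, ← div_eq_mul_inv, div_le_div_iff₀ (by positivity) (by positivity)]
  linarith

/-- Bourgain's unconditional uniform effective Oppenheim bound for diagonal ternary
quadratic forms: for a.e. `α₃ ∈ [1/2,1]`,
`min_{0 < ‖x‖ ≤ N} |x₁² − α₂x₂² − α₃x₃²| ≪ N^{−2/5+ε}`. -/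
theorem stmt8 (ε : ℝ) (hε : 0 < ε) (α₂ : ℝ) (hα₂ : 0 < α₂) :
    ∀ᵐ α₃ ∂(volume.restrict (Set.Icc (1/2 : ℝ) 1)),
      ∃ C : ℝ, 0 < C ∧ ∀ᶠ N : ℝ in atTop, ∃ x₁ x₂ x₃ : ℤ,
        ¬(x₁ = 0 ∧ x₂ = 0 ∧ x₃ = 0) ∧
        max |(x₁ : ℝ)| (max |(x₂ : ℝ)| |(x₃ : ℝ)|) ≤ N ∧
        |(x₁ : ℝ) ^ 2 - α₂ * (x₂ : ℝ) ^ 2 - α₃ * (x₃ : ℝ) ^ 2| ≤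
          C * N ^ (-(2 : ℝ)/5 + ε) := by
  rw [ae_restrict_iff' measurableSet_Icc]
  have hnull : volume (Real.exp '' {u | ¬ ∀ᶠ j : ℕ in atTop,
      u ∉ exceptionalExponents α₂ (2 ^ j)}) = 0 :=
    addHaar_image_eq_zero_of_differentiableOn_of_addHaar_eq_zero volume
      Real.differentiable_exp.differentiableOn
      (ae_iff.1 (exists_ae_eventually_notMem_exceptionalExponents hα₂))
  filter_upwards [compl_mem_ae_iff.2 hnull] with α₃ hα₃ hmem
  have hα₃0 : 0 < α₃ := by linarith [hmem.1]
  have hev : ∀ᶠ j : ℕ in atTop, Real.log α₃ ∉ exceptionalExponents α₂ (2 ^ j) := by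
    by_contra hcon
    exact hα₃ ⟨Real.log α₃, hcon, Real.exp_log hα₃0⟩
  have hlog : Real.log α₃ ∈ Set.Icc (-Real.log 2) 0 := by
    refine ⟨?_, Real.log_nonpos hα₃0.le hmem.2⟩
    rw [← Real.log_inv]
    exact Real.log_le_log (by norm_num) (by linarith [hmem.1])
  obtain ⟨J, hJ⟩ := eventually_atTop.1 hev
  refine ⟨72 * 2 ^ 20, by norm_num, ?_⟩
  filter_upwards [eventually_ge_atTop (21 * (2 ^ 43 : ℝ) ^ J), eventually_ge_atTop 21] with N hN hN21
  obtain ⟨j, hj1, hj2⟩ := exists_nat_pow_near (x := N / 21) (y := (2 ^ 43 : ℝ)) (by linarith) (by norm_num)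
  have hJj : J ≤ j := by
    have h1 : (2 ^ 43 : ℝ) ^ J < (2 ^ 43 : ℝ) ^ (j + 1) :=
      lt_of_le_of_lt ((le_div_iff₀' (by norm_num)).2 hN) hj2
    have := (pow_lt_pow_iff_right₀ (by norm_num : (1 : ℝ) < 2 ^ 43)).1 h1
    omega
  have hY1 : (1 : ℝ) ≤ 2 ^ j := one_le_pow₀ one_le_two
  have hjY : ((2 ^ 43 : ℝ)) ^ j = ((2 : ℝ) ^ j) ^ 43 := by rw [← pow_mul, ← pow_mul, mul_comm]
  have hmem' := hJ j hJj
  simp only [exceptionalExponents, Set.mem_ofPred_eq, not_and, not_not] at hmem'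
  obtain ⟨x₁, x₂, x₃, h3, hmax, hQ⟩ := hmem' hlog
  push_cast at hmax hQ
  refine ⟨x₁, x₂, x₃, fun h => h3 h.2.2, ?_, ?_⟩
  · rw [hjY] at hj1
    linarith
  · rw [Real.exp_log hα₃0] at hQ
    have key := one_div_pow_le_rpow_neg hε.le (by linarith : (1 : ℝ) ≤ N) hY1 (by
      rw [pow_succ, hjY] at hj2
      have h43 : ((2 : ℝ) ^ j) ^ 43 ≤ ((2 : ℝ) ^ j) ^ 45 := pow_le_pow_right₀ hY1 (by norm_num)
      linarith)
    calc _ ≤ 72 / ((2 : ℝ) ^ j) ^ 18 := hQ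
      _ = 72 * (1 / ((2 : ℝ) ^ j) ^ 18) := by ring
      _ ≤ 72 * (2 ^ 20 * N ^ (-(2 : ℝ) / 5 + ε)) := by gcongr
      _ = _ := by ring
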